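/- Let d > 1 be a cube-free integer of one of the following forms, where p is a prime ≡ 4 or 7 (mod 9), q is a prime ≡ 2 or 5 (mod 9), and e, e₁, f₁ ∈ {1, 2}: d = p^{e₁}; or d = 3^{e} p^{e₁}; or d = p^{e₁} q^{f₁} ≡ ±1 (mod 9). Then the 3-class group C_{L,3} of the pure cubic field L = ℚ(∛d) is cyclic of order 3. -/

import Mathlib

open IntermediateField NumberField
open scoped nonZeroDivisors

set_option synthInstance.maxHeartbeats 1000000
set_option maxHeartbeats 2000000

noncomputable section

instance : Fact (Nat.Prime 3) := ⟨by norm_num⟩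

/-- A positive integer is cube-free if no prime cube divides it. -/
def IsCubeFree (d : ℕ) : Prop := ∀ p : ℕ, p.Prime → ¬ (p ^ 3 ∣ d)

/-- The primitive cube root of unity `ζ₃ = e^{2πi/3}`. -/
def zeta3 : ℂ := Complex.exp (2 * Real.pi * Complex.I / 3)

lemma zeta3_isPrimitiveRoot : IsPrimitiveRoot zeta3 3 := by
  simpa [zeta3] using Complex.isPrimitiveRoot_exp 3 (by norm_num)

lemma isIntegral_zeta3 : IsIntegral ℚ zeta3 :=
  (zeta3_isPrimitiveRoot.isIntegral (by norm_num)).tower_top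

/-- The real cube root of `d`, as a complex number. -/
def cbrt (d : ℕ) : ℂ := ((d : ℝ) ^ ((3 : ℝ)⁻¹) : ℝ)

lemma cbrt_pow_three (d : ℕ) : (cbrt d) ^ 3 = (d : ℂ) := by
  have h : ((d : ℝ) ^ ((3 : ℝ)⁻¹)) ^ (3 : ℕ) = (d : ℝ) := by
    rw [← Real.rpow_natCast ((d : ℝ) ^ ((3 : ℝ)⁻¹)) 3, ← Real.rpow_mul (by positivity)]
    norm_num
  calc (cbrt d) ^ 3 = (((((d : ℝ) ^ ((3 : ℝ)⁻¹)) ^ (3:ℕ) : ℝ)) : ℂ) := by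
        push_cast [cbrt]; ring
    _ = ((d : ℝ) : ℂ) := by rw [h]
    _ = (d : ℂ) := by norm_num

lemma isIntegral_cbrt (d : ℕ) : IsIntegral ℚ (cbrt d) := by
  have h : IsIntegral ℤ (cbrt d) := by
    refine ⟨Polynomial.X ^ 3 - Polynomial.C (d : ℤ), ?_, ?_⟩
    · exact Polynomial.monic_X_pow_sub_C _ (by norm_num)
    · simp [Polynomial.eval₂, cbrt_pow_three d]
  exact h.tower_top

/-- `L = ℚ(∛d)`, the pure cubic field, realized as a subfield of `ℂ`. -/
def Lc (d : ℕ) : IntermediateField ℚ ℂ := ℚ⟮cbrt d⟯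

instance (d : ℕ) : NumberField (Lc d) where
  to_finiteDimensional := by
    apply IntermediateField.finiteDimensional_adjoin
    rintro x rfl
    exact isIntegral_cbrt d

section
open IsDedekindDomain
open scoped WithZero

section Ord
variable {E : Type*} [Field E] [NumberField E]

/-- Additive valuation (up to sign) of `x` at a finite place of `E`. -/
noncomputable def ord (v : HeightOneSpectrum (𝓞 E)) (x : E) : ℤ := WithZero.log (v.valuation E x)

lemma ord_mul (v : HeightOneSpectrum (𝓞 E)) {x y : E} (hx : x ≠ 0) (hy : y ≠ 0) :
    ord v (x * y) = ord v x + ord v y := by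
  rw [ord, map_mul, WithZero.log_mul (by simpa) (by simpa)]; rfl

lemma ord_pow (v : HeightOneSpectrum (𝓞 E)) (x : E) (n : ℕ) :
    ord v (x ^ n) = n * ord v x := by
  rw [ord, map_pow, WithZero.log_pow]; simp [ord]

lemma ord_inv (v : HeightOneSpectrum (𝓞 E)) (x : E) : ord v x⁻¹ = - ord v x := by
  simp [ord, WithZero.log_inv]

@[simp] lemma ord_one (v : HeightOneSpectrum (𝓞 E)) : ord v (1 : E) = 0 := by
  simp [ord]

@[simp] lemma ord_neg (v : HeightOneSpectrum (𝓞 E)) (x : E) : ord v (-x) = ord v x := by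
  simp [ord, Valuation.map_neg]

lemma ord_eq_zero_of_notMem {v : HeightOneSpectrum (𝓞 E)} {x : 𝓞 E} (hx : x ∉ v.asIdeal) :
    ord v (x : E) = 0 := by
  simp [ord, (HeightOneSpectrum.valuation_eq_one_iff_notMem (K := E) v).2 hx]

lemma ord_neg_of_mem {v : HeightOneSpectrum (𝓞 E)} {x : 𝓞 E} (h0 : x ≠ 0) (hx : x ∈ v.asIdeal) :
    ord v (x : E) < 0 := by
  have h := (v.valuation_lt_one_iff_mem (K := E) x).2 hx
  rw [ord, ← WithZero.log_one, WithZero.log_lt_log (by simpa using h0) one_ne_zero]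
  exact h

lemma ord_eq_neg_multiplicity (v : HeightOneSpectrum (𝓞 E)) {x : 𝓞 E} (hx : x ≠ 0) :
    ord v (x : E) = - (multiplicity v.asIdeal (Ideal.span {x}) : ℤ) := by
  rw [ord, HeightOneSpectrum.valuation_of_algebraMap,
    HeightOneSpectrum.intValuation_eq_exp_neg_multiplicity _ hx, WithZero.log_exp]

lemma ideal_isCube {I : Ideal (𝓞 E)} (hI : I ≠ ⊥)
    (h : ∀ v : HeightOneSpectrum (𝓞 E), 3 ∣ multiplicity v.asIdeal I) : ∃ J : Ideal (𝓞 E), I = J ^ 3 := by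
  choose m hm using h
  refine ⟨∏ᶠ v : HeightOneSpectrum (𝓞 E), v.asIdeal ^ m v, ?_⟩
  rw [← Ideal.finprod_heightOneSpectrum_pow_multiplicity hI, finprod_pow]
  · refine finprod_congr fun v ↦ ?_
    rw [hm, mul_comm, pow_mul]
  · refine (Ideal.hasFiniteMulSupport hI).subset ?_
    intro v hv
    simp only [Function.mem_mulSupport] at hv ⊢
    intro h
    apply hv
    rw [HeightOneSpectrum.maxPowDividing_eq_pow_multiplicity hI, hm, mul_comm, pow_mul] at h
    rw [Ideal.one_eq_top] at h ⊢
    exact Ideal.pow_eq_top_iff.1 h |>.resolve_right (by norm_num)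

/-- An element is locally a cube (up to units) at every finite place. -/
def IsVirtualCube (x : E) : Prop := x ≠ 0 ∧ ∀ v : HeightOneSpectrum (𝓞 E), 3 ∣ ord v x

lemma IsVirtualCube.exists_ideal {x : 𝓞 E} (hx : IsVirtualCube (x : E)) :
    ∃ J : Ideal (𝓞 E), Ideal.span {x} = J ^ 3 := by
  have h0 : x ≠ 0 := by rintro rfl; exact hx.1 (by simp)
  refine ideal_isCube (by simpa) fun v ↦ ?_
  have := hx.2 v
  rw [ord_eq_neg_multiplicity v h0, dvd_neg] at this
  exact_mod_cast this

lemma multiplicity_pow_ideal (v : HeightOneSpectrum (𝓞 E)) {J : Ideal (𝓞 E)} (hJ : J ≠ ⊥) (n : ℕ) :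
    multiplicity v.asIdeal (J ^ n) = n * multiplicity v.asIdeal J :=
  FiniteMultiplicity.multiplicity_pow v.prime (FiniteMultiplicity.of_prime_left v.prime hJ)

lemma isVirtualCube_of_ideal {x : 𝓞 E} (h0 : x ≠ 0) {J : Ideal (𝓞 E)} (h : Ideal.span {x} = J ^ 3) :
    IsVirtualCube (x : E) := by
  refine ⟨by simpa using h0, fun v ↦ ?_⟩
  have hJ : J ≠ ⊥ := by rintro rfl; simp [h0] at h
  rw [ord_eq_neg_multiplicity v h0, h, multiplicity_pow_ideal v hJ]
  simp

end Ord

section Unramified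
variable {E R : Type*} [Field E] [NumberField E] [Field R] [NumberField R] [Algebra E R]

lemma notMem_primes_of_derivative {α : 𝓞 R} (hα : Algebra.adjoin E {(α : R)} = ⊤) {n : ℕ} {c : 𝓞 E}
    (hc : α ^ n = algebraMap (𝓞 E) (𝓞 R) c) : (n : 𝓞 R) * α ^ (n - 1) ∈ differentIdeal (𝓞 E) (𝓞 R) := by
  have h := aeval_derivative_mem_differentIdeal (𝓞 E) E R α hα
  have hint : IsIntegral (𝓞 E) α := IsIntegral.of_finite _ _
  obtain ⟨g, hg⟩ : minpoly (𝓞 E) α ∣ (Polynomial.X ^ n - Polynomial.C c) :=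
    minpoly.isIntegrallyClosed_dvd hint (by simp [hc])
  have h2 := congrArg (fun f ↦ Polynomial.aeval α (Polynomial.derivative f)) hg
  simp only [Polynomial.derivative_sub, Polynomial.derivative_X_pow, Polynomial.derivative_C, map_mul, sub_zero,
    Polynomial.derivative_mul, map_add, minpoly.aeval, zero_mul, add_zero, map_pow, Polynomial.aeval_X, map_natCast] at h2
  rw [h2]
  exact Ideal.mul_mem_right _ _ h

lemma ramificationIdx'_eq_one_of_radical {α : 𝓞 R} (hα : Algebra.adjoin E {(α : R)} = ⊤) {n : ℕ} (hn : n ≠ 0) {c : 𝓞 E}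
    (hc : α ^ n = algebraMap (𝓞 E) (𝓞 R) c) (v : HeightOneSpectrum (𝓞 E)) (w : HeightOneSpectrum (𝓞 R))
    [w.asIdeal.LiesOver v.asIdeal] (hv : (n : 𝓞 E) * c ∉ v.asIdeal) :
    v.asIdeal.ramificationIdx' w.asIdeal = 1 := by
  have hw : ¬ w.asIdeal ∣ differentIdeal (𝓞 E) (𝓞 R) := by
    intro h
    have h1 := Ideal.dvd_iff_le.1 h (notMem_primes_of_derivative hα hc)
    apply hv
    rw [Ideal.mem_of_liesOver w.asIdeal v.asIdeal, map_mul, ← hc, map_natCast]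
    obtain ⟨m, rfl⟩ := Nat.exists_eq_succ_of_ne_zero hn
    rw [pow_succ, ← mul_assoc]
    exact Ideal.mul_mem_right _ _ h1
  have h0 : v.asIdeal.ramificationIdx' w.asIdeal ≠ 0 :=
    Ideal.IsDedekindDomain.ramificationIdx'_ne_zero_of_liesOver w.asIdeal v.ne_bot
  by_contra h1
  apply hw
  have := pow_sub_one_dvd_differentIdeal (𝓞 E) (p := v.asIdeal) w.asIdeal 2 v.ne_bot ?_
  · simpa using this
  · rw [Ideal.dvd_iff_le]
    refine Ideal.le_pow_of_le_ramificationIdx' (by omega)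

lemma exists_above {E R : Type*} [Field E] [NumberField E] [Field R] [Algebra E R] [Algebra.IsAlgebraic E R]
    (v : HeightOneSpectrum (𝓞 E)) :
    ∃ w : HeightOneSpectrum (𝓞 R), w.asIdeal.LiesOver v.asIdeal := by
  obtain ⟨Q, hQ, hQ'⟩ := Ideal.exists_maximal_ideal_liesOver_of_isIntegral (S := 𝓞 R) v.asIdeal
  exact ⟨⟨Q, hQ.isPrime, Ideal.ne_bot_of_liesOver_of_ne_bot v.ne_bot Q⟩, hQ'⟩

lemma ord_algebraMap {α : 𝓞 R} (hα : Algebra.adjoin E {(α : R)} = ⊤) {n : ℕ} (hn : n ≠ 0) {c : 𝓞 E}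
    (hc : α ^ n = algebraMap (𝓞 E) (𝓞 R) c) (v : HeightOneSpectrum (𝓞 E)) (w : HeightOneSpectrum (𝓞 R))
    [w.asIdeal.LiesOver v.asIdeal] (hv : (n : 𝓞 E) * c ∉ v.asIdeal) (x : E) :
    ord w (algebraMap E R x) = ord v x := by
  rw [ord, ord, ← HeightOneSpectrum.valuation_liesOver R v w,
    ramificationIdx'_eq_one_of_radical hα hn hc v w hv, pow_one]

end Unramified

/-- The explicit norm form of a pure cubic extension. -/
def cubicForm {R : Type*} [CommRing R] (D x y w : R) : R :=
  x ^ 3 + D * y ^ 3 + D ^ 2 * w ^ 3 - 3 * D * x * y * w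

/-- The tower `ℚ ⊂ L = ℚ(θ), K = ℚ(ζ) ⊂ k = ℚ(θ, ζ)` attached to a pure cubic field, where
`θ ^ 3 = D` and `ζ` is a primitive cube root of unity. -/
structure CubicTower (L K k : Type*) [Field L] [NumberField L] [Field K] [NumberField K]
    [Field k] [NumberField k] [Algebra L k] [Algebra K k] where
  D : ℕ
  D_ne_zero : D ≠ 0
  θ : L
  θ_pow : θ ^ 3 = D
  ζ : K
  ζ_prim : IsPrimitiveRoot ζ 3
  coordL : ∀ x : L, ∃ a b c : ℚ, x = a + b * θ + c * θ ^ 2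
  coordK : ∀ x : K, ∃ a b : ℚ, x = a + b * ζ
  coord : ∀ x : k, ∃ a b c : K, x = algebraMap K k a + algebraMap K k b * algebraMap L k θ +
    algebraMap K k c * algebraMap L k θ ^ 2
  norm_coord : ∀ a b c : ℚ, Algebra.norm ℚ (a + b * θ + c * θ ^ 2 : L) = cubicForm (D : ℚ) a b c
  σ : k ≃ₐ[K] k
  σ_θ : σ (algebraMap L k θ) = algebraMap K k ζ * algebraMap L k θ
  τ : k ≃ₐ[L] k
  τ_ζ : τ (algebraMap K k ζ) = algebraMap K k ζ ^ 2
  conj : K ≃+* K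
  conj_ζ : conj ζ = ζ ^ 2
  hilbert : ∀ x : k, x * σ x * σ (σ x) = 1 → ∃ y : k, y ≠ 0 ∧ x = y / σ y

namespace CubicTower
variable {L K k : Type*} [Field L] [NumberField L] [Field K] [NumberField K]
    [Field k] [NumberField k] [Algebra L k] [Algebra K k] (T : CubicTower L K k)

/-- Image of the cube root of unity in the top field. -/
def z : k := algebraMap K k T.ζ
/-- Image of the cube root in the top field. -/
def t : k := algebraMap L k T.θ

lemma σ_t : T.σ T.t = T.z * T.t := T.σ_θ
@[simp] lemma τ_t : T.τ T.t = T.t := T.τ.commutes _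
@[simp] lemma σ_z : T.σ T.z = T.z := T.σ.commutes _
lemma τ_z : T.τ T.z = T.z ^ 2 := T.τ_ζ

lemma ζ_rel : T.ζ ^ 2 + T.ζ + 1 = 0 := by
  have := T.ζ_prim.geom_sum_eq_zero (by norm_num)
  simp only [Finset.sum_range_succ, Finset.range_zero, Finset.sum_empty] at this
  linear_combination this

lemma z_rel : T.z ^ 2 + T.z + 1 = 0 := by
  have := congrArg (algebraMap K k) T.ζ_rel
  simpa [z] using this

lemma z_pow : T.z ^ 3 = 1 := by linear_combination (T.z - 1) * T.z_rel

lemma ζ_pow : T.ζ ^ 3 = 1 := T.ζ_prim.pow_eq_one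

lemma t_pow : T.t ^ 3 = (T.D : k) := by
  rw [t, ← map_pow, T.θ_pow, map_natCast]

lemma θ_ne_zero : T.θ ≠ 0 := by
  intro h
  have := T.θ_pow
  rw [h] at this
  have h2 := T.D_ne_zero
  exact h2 (Nat.cast_injective (R := L) (by simpa using this.symm))

lemma t_ne_zero : T.t ≠ 0 := by simpa [t] using T.θ_ne_zero

lemma algebraMap_conj (x : K) : algebraMap K k (T.conj x) = T.τ (algebraMap K k x) := by
  obtain ⟨a, b, rfl⟩ := T.coordK x
  simp [T.conj_ζ, T.τ_ζ]

lemma conj_conj (x : K) : T.conj (T.conj x) = x := by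
  obtain ⟨a, b, rfl⟩ := T.coordK x
  simp only [map_add, map_mul, map_ratCast, T.conj_ζ, map_pow]
  linear_combination b * T.ζ * T.ζ_pow

lemma norm_rational (x : K) : ∃ r : ℚ, x * T.conj x = r := by
  obtain ⟨a, b, rfl⟩ := T.coordK x
  refine ⟨a ^ 2 - a * b + b ^ 2, ?_⟩
  simp only [map_add, map_mul, map_ratCast, T.conj_ζ]
  push_cast
  linear_combination b ^ 2 * T.ζ_pow + a * b * T.ζ_rel

lemma exists_of_σ_fixed {x : k} (hx : T.σ x = x) : ∃ a : K, x = algebraMap K k a := by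
  obtain ⟨a, b, c, h⟩ := T.coord x
  have h2 : T.σ (T.σ x) = x := by rw [hx, hx]
  refine ⟨a, ?_⟩
  change x = algebraMap K k a + algebraMap K k b * T.t + algebraMap K k c * T.t ^ 2 at h
  have e1 : T.σ x = algebraMap K k a + algebraMap K k b * (T.z * T.t)
      + algebraMap K k c * (T.z * T.t) ^ 2 := by
    rw [h]; simp [T.σ_t]
  have e2 : T.σ (T.σ x) = algebraMap K k a + algebraMap K k b * (T.z * (T.z * T.t))
      + algebraMap K k c * (T.z * (T.z * T.t)) ^ 2 := by
    rw [e1]; simp [T.σ_t]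
  rw [hx] at e1
  rw [h2] at e2
  have h3 : (3 : k) * x = 3 * algebraMap K k a := by
    linear_combination h + e1 + e2 + (algebraMap K k b * T.t + algebraMap K k c * T.t ^ 2) * T.z_rel
      + algebraMap K k c * T.t ^ 2 * T.z * T.z_pow
  exact mul_left_cancel₀ (by norm_num) h3

lemma exists_of_τ_fixed {x : k} (hx : T.τ x = x) : ∃ a : L, x = algebraMap L k a := by
  obtain ⟨a, b, c, h⟩ := T.coord x
  obtain ⟨a0, a1, rfl⟩ := T.coordK a
  obtain ⟨b0, b1, rfl⟩ := T.coordK b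
  obtain ⟨c0, c1, rfl⟩ := T.coordK c
  refine ⟨(2 * (a0 + b0 * T.θ + c0 * T.θ ^ 2) - (a1 + b1 * T.θ + c1 * T.θ ^ 2)) / 2, ?_⟩
  simp only [map_add, map_mul, map_ratCast] at h
  change x = a0 + a1 * T.z + (b0 + b1 * T.z) * T.t + (c0 + c1 * T.z) * T.t ^ 2 at h
  have e1 : T.τ x = a0 + a1 * T.z ^ 2 + (b0 + b1 * T.z ^ 2) * T.t + (c0 + c1 * T.z ^ 2) * T.t ^ 2 := by
    rw [h]; simp [T.τ_z]
  rw [hx] at e1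
  simp only [map_div₀, map_sub, map_add, map_mul, map_pow, map_ratCast, map_ofNat]
  change x = (2 * (a0 + b0 * T.t + c0 * T.t ^ 2) - (a1 + b1 * T.t + c1 * T.t ^ 2)) / 2
  rw [eq_div_iff (by norm_num)]
  linear_combination h + e1 + (a1 + b1 * T.t + c1 * T.t ^ 2) * T.z_rel

lemma σ_σ_σ (x : k) : T.σ (T.σ (T.σ x)) = x := by
  obtain ⟨a, b, c, h⟩ := T.coord x
  change x = algebraMap K k a + algebraMap K k b * T.t + algebraMap K k c * T.t ^ 2 at h
  rw [h]
  simp only [map_add, map_mul, map_pow, T.σ_t, T.σ_z, AlgEquiv.commutes]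
  linear_combination (algebraMap K k b * T.t + algebraMap K k c * T.t ^ 2 * (T.z ^ 3 + 1)) * T.z_pow

lemma τ_τ (x : k) : T.τ (T.τ x) = x := by
  obtain ⟨a, b, c, h⟩ := T.coord x
  change x = algebraMap K k a + algebraMap K k b * T.t + algebraMap K k c * T.t ^ 2 at h
  rw [h]
  simp only [map_add, map_mul, map_pow, T.τ_t, ← T.algebraMap_conj, T.conj_conj]

lemma τ_σ (x : k) : T.τ (T.σ x) = T.σ (T.σ (T.τ x)) := by
  obtain ⟨a, b, c, h⟩ := T.coord x
  change x = algebraMap K k a + algebraMap K k b * T.t + algebraMap K k c * T.t ^ 2 at h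
  rw [h]
  simp only [map_add, map_mul, map_pow, T.τ_t, T.τ_z, T.σ_t, T.σ_z, ← T.algebraMap_conj,
    AlgEquiv.commutes]
  ring

/-- The norm from the top field to `K`, as an element of the top field. -/
def nm (x : k) : k := x * T.σ x * T.σ (T.σ x)

lemma nm_mul (x y : k) : T.nm (x * y) = T.nm x * T.nm y := by
  simp only [nm, map_mul]; ring

lemma nm_ne_zero {x : k} (hx : x ≠ 0) : T.nm x ≠ 0 := by
  simp [nm, hx]

lemma nm_t : T.nm T.t = T.D := by
  simp only [nm, T.σ_t, map_mul, T.σ_z]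
  linear_combination T.t ^ 3 * T.z_pow + T.t_pow

lemma exists_nm (x : k) : ∃ n : K, T.nm x = algebraMap K k n := by
  apply T.exists_of_σ_fixed
  simp only [nm, map_mul, T.σ_σ_σ]; ring

lemma nm_coord (a b c : K) :
    T.nm (algebraMap K k a + algebraMap K k b * T.t + algebraMap K k c * T.t ^ 2) =
      algebraMap K k (cubicForm (T.D : K) a b c) := by
  simp only [nm, cubicForm, map_add, map_mul, map_pow, T.σ_t, T.σ_z, AlgEquiv.commutes, map_sub,
    map_natCast, map_ofNat]
  rw [← T.t_pow]
  set A := algebraMap K k a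
  set B := algebraMap K k b
  set C := algebraMap K k c
  have h1 := T.z_rel
  have h3 := T.z_pow
  have h2 : T.z ^ 2 = - T.z - 1 := by linear_combination h1
  have h4 : T.z ^ 4 = T.z := by linear_combination T.z * h3
  ring_nf
  have h5 : T.z ^ 5 = - T.z - 1 := by linear_combination T.z ^ 2 * h3 + h2
  have h6 : T.z ^ 6 = 1 := by linear_combination (T.z ^ 3 + 1) * h3
  simp only [h6, h5, h4, h3, h2]
  ring

lemma exists_of_pow_three_mem {x : L} {r : K} (h : algebraMap L k x ^ 3 = algebraMap K k r) :
    ∃ (j : ℕ) (κ : ℚ), x = κ * T.θ ^ j := by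
  by_cases hx : x = 0
  · exact ⟨0, 0, by simp [hx]⟩
  set X := algebraMap L k x
  have hX : X ≠ 0 := by simpa [X] using hx
  have h1 : T.σ X ^ 3 = X ^ 3 := by rw [← map_pow, h]; simp
  have hz : IsPrimitiveRoot T.z 3 := T.ζ_prim.map_of_injective (algebraMap K k).injective
  obtain ⟨j, hj, hj2⟩ := hz.eq_pow_of_pow_eq_one (ξ := T.σ X / X) (by
    rw [div_pow, h1, div_self (pow_ne_zero _ hX)])
  have hj3 : T.σ X = T.z ^ j * X := by rw [hj2]; field_simp
  have ht := T.t_ne_zero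
  have hz0 : T.z ≠ 0 := hz.ne_zero (by norm_num)
  obtain ⟨a, ha⟩ := T.exists_of_σ_fixed (x := X / T.t ^ j) (by
    rw [map_div₀, map_pow, T.σ_t, hj3, mul_pow, mul_div_mul_left _ _ (pow_ne_zero _ hz0)])
  have hτ : T.τ (X / T.t ^ j) = X / T.t ^ j := by
    rw [map_div₀, map_pow, T.τ_t]; simp [X]
  rw [ha, ← T.algebraMap_conj] at hτ
  have hc := (algebraMap K k).injective hτ
  obtain ⟨u, v, rfl⟩ := T.coordK a
  have h2 : ((2 * u - v) : K) = 2 * (u + v * T.ζ) := by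
    simp only [map_add, map_mul, map_ratCast, T.conj_ζ] at hc
    linear_combination hc - v * T.ζ_rel
  refine ⟨j, (2 * u - v) / 2, ?_⟩
  apply (algebraMap L k).injective
  have h3 : X = algebraMap K k (u + v * T.ζ) * T.t ^ j := by rw [← ha]; field_simp
  rw [show algebraMap L k x = X from rfl, h3, map_mul, map_pow]
  congr 1
  have h4 : (u + v * T.ζ : K) = (((2 * u - v) / 2 : ℚ) : K) := by
    push_cast; rw [h2]; field_simp
  rw [h4, map_ratCast, map_ratCast]

end CubicTower

section VC
variable {E R : Type*} [Field E] [NumberField E] [Field R] [NumberField R]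

lemma exists_int_mul_eq (x : E) : ∃ (m : ℤ) (y : 𝓞 E), m ≠ 0 ∧ (y : E) = m * x := by
  obtain ⟨y, hy, hx⟩ := exists_integral_multiples ℤ ℚ {x}
  refine ⟨y, ⟨_, hx x (by simp)⟩, hy, ?_⟩
  simp

lemma IsVirtualCube.mul {x y : E} (hx : IsVirtualCube x) (hy : IsVirtualCube y) :
    IsVirtualCube (x * y) :=
  ⟨mul_ne_zero hx.1 hy.1, fun v ↦ by rw [ord_mul v hx.1 hy.1]; exact dvd_add (hx.2 v) (hy.2 v)⟩

lemma IsVirtualCube.pow {x : E} (hx : IsVirtualCube x) (n : ℕ) : IsVirtualCube (x ^ n) :=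
  ⟨pow_ne_zero _ hx.1, fun v ↦ by rw [ord_pow]; exact (hx.2 v).mul_left _⟩

lemma IsVirtualCube.inv {x : E} (hx : IsVirtualCube x) : IsVirtualCube x⁻¹ :=
  ⟨inv_ne_zero hx.1, fun v ↦ by rw [ord_inv]; exact (hx.2 v).neg_right⟩

lemma isVirtualCube_cube {x : E} (hx : x ≠ 0) : IsVirtualCube (x ^ 3) :=
  ⟨pow_ne_zero _ hx, fun v ↦ by rw [ord_pow]; exact ⟨_, rfl⟩⟩

lemma IsVirtualCube.map_algebraMap [Algebra E R] {x : E} (hx : IsVirtualCube x) :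
    IsVirtualCube (algebraMap E R x) := by
  refine ⟨by simpa using hx.1, fun w ↦ ?_⟩
  let v : HeightOneSpectrum (𝓞 E) := ⟨w.asIdeal.under (𝓞 E), inferInstance,
    Ideal.IsIntegral.comap_ne_bot _ w.ne_bot⟩
  have : w.asIdeal.LiesOver v.asIdeal := ⟨rfl⟩
  rw [ord, ← HeightOneSpectrum.valuation_liesOver R v w, WithZero.log_pow]
  rw [nsmul_eq_mul]
  exact Dvd.dvd.mul_left (hx.2 v) _

lemma IsVirtualCube.map (f : E →+* R) {x : E} (hx : IsVirtualCube x) : IsVirtualCube (f x) :=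
  letI := f.toAlgebra
  hx.map_algebraMap

lemma norm_eq_cube {x : E} (hx : IsVirtualCube x) : ∃ w : ℚ, w ≠ 0 ∧ Algebra.norm ℚ x = w ^ 3 := by
  obtain ⟨m, y, hm, hy⟩ := exists_int_mul_eq x
  have hmE : (m : E) ≠ 0 := by exact_mod_cast hm
  have h1 : IsVirtualCube (((y * m ^ 2 : 𝓞 E)) : E) := by
    convert hx.mul (isVirtualCube_cube hmE) using 1
    simp [hy]; ring
  obtain ⟨J, hJ⟩ := h1.exists_ideal
  have h2 := congrArg Ideal.absNorm hJ
  rw [Ideal.absNorm_span_singleton, map_pow] at h2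
  have h3 : ∃ u : ℤ, Algebra.norm ℤ (y * m ^ 2 : 𝓞 E) = u ^ 3 := by
    rcases Int.natAbs_eq (Algebra.norm ℤ (y * m ^ 2 : 𝓞 E)) with h | h
    · exact ⟨Ideal.absNorm J, by rw [h, h2]; simp⟩
    · exact ⟨-Ideal.absNorm J, by rw [h, h2]; simp; ring⟩
  obtain ⟨u, hu⟩ := h3
  have h4 : Algebra.norm ℚ (((y * m ^ 2 : 𝓞 E)) : E) = u ^ 3 := by
    rw [← Algebra.coe_norm_int, hu]; simp
  have h5 : (((y * m ^ 2 : 𝓞 E)) : E) = x * algebraMap ℚ E m ^ 3 := by simp [hy]; ring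
  have hmQ : (m : ℚ) ≠ 0 := by exact_mod_cast hm
  rw [h5, map_mul, map_pow, Algebra.norm_algebraMap] at h4
  have hw : Algebra.norm ℚ x = (u / m ^ Module.finrank ℚ E) ^ 3 := by
    field_simp
    linear_combination h4
  refine ⟨_, ?_, hw⟩
  intro h
  rw [h] at hw
  exact hx.1 (Algebra.norm_eq_zero_iff.1 (by rw [hw]; simp))

lemma adjoin_eq_top_of_coord {E R : Type*} [Field E] [Field R] [Algebra E R] {α : R}
    (h : ∀ x : R, ∃ a b c : E, x = algebraMap E R a + algebraMap E R b * α + algebraMap E R c * α ^ 2) :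
    Algebra.adjoin E {α} = ⊤ := by
  rw [eq_top_iff]
  rintro x -
  obtain ⟨a, b, c, rfl⟩ := h x
  have hα := Algebra.self_mem_adjoin_singleton E α
  exact add_mem (add_mem (algebraMap_mem _ _) (mul_mem (algebraMap_mem _ _) hα))
    (mul_mem (algebraMap_mem _ _) (pow_mem hα 2))

end VC

namespace CubicTower
variable {L K k : Type*} [Field L] [NumberField L] [Field K] [NumberField K]
    [Field k] [NumberField k] [Algebra L k] [Algebra K k] (T : CubicTower L K k)

lemma nm_algebraMap_left (x : L) : T.nm (algebraMap L k x) = (Algebra.norm ℚ x : ℚ) := by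
  obtain ⟨a, b, c, rfl⟩ := T.coordL x
  rw [T.norm_coord]
  have := T.nm_coord a b c
  simp only [map_ratCast, cubicForm, map_add, map_mul, map_pow, map_sub, map_natCast, map_ofNat] at this ⊢
  rw [← t, this]
  simp

/-- `y` witnesses the Kummer-type relation attached to `a`. -/
def Rel (a : L) (y : k) (n : K) : Prop :=
  y ≠ 0 ∧ T.nm y = algebraMap K k n ∧ algebraMap K k n * algebraMap L k a = T.σ (algebraMap L k a) * y ^ 3 ∧
    ∃ κ : ℚ, κ ≠ 0 ∧ n * T.conj n = κ ^ 3

variable {T}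
lemma Rel.ne_zero {a : L} {y : k} {n : K} (h : T.Rel a y n) : n ≠ 0 := by
  have := T.nm_ne_zero h.1
  rw [h.2.1] at this
  simpa using this

lemma Rel.mul {a b : L} {y y' : k} {n n' : K} (h : T.Rel a y n) (h' : T.Rel b y' n') :
    T.Rel (a * b) (y * y') (n * n') := by
  obtain ⟨h1, h2, h3, κ, h4, h5⟩ := h
  obtain ⟨h1', h2', h3', κ', h4', h5'⟩ := h'
  refine ⟨mul_ne_zero h1 h1', by rw [nm_mul, h2, h2', map_mul], ?_, κ * κ', mul_ne_zero h4 h4', ?_⟩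
  · simp only [map_mul]
    linear_combination h3 * (algebraMap K k n' * algebraMap L k b) + (T.σ (algebraMap L k a) * y ^ 3) * h3'
  · simp only [map_mul]; push_cast
    linear_combination h5 * (n' * T.conj n') + κ ^ 3 * h5'

variable (T) in
lemma Rel.one : T.Rel 1 1 1 := by
  refine ⟨one_ne_zero, by simp [nm], by simp, 1, one_ne_zero, by simp⟩

lemma Rel.pow {a : L} {y : k} {n : K} (h : T.Rel a y n) (i : ℕ) : T.Rel (a ^ i) (y ^ i) (n ^ i) := by
  induction i with
  | zero => simpa using Rel.one T
  | succ i ih => simpa [pow_succ] using ih.mul h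

variable (T)
lemma exists_rel {a : L} (ha : IsVirtualCube a) : ∃ y n, T.Rel a y n := by
  obtain ⟨w, hw, hN⟩ := norm_eq_cube ha
  set A := algebraMap L k a with hA
  have hA0 : A ≠ 0 := by simpa [A] using ha.1
  have hNA : A * T.σ A * T.σ (T.σ A) = (w : k) ^ 3 := by
    have := T.nm_algebraMap_left a
    rw [hN] at this
    simpa [nm] using this
  have hwk : (w : k) ≠ 0 := by exact_mod_cast hw
  obtain ⟨u, hu, hu2⟩ := T.hilbert (T.σ A / w) (by
    simp only [map_div₀, map_ratCast, T.σ_σ_σ]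
    field_simp
    linear_combination hNA)
  have hrel : ∃ y : k, y ≠ 0 ∧ T.nm y * A = T.σ A * y ^ 3 := by
    have hσu : T.σ u ≠ 0 := by simpa using hu
    have hσσu : T.σ (T.σ u) ≠ 0 := by simpa using hu
    have e1 : T.σ A * T.σ u = w * u := by field_simp at hu2; linear_combination hu2
    have e2 : T.σ (T.σ A) * T.σ (T.σ u) = w * T.σ u := by
      have := congrArg T.σ e1; simpa using this
    have e3 : A * u = w * T.σ (T.σ u) := by
      have := congrArg T.σ e2; simpa [T.σ_σ_σ] using this
    refine ⟨u⁻¹, inv_ne_zero hu, ?_⟩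
    simp only [nm, map_inv₀]
    field_simp
    linear_combination u * e3 - T.σ (T.σ u) * e1
  obtain ⟨y, hy, hy1⟩ := hrel
  obtain ⟨n, hn⟩ := T.exists_nm y
  rw [hn] at hy1
  obtain ⟨s, hs⟩ := T.exists_of_τ_fixed (x := y * T.τ y) (by rw [map_mul, T.τ_τ, mul_comm])
  have hτ : algebraMap K k (T.conj n) * A = T.σ (T.σ A) * T.τ y ^ 3 := by
    have := congrArg T.τ hy1
    simpa [T.τ_σ, ← T.algebraMap_conj, hA] using this
  have hX : algebraMap L k (w * s / a) ^ 3 = algebraMap K k (n * T.conj n) := by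
    simp only [map_div₀, map_mul, map_ratCast, ← hs, ← hA]
    field_simp
    linear_combination -(algebraMap K k (T.conj n) * A) * A * hy1 - T.σ A * y ^ 3 * A * hτ
      - y ^ 3 * T.τ y ^ 3 * hNA
  obtain ⟨j, κ, hκ⟩ := T.exists_of_pow_three_mem hX
  obtain ⟨r, hr⟩ := T.norm_rational n
  have hrκ : n * T.conj n = κ ^ 3 * T.D ^ j := by
    apply (algebraMap K k).injective
    rw [← hX, hκ]
    simp only [map_mul, map_pow, map_ratCast, map_natCast]
    rw [mul_pow, ← pow_mul, mul_comm j 3, pow_mul]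
    change _ * (T.t ^ 3) ^ j = _
    rw [T.t_pow]
  have hn0 : n ≠ 0 := by
    rintro rfl
    exact T.nm_ne_zero hy (by simpa using hn)
  have hκ0 : κ ≠ 0 := by
    rintro rfl
    simp [hn0] at hrκ
  have hnt : T.nm (T.t ^ j) = (T.D : k) ^ j := by
    rw [← T.nm_t]; simp [nm, mul_pow]
  have hD : (T.D : ℚ) ≠ 0 := by exact_mod_cast T.D_ne_zero
  refine ⟨y * T.t ^ j, n * T.D ^ j, mul_ne_zero hy (pow_ne_zero _ T.t_ne_zero), ?_, ?_, κ * T.D ^ j,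
    mul_ne_zero hκ0 (pow_ne_zero _ hD), ?_⟩
  · rw [nm_mul, hnt, hn]; simp
  · rw [mul_pow, ← pow_mul, mul_comm j 3, pow_mul, T.t_pow]
    simp only [map_mul, map_pow, map_natCast]
    linear_combination (T.D : k) ^ j * hy1
  · simp only [map_mul, map_pow, map_natCast]; push_cast
    linear_combination (T.D : K) ^ (2 * j) * hrκ

end CubicTower

section Places
variable {E R : Type*} [Field E] [NumberField E] [Field R] [NumberField R]

lemma exists_ratPlace {u : ℕ} (hu : u.Prime) : ∃ v : HeightOneSpectrum (𝓞 ℚ),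
    v.asIdeal = Ideal.span {(u : 𝓞 ℚ)} ∧ ord v (u : ℚ) = -1 ∧
      ∀ n : ℤ, (n : 𝓞 ℚ) ∈ v.asIdeal ↔ (u : ℤ) ∣ n := by
  have hdvd : ∀ n : ℤ, (u : 𝓞 ℚ) ∣ n ↔ (u : ℤ) ∣ n := fun n ↦ by
    rw [← map_dvd_iff Rat.ringOfIntegersEquiv]; simp
  have hp : Prime (u : 𝓞 ℚ) := by
    rw [← MulEquiv.prime_iff Rat.ringOfIntegersEquiv]
    simpa using Nat.prime_iff_prime_int.1 hu
  refine ⟨⟨Ideal.span {(u : 𝓞 ℚ)}, (Ideal.span_singleton_prime hp.ne_zero).2 hp, by simpa using hp.ne_zero⟩,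
    rfl, ?_, fun n ↦ by rw [Ideal.mem_span_singleton, hdvd]⟩
  have := ord_eq_neg_multiplicity
    ⟨Ideal.span {(u : 𝓞 ℚ)}, (Ideal.span_singleton_prime hp.ne_zero).2 hp, by simpa using hp.ne_zero⟩ hp.ne_zero
  rw [multiplicity_self] at this
  simpa using this

lemma ord_intCast_eq_zero {v : HeightOneSpectrum (𝓞 E)} {u : ℕ} (hv : (u : 𝓞 E) ∈ v.asIdeal) {n : ℤ}
    (h : IsCoprime (u : ℤ) n) : ord v (n : E) = 0 := by
  have : (n : 𝓞 E) ∉ v.asIdeal := by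
    intro hn
    obtain ⟨a, b, hab⟩ := h
    apply v.isPrime.ne_top
    rw [Ideal.eq_top_iff_one]
    have := congrArg (Int.cast (R := 𝓞 E)) hab
    push_cast at this
    rw [← this]
    exact add_mem (Ideal.mul_mem_left _ _ hv) (Ideal.mul_mem_left _ _ hn)
  simpa using ord_eq_zero_of_notMem this

lemma exists_place_over {u : ℕ} (hu : u.Prime) : ∃ w : HeightOneSpectrum (𝓞 E), (u : 𝓞 E) ∈ w.asIdeal := by
  obtain ⟨v, hv, -, -⟩ := exists_ratPlace hu
  obtain ⟨w, hw⟩ := exists_above (R := E) v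
  refine ⟨w, ?_⟩
  have : (u : 𝓞 ℚ) ∈ v.asIdeal := by rw [hv]; exact Ideal.mem_span_singleton_self _
  rw [Ideal.mem_of_liesOver w.asIdeal] at this
  simpa using this

/-- A prime not dividing the discriminant of the radical equation has valuation one upstairs. -/
lemma ord_prime_eq_neg_one {α : 𝓞 E} (hα : Algebra.adjoin ℚ {(α : E)} = ⊤) {n : ℕ} (hn : n ≠ 0) {c : ℤ}
    (hc : α ^ n = c) {u : ℕ} (hu : u.Prime) (hu2 : ¬ (u : ℤ) ∣ n * c) (w : HeightOneSpectrum (𝓞 E))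
    (hw : (u : 𝓞 E) ∈ w.asIdeal) : ord w (u : E) = -1 := by
  obtain ⟨v, hv, h1, h2⟩ := exists_ratPlace hu
  have hle : v.asIdeal ≤ w.asIdeal.under (𝓞 ℚ) := by
    rw [hv, Ideal.span_singleton_le_iff_mem, Ideal.mem_comap]; simpa using hw
  have : w.asIdeal.LiesOver v.asIdeal := ⟨v.isMaximal.eq_of_le (Ideal.IsPrime.ne_top inferInstance) hle⟩
  have := ord_algebraMap hα hn (c := (c : 𝓞 ℚ)) (by simpa using hc) v w (by
    have := h2 (n * c)
    push_cast at this
    rw [this]; exact hu2) u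
  rw [h1] at this
  simpa using this

lemma exists_place_of_equiv (f : E ≃+* R) (w : HeightOneSpectrum (𝓞 R)) :
    ∃ v : HeightOneSpectrum (𝓞 E), (∀ x : 𝓞 E, x ∈ v.asIdeal ↔ RingOfIntegers.mapRingEquiv f x ∈ w.asIdeal) ∧
      ∀ x : E, ord w (f x) = ord v x := by
  let := f.toRingHom.toAlgebra
  let v : HeightOneSpectrum (𝓞 E) := ⟨w.asIdeal.under (𝓞 E), inferInstance,
    Ideal.IsIntegral.comap_ne_bot _ w.ne_bot⟩
  have : w.asIdeal.LiesOver v.asIdeal := ⟨rfl⟩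
  refine ⟨v, fun x ↦ Iff.rfl, fun x ↦ ?_⟩
  refine ord_algebraMap (α := 1) ?_ one_ne_zero (c := 1) (by simp) v w ?_ x
  · rw [eq_top_iff]
    rintro x -
    obtain ⟨y, rfl⟩ := f.surjective x
    exact algebraMap_mem _ y
  · rw [Nat.cast_one, one_mul]
    exact fun h ↦ v.isPrime.ne_top ((Ideal.eq_top_iff_one _).2 h)

end Places

namespace CubicTower
variable {L K k : Type*} [Field L] [NumberField L] [Field K] [NumberField K]
    [Field k] [NumberField k] [Algebra L k] [Algebra K k] (T : CubicTower L K k)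

/-- The cube root as an algebraic integer of the top field. -/
def tInt : 𝓞 k := ⟨T.t, by
  have : IsIntegral ℤ (T.t ^ 3) := by
    rw [T.t_pow]; simpa using isIntegral_algebraMap (R := ℤ) (A := k) (x := (T.D : ℤ))
  exact this.of_pow (by norm_num)⟩

/-- The cube root as an algebraic integer. -/
def θInt : 𝓞 L := ⟨T.θ, by
  have : IsIntegral ℤ (T.θ ^ 3) := by
    rw [T.θ_pow]; simpa using isIntegral_algebraMap (R := ℤ) (A := L) (x := (T.D : ℤ))
  exact this.of_pow (by norm_num)⟩

/-- The cube root of unity as an algebraic integer. -/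
def ζInt : 𝓞 K := T.ζ_prim.toInteger

@[simp] lemma coe_tInt : (T.tInt : k) = T.t := rfl
@[simp] lemma coe_ζInt : (T.ζInt : K) = T.ζ := rfl
@[simp] lemma coe_θInt : (T.θInt : L) = T.θ := rfl

variable {T} in
lemma Rel.dvd_ord_of_notMem {a : L} (ha : IsVirtualCube a) {y : k} {n : K} (h : T.Rel a y n)
    (v : HeightOneSpectrum (𝓞 K)) (hv : ((3 * T.D : ℕ) : 𝓞 K) ∉ v.asIdeal) : 3 ∣ ord v n := by
  obtain ⟨h1, h2, h3, -⟩ := h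
  have hA : IsVirtualCube (algebraMap L k a) := ha.map_algebraMap
  have hn : IsVirtualCube (algebraMap K k n) := by
    have : algebraMap K k n = T.σ (algebraMap L k a) * y ^ 3 * (algebraMap L k a)⁻¹ := by
      rw [← h3]; field_simp [hA.1]
    rw [this]
    exact ((hA.map T.σ.toRingEquiv.toRingHom).mul (isVirtualCube_cube h1)).mul hA.inv
  obtain ⟨w, hw⟩ := exists_above (R := k) v
  have := hn.2 w
  rwa [ord_algebraMap (α := T.tInt) (adjoin_eq_top_of_coord T.coord) (n := 3) (by norm_num) (c := (T.D : 𝓞 K)) ?_ v w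
    (by simpa using hv)] at this
  ext
  simpa using T.t_pow

lemma mapConj_coord (a b : ℤ) : RingOfIntegers.mapRingEquiv T.conj (a + b * T.ζInt) = a + b * T.ζInt ^ 2 := by
  ext
  simp [T.conj_ζ]

section cyc
variable [IsCyclotomicExtension {3} ℚ K]

lemma exists_int_coord (x : 𝓞 K) : ∃ a b : ℤ, x = a + b * T.ζInt := by
  have h := T.ζ_prim.integralPowerBasis.adjoin_gen_eq_top
  rw [IsPrimitiveRoot.integralPowerBasis_gen] at h
  have hx : x ∈ Algebra.adjoin ℤ {T.ζ_prim.toInteger} := h ▸ Algebra.mem_top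
  have hrel : T.ζInt ^ 2 = - T.ζInt - 1 := by
    ext; simp; linear_combination T.ζ_rel
  induction hx using Algebra.adjoin_induction with
  | mem x hx => 
    rw [Set.mem_singleton_iff] at hx
    exact ⟨0, 1, by simp [hx, ζInt]⟩
  | algebraMap r => exact ⟨r, 0, by simp⟩
  | add x y _ _ hx hy => 
    obtain ⟨a, b, rfl⟩ := hx
    obtain ⟨c, d, rfl⟩ := hy
    exact ⟨a + c, b + d, by push_cast; ring⟩
  | mul x y _ _ hx hy =>
    obtain ⟨a, b, rfl⟩ := hx
    obtain ⟨c, d, rfl⟩ := hy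
    refine ⟨a * c - b * d, a * d + b * c - b * d, ?_⟩
    push_cast
    linear_combination (b * d : 𝓞 K) * hrel

lemma mapConj_mem {u : ℕ} (hu : u.Prime) (hu3 : u = 3 ∨ u % 3 = 2) {v : HeightOneSpectrum (𝓞 K)}
    (hv : (u : 𝓞 K) ∈ v.asIdeal) {x : 𝓞 K} (hx : x ∈ v.asIdeal) :
    RingOfIntegers.mapRingEquiv T.conj x ∈ v.asIdeal := by
  have hrel : T.ζInt ^ 2 + T.ζInt + 1 = 0 := by
    ext; simp; linear_combination T.ζ_rel
  obtain ⟨a, b, rfl⟩ := T.exists_int_coord x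
  rw [mapConj_coord]
  rcases hu3 with rfl | hu3
  · have h1 : T.ζInt ^ 2 - T.ζInt ∈ v.asIdeal := by
      apply v.isPrime.mem_of_pow_mem 2
      have : (T.ζInt ^ 2 - T.ζInt) ^ 2 = (-1) * ((3 : ℕ) : 𝓞 K) := by
        push_cast
        linear_combination (T.ζInt ^ 2 - 3 * T.ζInt + 3) * hrel
      rw [this]
      exact Ideal.mul_mem_left _ _ hv
    have h2 : a + b * T.ζInt ^ 2 = (a + b * T.ζInt) + b * (T.ζInt ^ 2 - T.ζInt) := by ring
    rw [h2]
    exact add_mem hx (Ideal.mul_mem_left _ _ h1)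
  · have := v.isPrime
    have : Fact u.Prime := ⟨hu⟩
    let Q := 𝓞 K ⧸ v.asIdeal
    have hchar : CharP Q u := by
      refine (CharP.charP_iff_prime_eq_zero hu).2 ?_
      rw [← map_natCast (Ideal.Quotient.mk v.asIdeal)]
      exact Ideal.Quotient.eq_zero_iff_mem.2 hv
    rw [← Ideal.Quotient.eq_zero_iff_mem] at hx ⊢
    have hF := congrArg (· ^ u) hx
    simp only [map_add, map_mul, map_intCast, zero_pow hu.ne_zero, add_pow_char, mul_pow] at hF
    have ha : ∀ a : ℤ, (a : Q) ^ u = a := fun a ↦ by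
      have := congrArg (ZMod.castHom (dvd_refl u) Q) (ZMod.pow_card (a : ZMod u))
      rw [map_pow, map_intCast] at this; exact this
    rw [ha, ha] at hF
    have hz : T.ζInt ^ u = T.ζInt ^ 2 := by
      have h3 : T.ζInt ^ 3 = 1 := by ext; simpa using T.ζ_pow
      conv_lhs => rw [← Nat.div_add_mod u 3, hu3, pow_add, pow_mul, h3, one_pow, one_mul]
    rw [← map_pow, hz] at hF
    simpa using hF

lemma ord_conj_eq {u : ℕ} (hu : u.Prime) (hu3 : u = 3 ∨ u % 3 = 2) {v : HeightOneSpectrum (𝓞 K)}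
    (hv : (u : 𝓞 K) ∈ v.asIdeal) (n : K) : ord v (T.conj n) = ord v n := by
  obtain ⟨v', h1, h2⟩ := exists_place_of_equiv T.conj v
  rw [h2]
  have : v' = v := by
    ext1
    refine (v.isMaximal.eq_of_le v'.isPrime.ne_top fun x hx ↦ ?_).symm
    rw [h1]
    exact T.mapConj_mem hu hu3 hv hx
  rw [this]

lemma place_over_p {p : ℕ} (hp : p.Prime) {γ v : HeightOneSpectrum (𝓞 K)} (hγ : (p : 𝓞 K) ∈ γ.asIdeal)
    (hv : (p : 𝓞 K) ∈ v.asIdeal) : v = γ ∨ ∀ n, ord v (T.conj n) = ord γ n := by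
  obtain ⟨v', h1, h2⟩ := exists_place_of_equiv T.conj v
  have hsub : (γ.asIdeal : Set (𝓞 K)) ⊆ v.asIdeal ∪ v'.asIdeal := by
    intro x hx
    have key : ∃ m : ℤ, x * RingOfIntegers.mapRingEquiv T.conj x = m := by
      obtain ⟨a, b, rfl⟩ := T.exists_int_coord x
      refine ⟨a ^ 2 - a * b + b ^ 2, ?_⟩
      rw [mapConj_coord]
      have hrel : T.ζInt ^ 2 + T.ζInt + 1 = 0 := by
        ext; simp; linear_combination T.ζ_rel
      push_cast
      linear_combination (b ^ 2 * (T.ζInt - 1) + a * b) * hrel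
    obtain ⟨m, hm⟩ := key
    have hmγ : (m : 𝓞 K) ∈ γ.asIdeal := hm ▸ Ideal.mul_mem_right _ _ hx
    have hpm : (p : ℤ) ∣ m := by
      by_contra h
      have := ord_intCast_eq_zero hγ ((Nat.prime_iff_prime_int.1 hp).coprime_iff_not_dvd.2 h)
      have hm0 : (m : 𝓞 K) ≠ 0 := by
        intro h0; rw [Int.cast_eq_zero] at h0; exact h (h0 ▸ dvd_zero _)
      have := ord_neg_of_mem hm0 hmγ
      simp at this
      omega
    obtain ⟨c, rfl⟩ := hpm
    have hmv : x * RingOfIntegers.mapRingEquiv T.conj x ∈ v.asIdeal := by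
      rw [hm]; push_cast; exact Ideal.mul_mem_right _ _ hv
    rcases v.isPrime.mem_or_mem hmv with h | h
    · exact Or.inl h
    · exact Or.inr ((h1 x).2 h)
  rcases Ideal.subset_union.1 hsub with h | h
  · left
    ext1
    exact (γ.isMaximal.eq_of_le v.isPrime.ne_top h).symm
  · right
    intro n
    have : v' = γ := by
      ext1
      exact (γ.isMaximal.eq_of_le v'.isPrime.ne_top h).symm
    rw [h2, this]

end cyc
end CubicTower

section Ultrametric
variable {F : Type*} [Field F] (v : Valuation F ℤᵐ⁰)

lemma valuation_add_four {a b c e : F} (hb : v b < v a) (hc : v c < v a)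
    (he : v e ^ 3 ≤ v a * v b * v c) : v (b + c + e) < v a := by
  have ha : 0 < v a := lt_of_le_of_lt zero_le hb
  have hea : v e < v a := by
    refine lt_of_pow_lt_pow_left₀ 3 zero_le (he.trans_lt ?_)
    rw [pow_succ, pow_two]
    have h1 : v a * v b < v a * v a := by gcongr
    have h2 : 0 < v a * v a := mul_pos ha ha
    calc v a * v b * v c ≤ v a * v a * v c := by gcongr
      _ < v a * v a * v a := by gcongr
  exact v.map_add_lt (v.map_add_lt hb hc) hea

lemma cubicForm_valuation {D x y w n : F} (hD : v D = WithZero.exp (-1)) (h3 : v 3 ≤ 1)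
    (hn : n = cubicForm D x y w) (hvn : v n = 1) : v x = 1 ∧ v (n - x ^ 3) < 1 := by
  set a := x ^ 3 with ha
  set b := D * y ^ 3 with hb
  set c := D ^ 2 * w ^ 3 with hc
  set e := - (3 * D * x * y * w) with he'
  have hD0 : v D ≠ 0 := by rw [hD]; exact WithZero.exp_ne_zero
  have hDl : WithZero.log (v D) = -1 := by rw [hD]; rfl
  have hn' : n = a + b + c + e := by rw [hn, cubicForm]; ring
  have he : v e ^ 3 ≤ v a * v b * v c := by
    rw [← map_pow, ← map_mul, ← map_mul]
    have : e ^ 3 = (-27) * (a * b * c) := by simp only [ha, hb, hc, he']; ring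
    rw [this, map_mul]
    have h27 : v (-27 : F) ≤ 1 := by
      rw [Valuation.map_neg, show (27 : F) = 3 ^ 3 by norm_num, map_pow]
      exact pow_le_one₀ zero_le h3
    exact mul_le_of_le_one_left' h27
  have hla : ∀ r : F, v r ≠ 0 → WithZero.log (v (r ^ 3)) = 3 * WithZero.log (v r) := fun r _ ↦ by
    rw [map_pow, WithZero.log_pow]; simp
  have hlb : ∀ r : F, v r ≠ 0 → WithZero.log (v (D * r ^ 3)) = -1 + 3 * WithZero.log (v r) := fun r hr ↦ by
    rw [map_mul, WithZero.log_mul hD0 (by simpa using hr), hla r hr, hDl]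
  have hlc : ∀ r : F, v r ≠ 0 → WithZero.log (v (D ^ 2 * r ^ 3)) = -2 + 3 * WithZero.log (v r) := fun r hr ↦ by
    rw [map_mul, WithZero.log_mul (by simpa using hD0) (by simpa using hr), hla r hr, map_pow,
      WithZero.log_pow, hDl]; simp
  have z1 : ∀ r : F, v (D * r ^ 3) ≠ 0 → v r ≠ 0 := fun r h h' ↦ h (by simp [h'])
  have z2 : ∀ r : F, v (D ^ 2 * r ^ 3) ≠ 0 → v r ≠ 0 := fun r h h' ↦ h (by simp [h'])
  have z0 : ∀ r : F, v (r ^ 3) ≠ 0 → v r ≠ 0 := fun r h h' ↦ h (by simp [h'])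
  have dab : v a = v b → v a = 0 := fun h ↦ by
    by_contra h0
    have h1 := hla x (z0 x h0)
    have h2 := hlb y (z1 y (h ▸ h0))
    rw [← ha, h, hb, h2] at h1
    omega
  have dac : v a = v c → v a = 0 := fun h ↦ by
    by_contra h0
    have h1 := hla x (z0 x h0)
    have h2 := hlc w (z2 w (h ▸ h0))
    rw [← ha, h, hc, h2] at h1
    omega
  have dbc : v b = v c → v b = 0 := fun h ↦ by
    by_contra h0
    have h1 := hlb y (z1 y h0)
    have h2 := hlc w (z2 w (h ▸ h0))
    rw [← hb, h, hc, h2] at h1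
    omega
  have hb1 : v b ≠ 1 := fun h ↦ by
    have h2 := hlb y (z1 y (by rw [← hb, h]; exact one_ne_zero))
    rw [← hb, h, WithZero.log_one] at h2
    omega
  have hc1 : v c ≠ 1 := fun h ↦ by
    have h2 := hlc w (z2 w (by rw [← hc, h]; exact one_ne_zero))
    rw [← hc, h, WithZero.log_one] at h2
    omega
  have casea : v b < v a → v c < v a → v x = 1 ∧ v (n - a) < 1 := fun h1 h2 ↦ by
    have h3 := valuation_add_four v h1 h2 he
    have h4 : v n = v a := by
      rw [hn', show a + b + c + e = a + (b + c + e) by ring, v.map_add_eq_of_lt_left h3]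
    have h5 : v a = 1 := h4 ▸ hvn
    refine ⟨?_, ?_⟩
    · rw [ha, map_pow] at h5
      exact (pow_eq_one_iff_of_nonneg zero_le (by norm_num)).1 h5
    · rw [hn', show a + b + c + e - a = b + c + e by ring, ← h5]
      exact h3
  have caseb : v a < v b → v c < v b → False := fun h1 h2 ↦ by
    have h3 := valuation_add_four v h1 h2 (by rwa [mul_comm (v b)])
    apply hb1
    rw [← hvn, hn', show a + b + c + e = b + (a + c + e) by ring, v.map_add_eq_of_lt_left h3]
  have casec : v a < v c → v b < v c → False := fun h1 h2 ↦ by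
    have h3 := valuation_add_four v h1 h2 (by rwa [mul_assoc, mul_comm (v c)])
    apply hc1
    rw [← hvn, hn', show a + b + c + e = c + (a + b + e) by ring, v.map_add_eq_of_lt_left h3]
  have hall : v a = 0 → v b = 0 → v c = 0 → False := fun h1 h2 h3 ↦ by
    have h4 : v e = 0 := by
      rw [h1, zero_mul, zero_mul] at he
      exact pow_eq_zero_iff (n := 3) (by norm_num) |>.1 (le_antisymm he zero_le)
    rw [Valuation.zero_iff] at h1 h2 h3 h4
    rw [hn', h1, h2, h3, h4] at hvn
    simp at hvn
  have nz : ∀ g : ℤᵐ⁰, g = 0 ∨ 0 < g := fun g ↦ eq_zero_or_pos g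
  rcases lt_trichotomy (v a) (v b) with h | h | h
  · exfalso
    rcases lt_trichotomy (v b) (v c) with h' | h' | h'
    · exact casec (h.trans h') h'
    · rw [dbc h'] at h; exact not_lt_zero h
    · exact caseb h h'
  · have h1 := dab h
    have h2 : v b = 0 := h ▸ h1
    exfalso
    rcases nz (v c) with h3 | h3
    · exact hall h1 h2 h3
    · exact casec (by rwa [h1]) (by rwa [h2])
  · rcases lt_trichotomy (v a) (v c) with h' | h' | h'
    · exact (casec h' (h.trans h')).elim
    · rw [dac h'] at h; exact absurd h not_lt_zero
    · exact casea h h'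

end Ultrametric

section Norm
variable {E : Type*} [Field E] [NumberField E]

lemma pow_sub_one_mem_of_cubicForm {p : ℕ} (hp3 : p % 3 = 1) (γ : HeightOneSpectrum (𝓞 E))
    (hres : ∀ x : 𝓞 E, x ^ p - x ∈ γ.asIdeal) {D : E} (hD0 : D ≠ 0) (hD : ord γ D = -1) {n : 𝓞 E} (hn : n ∉ γ.asIdeal)
    {x y w : E} (h : (n : E) = cubicForm D x y w) : n ^ ((p - 1) / 3) - 1 ∈ γ.asIdeal := by
  have hvD : γ.valuation E D = WithZero.exp (-1) := by
    rw [← hD, ord, WithZero.exp_log (by simpa using hD0)]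
  have h3 : γ.valuation E 3 ≤ 1 := by
    rw [show (3 : E) = algebraMap (𝓞 E) E 3 from (map_ofNat _ _).symm]
    exact γ.valuation_le_one 3
  obtain ⟨h1, h2⟩ := cubicForm_valuation _ hvD h3 h ((γ.valuation_eq_one_iff_notMem (K := E)).2 hn)
  obtain ⟨s, hs⟩ := γ.exists_valuation_sub_lt_of_integer h1.le 1
  rw [Units.val_one] at hs
  set V := γ.valuation E
  have hvs : V (s : E) = 1 := by
    rw [show (s : E) = x + (s - x) by ring, V.map_add_eq_of_lt_left (by rwa [h1]), h1]
  have hsn : s ∉ γ.asIdeal := (γ.valuation_eq_one_iff_notMem (K := E)).1 hvs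
  have hns : n - s ^ 3 ∈ γ.asIdeal := by
    rw [← γ.valuation_lt_one_iff_mem (K := E)]
    have : algebraMap (𝓞 E) E (n - s ^ 3) = (n - x ^ 3) - (s - x) * (s ^ 2 + s * x + x ^ 2) := by
      simp; ring
    change V (algebraMap (𝓞 E) E (n - s ^ 3)) < 1
    rw [this]
    refine V.map_sub_lt h2 ?_
    rw [map_mul]
    refine mul_lt_one_of_lt_of_le hs ?_
    refine V.map_add_le (V.map_add_le ?_ ?_) ?_ <;> simp [hvs, h1]
  have := γ.isPrime
  rw [← Ideal.Quotient.eq_zero_iff_mem] at hns hsn ⊢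
  have hr := hres s
  rw [← Ideal.Quotient.eq_zero_iff_mem] at hr
  simp only [map_sub, map_pow, map_one, sub_eq_zero] at hns hr ⊢
  rw [hns, ← pow_mul]
  apply mul_right_cancel₀ hsn
  rw [one_mul, ← pow_succ]
  convert hr using 2
  omega

end Norm

namespace CubicTower
variable {L K k : Type*} [Field L] [NumberField L] [Field K] [NumberField K]
    [Field k] [NumberField k] [Algebra L k] [Algebra K k] (T : CubicTower L K k)

lemma ord_radicand {p M : ℕ} (hp : p.Prime) (hp3 : p % 3 = 1) (hM : ¬ p ∣ M) (hD : T.D = p * M)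
    {γ : HeightOneSpectrum (𝓞 K)} (hγ : (p : 𝓞 K) ∈ γ.asIdeal) : ord γ (T.D : K) = -1 := by
  have hM0 : M ≠ 0 := fun h ↦ hM (h ▸ dvd_zero _)
  have h1 : ord γ (p : K) = -1 := by
    refine ord_prime_eq_neg_one (α := T.ζInt) ?_ (n := 3) (by norm_num) (c := 1) ?_ hp ?_ γ hγ
    · exact adjoin_eq_top_of_coord (α := T.ζ) fun x ↦ by
        obtain ⟨a, b, h⟩ := T.coordK x
        exact ⟨a, b, 0, by simpa using h⟩
    · ext; simpa using T.ζ_pow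
    · intro h
      have h' : p ∣ 3 := by exact_mod_cast h
      have := (Nat.prime_dvd_prime_iff_eq hp Nat.prime_three).1 h'
      omega
  have h2 : ord γ ((M : ℤ) : K) = 0 :=
    ord_intCast_eq_zero hγ (Nat.isCoprime_iff_coprime.2 ((Nat.Prime.coprime_iff_not_dvd hp).2 hM))
  rw [hD, Nat.cast_mul, ord_mul γ (by exact_mod_cast hp.ne_zero) (by exact_mod_cast hM0), h1]
  simpa using h2

variable [IsCyclotomicExtension {3} ℚ K]

lemma pow_sub_self_mem (T : CubicTower L K k) {p : ℕ} (hp : p.Prime) (hp3 : p % 3 = 1) {γ : HeightOneSpectrum (𝓞 K)}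
    (hγ : (p : 𝓞 K) ∈ γ.asIdeal) (x : 𝓞 K) : x ^ p - x ∈ γ.asIdeal := by
  obtain ⟨a, b, rfl⟩ := T.exists_int_coord x
  have := γ.isPrime
  have : Fact p.Prime := ⟨hp⟩
  let Q := 𝓞 K ⧸ γ.asIdeal
  have hchar : CharP Q p := by
    refine (CharP.charP_iff_prime_eq_zero hp).2 ?_
    rw [← map_natCast (Ideal.Quotient.mk γ.asIdeal)]
    exact Ideal.Quotient.eq_zero_iff_mem.2 hγ
  rw [← Ideal.Quotient.eq_zero_iff_mem]
  have ha : ∀ a : ℤ, (a : Q) ^ p = a := fun a ↦ by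
    have := congrArg (ZMod.castHom (dvd_refl p) Q) (ZMod.pow_card (a : ZMod p))
    rw [map_pow, map_intCast] at this; exact this
  have hz : T.ζInt ^ p = T.ζInt := by
    have h3 : T.ζInt ^ 3 = 1 := by ext; simpa using T.ζ_pow
    conv_lhs => rw [← Nat.div_add_mod p 3, hp3, pow_add, pow_mul, h3, one_pow, one_mul, pow_one]
  simp only [map_sub, map_pow, map_add, map_mul, map_intCast]
  rw [add_pow_char, mul_pow, ha, ha, ← map_pow, hz, sub_self]

lemma pow_sub_one_mem_of_nm {p M : ℕ} (hp : p.Prime) (hp3 : p % 3 = 1) (hM : ¬ p ∣ M) (hD : T.D = p * M)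
    {γ : HeightOneSpectrum (𝓞 K)} (hγ : (p : 𝓞 K) ∈ γ.asIdeal) {n : 𝓞 K} (hn : n ∉ γ.asIdeal) {y : k}
    (hy : T.nm y = algebraMap K k n) : n ^ ((p - 1) / 3) - 1 ∈ γ.asIdeal := by
  obtain ⟨a, b, c, h⟩ := T.coord y
  have h2 := T.nm_coord a b c
  change y = algebraMap K k a + algebraMap K k b * T.t + algebraMap K k c * T.t ^ 2 at h
  rw [← h, hy] at h2
  exact pow_sub_one_mem_of_cubicForm hp3 γ (T.pow_sub_self_mem hp hp3 hγ) (by exact_mod_cast T.D_ne_zero)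
    (T.ord_radicand hp hp3 hM hD hγ) hn ((algebraMap K k).injective h2)

lemma nm_ne_root_of_unity {p M : ℕ} (hp : p.Prime) (hp9 : p % 9 = 4 ∨ p % 9 = 7) (hM : ¬ p ∣ M) (hD : T.D = p * M)
    {s : ℕ} (hs : ¬ 3 ∣ s) (y : k) : T.nm y ≠ T.z ^ s := by
  intro h
  obtain ⟨γ, hγ⟩ := exists_place_over (E := K) hp
  have h3 : T.ζInt ^ 3 = 1 := by ext; simpa using T.ζ_pow
  have hrel : T.ζInt ^ 2 + T.ζInt + 1 = 0 := by
    ext; simp; linear_combination T.ζ_rel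
  have hn : T.ζInt ^ s ∉ γ.asIdeal := by
    intro hmem
    have := γ.isPrime.mem_of_pow_mem s hmem
    apply γ.isPrime.ne_top
    rw [Ideal.eq_top_iff_one, ← h3]
    exact Ideal.pow_mem_of_mem _ this 3 (by norm_num)
  have h1 := T.pow_sub_one_mem_of_nm hp (by omega) hM hD hγ hn (y := y) (by rw [h]; simp [z])
  have h3γ : (3 : 𝓞 K) ∈ γ.asIdeal := by
    rw [← pow_mul] at h1
    have hm : ¬ 3 ∣ s * ((p - 1) / 3) := by
      rw [Nat.prime_three.dvd_mul]; omega
    have hmod : (s * ((p - 1) / 3)) % 3 = 1 ∨ (s * ((p - 1) / 3)) % 3 = 2 := by omega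
    rw [← Nat.div_add_mod (s * ((p - 1) / 3)) 3, pow_add, pow_mul, h3, one_pow, one_mul] at h1
    rcases hmod with h' | h' <;> rw [h'] at h1
    · have : (3 : 𝓞 K) = (T.ζInt ^ 1 - 1) * (- T.ζInt - 2) := by linear_combination -hrel + 2 * hrel
      rw [this]; exact Ideal.mul_mem_right _ _ h1
    · have : (3 : 𝓞 K) = (T.ζInt ^ 2 - 1) * (T.ζInt - 1) := by linear_combination (2 - T.ζInt) * hrel
      rw [this]; exact Ideal.mul_mem_right _ _ h1
  have := ord_intCast_eq_zero hγ (n := 3) (by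
    rw [show (3 : ℤ) = ((3 : ℕ) : ℤ) by rfl, Nat.isCoprime_iff_coprime, Nat.coprime_primes hp Nat.prime_three]
    omega)
  have h' : ord γ (3 : K) < 0 := by
    rw [show (3 : K) = algebraMap (𝓞 K) K 3 from (map_ofNat _ _).symm]
    exact ord_neg_of_mem (by norm_num) h3γ
  push_cast at this
  omega

lemma dvd_pow_sub_one_of_norm {p M : ℕ} (hp : p.Prime) (hp3 : p % 3 = 1) (hM : ¬ p ∣ M) (hD : T.D = p * M)
    {n : ℤ} (hn : ¬ (p : ℤ) ∣ n) {x : L} (h : Algebra.norm ℚ x = n) : (p : ℤ) ∣ n ^ ((p - 1) / 3) - 1 := by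
  obtain ⟨γ, hγ⟩ := exists_place_over (E := K) hp
  have key : ∀ n : ℤ, (n : 𝓞 K) ∈ γ.asIdeal → (p : ℤ) ∣ n := fun n hmem ↦ by
    by_contra h
    have := ord_intCast_eq_zero hγ ((Nat.prime_iff_prime_int.1 hp).coprime_iff_not_dvd.2 h)
    have hm0 : (n : 𝓞 K) ≠ 0 := by
      intro h0; rw [Int.cast_eq_zero] at h0; exact h (h0 ▸ dvd_zero _)
    have := ord_neg_of_mem hm0 hmem
    simp at this
    omega
  have h1 := T.pow_sub_one_mem_of_nm hp hp3 hM hD hγ (n := n) (fun h ↦ hn (key n h)) (y := algebraMap L k x)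
    (by rw [T.nm_algebraMap_left, h]; simp)
  exact key _ (by exact_mod_cast h1)

end CubicTower

section NatCube

lemma exists_nat_cube_decomposition (S : Fin 3 → ℕ) {m : ℕ} (hm : m ≠ 0)
    (h : ∀ u : ℕ, u.Prime → (∀ i, u ≠ S i) → 3 ∣ m.factorization u) :
    ∃ e i j s : ℕ, m = S 0 ^ e * S 1 ^ i * S 2 ^ j * s ^ 3 := by
  induction m using Nat.recOnPosPrimePosCoprime with
  | prime_pow p n hp hn =>
    by_cases hS : ∀ i, p ≠ S i
    · have := h p hp hS
      rw [hp.factorization_pow, Finsupp.single_eq_same] at this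
      obtain ⟨t, rfl⟩ := this
      exact ⟨0, 0, 0, p ^ t, by ring⟩
    · push Not at hS
      obtain ⟨i, rfl⟩ := hS
      fin_cases i
      · exact ⟨n, 0, 0, 1, by simp⟩
      · exact ⟨0, n, 0, 1, by simp⟩
      · exact ⟨0, 0, n, 1, by simp⟩
  | zero => exact absurd rfl hm
  | one => exact ⟨0, 0, 0, 1, by simp⟩
  | coprime a b ha hb hab iha ihb =>
    have hdis : ∀ u : ℕ, u.Prime → a.factorization u = 0 ∨ b.factorization u = 0 := fun u hu ↦ by
      by_contra! hc
      exact Nat.not_coprime_of_dvd_of_dvd hu.one_lt (Nat.dvd_of_factorization_pos hc.1)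
        (Nat.dvd_of_factorization_pos hc.2) hab
    obtain ⟨e, i, j, s, h1⟩ := iha (by omega) fun u hu hS ↦ by
      have := h u hu hS
      rw [Nat.factorization_mul (by omega) (by omega), Finsupp.add_apply] at this
      rcases hdis u hu with h' | h'
      · simp [h']
      · simpa [h'] using this
    obtain ⟨e', i', j', s', h2⟩ := ihb (by omega) fun u hu hS ↦ by
      have := h u hu hS
      rw [Nat.factorization_mul (by omega) (by omega), Finsupp.add_apply] at this
      rcases hdis u hu with h' | h'
      · simpa [h'] using this
      · simp [h']
    exact ⟨e + e', i + i', j + j', s * s', by rw [h1, h2]; ring⟩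

end NatCube

section Integral
variable {E : Type*} [Field E] [NumberField E]

lemma ord_natCast_of_mem {v : HeightOneSpectrum (𝓞 E)} {u m : ℕ} (hu : u.Prime) (hv : (u : 𝓞 E) ∈ v.asIdeal)
    (hm : m ≠ 0) : ord v (m : E) = m.factorization u * ord v (u : E) := by
  have h1 := Nat.ordProj_mul_ordCompl_eq_self m u
  have h2 := Nat.coprime_ordCompl hu hm
  have h3 : ord v (((ordCompl[u] m : ℕ) : ℤ) : E) = 0 :=
    ord_intCast_eq_zero hv (Nat.isCoprime_iff_coprime.2 h2)
  have h4 : ordCompl[u] m ≠ 0 := (Nat.ordCompl_pos u hm).ne'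
  conv_lhs => rw [← h1, Nat.cast_mul, Nat.cast_pow]
  rw [ord_mul v (pow_ne_zero _ (by exact_mod_cast hu.ne_zero)) (by exact_mod_cast h4), ord_pow]
  rw [Int.cast_natCast] at h3
  rw [h3, add_zero]

end Integral

namespace CubicTower
variable {L K k : Type*} [Field L] [NumberField L] [Field K] [NumberField K]
    [Field k] [NumberField k] [Algebra L k] [Algebra K k] {T : CubicTower L K k}

/-- The radicands of pure cubic fields considered here. -/
structure IsRadicand (D p ℓ f : ℕ) : Prop where
  hp : p.Prime
  hp9 : p % 9 = 4 ∨ p % 9 = 7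
  hℓ : ℓ.Prime
  hD : D = p * ℓ ^ f
  cases : ℓ = 3 ∨ (ℓ % 3 = 2 ∧ (D % 9 = 1 ∨ D % 9 = 8))

lemma IsRadicand.p_mod_three {D p ℓ f : ℕ} (h : IsRadicand D p ℓ f) : p % 3 = 1 := by
  have := h.hp9; omega

lemma IsRadicand.ne {D p ℓ f : ℕ} (h : IsRadicand D p ℓ f) : p ≠ ℓ := by
  have := h.p_mod_three
  rintro rfl
  rcases h.cases with h | h <;> omega

lemma IsRadicand.not_dvd {D p ℓ f : ℕ} (h : IsRadicand D p ℓ f) : ¬ p ∣ ℓ ^ f := fun hd ↦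
  h.ne ((Nat.prime_dvd_prime_iff_eq h.hp h.hℓ).1 (h.hp.dvd_of_dvd_pow hd))

section cyc
variable [IsCyclotomicExtension {3} ℚ K]

lemma Rel.isVirtualCube {a : L} (ha : IsVirtualCube a) {y : k} {n : K} (h : T.Rel a y n) {p ℓ f : ℕ}
    (hr : IsRadicand T.D p ℓ f) {γ : HeightOneSpectrum (𝓞 K)} (hγ : (p : 𝓞 K) ∈ γ.asIdeal) (hn : 3 ∣ ord γ n) :
    IsVirtualCube n := by
  refine ⟨h.ne_zero, fun v ↦ ?_⟩
  by_cases hv : ((3 * T.D : ℕ) : 𝓞 K) ∈ v.asIdeal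
  swap
  · exact h.dvd_ord_of_notMem ha v hv
  obtain ⟨κ, hκ, hnκ⟩ := h.2.2.2
  have hc : ord v n + ord v (T.conj n) = 3 * ord v (κ : K) := by
    rw [← ord_mul v h.ne_zero (by simpa using h.ne_zero), hnκ, ord_pow]; rfl
  have hself : ∀ u : ℕ, u.Prime → (u = 3 ∨ u % 3 = 2) → (u : 𝓞 K) ∈ v.asIdeal → 3 ∣ ord v n :=
    fun u hu hu3 huv ↦ by
      rw [T.ord_conj_eq hu hu3 huv] at hc
      omega
  rw [hr.hD] at hv
  push_cast at hv
  rcases v.isPrime.mem_or_mem hv with hv | hv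
  · exact hself 3 Nat.prime_three (Or.inl rfl) (by exact_mod_cast hv)
  rcases v.isPrime.mem_or_mem hv with hv | hv
  · rcases T.place_over_p hr.hp hγ hv with rfl | h'
    · exact hn
    · rw [h'] at hc
      omega
  · exact hself ℓ hr.hℓ (by rcases hr.cases with h | h; exacts [Or.inl h, Or.inr h.1])
      (v.isPrime.mem_of_pow_mem _ hv)

lemma exists_eq_root_mul_cube (T : CubicTower L K k) {n : K} (hn : IsVirtualCube n) :
    ∃ (s : ℕ) (c : K), c ≠ 0 ∧ n = T.ζ ^ s * c ^ 3 := by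
  obtain ⟨m, y, hm, hy⟩ := exists_int_mul_eq n
  have hmE : (m : K) ≠ 0 := by exact_mod_cast hm
  have h1 : IsVirtualCube (((y * m ^ 2 : 𝓞 K)) : K) := by
    convert hn.mul (isVirtualCube_cube hmE) using 1
    simp [hy]; ring
  obtain ⟨J, hJ⟩ := h1.exists_ideal
  have := IsCyclotomicExtension.Rat.three_pid K
  obtain ⟨c, rfl⟩ : ∃ c, J = Ideal.span {c} := (IsPrincipalIdealRing.principal J).principal
  rw [Ideal.span_singleton_pow, Ideal.span_singleton_eq_span_singleton] at hJ
  obtain ⟨u, hu⟩ := hJ.symm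
  have hu' : n * m ^ 3 = (c : K) ^ 3 * (u : 𝓞 K) := by
    have := congrArg (algebraMap (𝓞 K) K) hu
    simp only [map_mul, map_pow, map_intCast] at this
    rw [show algebraMap (𝓞 K) K y = m * n from hy] at this
    change _ = algebraMap (𝓞 K) K c ^ 3 * algebraMap (𝓞 K) K u
    rw [this]; ring
  have hc0 : (c : K) ≠ 0 := by
    intro h0
    rw [h0] at hu'
    exact mul_ne_zero hn.1 (pow_ne_zero 3 hmE) (by simpa using hu')
  have hus : ∃ (s : ℕ) (e : K), e ≠ 0 ∧ ((u : 𝓞 K) : K) = T.ζ ^ s * e ^ 3 := by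
    have := IsCyclotomicExtension.Rat.Three.Units.mem T.ζ_prim u
    have hη : algebraMap (𝓞 K) K ((T.ζ_prim.toInteger_isPrimitiveRoot.isUnit (by decide)).unit : (𝓞 K)ˣ) = T.ζ := rfl
    simp only [List.mem_cons, List.not_mem_nil, or_false] at this
    change ∃ (s : ℕ) (e : K), e ≠ 0 ∧ algebraMap (𝓞 K) K u = T.ζ ^ s * e ^ 3
    rcases this with h | h | h | h | h | h <;> rw [h]
    · exact ⟨0, 1, by simp, by simp⟩
    · exact ⟨0, -1, by simp, by rw [Units.val_neg, map_neg]; simp; norm_num⟩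
    · exact ⟨1, 1, by simp, by rw [hη]; simp⟩
    · exact ⟨1, -1, by simp, by rw [Units.val_neg, map_neg, hη]; ring⟩
    · exact ⟨2, 1, by simp, by rw [Units.val_pow_eq_pow_val, map_pow, hη]; simp⟩
    · exact ⟨2, -1, by simp, by rw [Units.val_neg, Units.val_pow_eq_pow_val, map_neg, map_pow, hη]; ring⟩
  obtain ⟨s, e, he, hue⟩ := hus
  refine ⟨s, c * e / m, by simp [hc0, he, hmE], ?_⟩
  field_simp
  rw [hu', hue]; ring

lemma Rel.exists_rat_mul_cube {a : L} (ha : a ≠ 0) {y : k} {n : K} (h : T.Rel a y n) {p ℓ f : ℕ}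
    (hr : IsRadicand T.D p ℓ f) (hn : IsVirtualCube n) :
    ∃ (r : ℚ) (x : L), a = r * x ^ 3 := by
  obtain ⟨s, c, hc, hnc⟩ := T.exists_eq_root_mul_cube hn
  obtain ⟨h1, h2, h3, -⟩ := h
  set C := algebraMap K k c with hC
  have hC0 : C ≠ 0 := by simpa [C] using hc
  have hσC : T.σ C = C := T.σ.commutes _
  have hnm : T.nm (y / C) = T.z ^ s := by
    have : T.nm (y / C) = T.nm y / C ^ 3 := by
      simp only [nm, map_div₀, hσC]; field_simp
    rw [this, h2, hnc]
    simp only [map_mul, map_pow, z, ← hC]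
    field_simp
  have hs : T.z ^ s = 1 := by
    by_cases hs : 3 ∣ s
    · obtain ⟨t, rfl⟩ := hs
      rw [pow_mul, T.z_pow, one_pow]
    · exact absurd hnm (T.nm_ne_root_of_unity hr.hp hr.hp9 hr.not_dvd hr.hD hs _)
  rw [hs] at hnm
  obtain ⟨g, hg, hyg⟩ := T.hilbert _ hnm
  have hσg : T.σ g ≠ 0 := by simpa using hg
  have hn' : algebraMap K k n = C ^ 3 := by
    rw [hnc, map_mul, map_pow, map_pow]; change T.z ^ s * C ^ 3 = _; rw [hs, one_mul]
  have hy : y = C * (g / T.σ g) := by rw [← hyg]; field_simp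
  set A := algebraMap L k a with hA
  have hA0 : A ≠ 0 := by simpa [A] using ha
  have key : A * T.σ g ^ 3 = T.σ A * g ^ 3 := by
    rw [hn', hy] at h3
    have : C ^ 3 * (A * T.σ g ^ 3) = C ^ 3 * (T.σ A * g ^ 3) := by
      field_simp at h3
      linear_combination C ^ 3 * h3
    exact mul_left_cancel₀ (pow_ne_zero 3 hC0) this
  have hfix : T.σ (A / g ^ 3) = A / g ^ 3 := by
    rw [map_div₀, map_pow]
    rw [div_eq_div_iff (pow_ne_zero 3 hσg) (pow_ne_zero 3 hg)]
    exact key.symm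
  obtain ⟨κ, hκ⟩ := T.exists_of_σ_fixed hfix
  have hAκ : A = algebraMap K k κ * g ^ 3 := by rw [← hκ]; field_simp
  have hAτ : A = algebraMap K k (T.conj κ) * T.τ g ^ 3 := by
    rw [T.algebraMap_conj, ← map_pow, ← map_mul, ← hAκ, hA]; exact (T.τ.commutes a).symm
  obtain ⟨r, hr'⟩ := T.norm_rational κ
  obtain ⟨x, hx⟩ := T.exists_of_τ_fixed (x := g * T.τ g) (by rw [map_mul, T.τ_τ]; ring)
  have hsq : a ^ 2 = r * x ^ 3 := by
    apply (algebraMap L k).injective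
    have hr'' : algebraMap K k κ * algebraMap K k (T.conj κ) = (r : k) := by
      rw [← map_mul, hr', map_ratCast]
    simp only [map_pow, map_mul, map_ratCast]
    rw [← hx, ← hr'', ← hA]
    linear_combination (A + algebraMap K k κ * g ^ 3) * hAκ + algebraMap K k κ * g ^ 3 * (hAτ - hAκ)
  refine ⟨r ^ 2, x ^ 2 / a, ?_⟩
  push_cast
  field_simp
  linear_combination (a ^ 2 + r * x ^ 3) * hsq

end cyc

end CubicTower

namespace CubicTower
variable {L K k : Type*} [Field L] [NumberField L] [Field K] [NumberField K]
    [Field k] [NumberField k] [Algebra L k] [Algebra K k] {T : CubicTower L K k}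

lemma exists_of_rat_mul_cube {a : L} (ha : IsVirtualCube a) {r : ℚ} {x : L} (h : a = r * x ^ 3) {p ℓ f : ℕ}
    (hr : IsRadicand T.D p ℓ f) : ∃ (e j : ℕ) (x : L), x ≠ 0 ∧ a = 3 ^ e * ℓ ^ j * x ^ 3 := by
  have hr0 : r ≠ 0 := by rintro rfl; exact ha.1 (by simp [h])
  have hx0 : x ≠ 0 := by rintro rfl; exact ha.1 (by simp [h])
  obtain ⟨N, hN⟩ : ∃ N, r.num.natAbs = N := ⟨_, rfl⟩
  set m := N * r.den ^ 2 with hm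
  have hm0 : m ≠ 0 := mul_ne_zero (by rw [← hN]; simpa using hr0) (by simp)
  have hrm : ∃ t : ℚ, t ≠ 0 ∧ r = m * t ^ 3 := by
    have hd : (r.den : ℚ) ≠ 0 := by simp
    have hr1 : r = r.num / r.den := (Rat.num_div_den r).symm
    rcases Int.natAbs_eq r.num with h' | h'
    · refine ⟨1 / r.den, by simp, ?_⟩
      rw [h', hN] at hr1
      rw [hm]; push_cast at hr1 ⊢; field_simp; field_simp at hr1; exact hr1
    · refine ⟨-1 / r.den, by simp, ?_⟩
      rw [h', hN] at hr1
      rw [hm]; push_cast at hr1 ⊢; field_simp; field_simp at hr1; linear_combination hr1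
  obtain ⟨t, ht0, hrt⟩ := hrm
  have hX0 : (t : L) * x ≠ 0 := mul_ne_zero (by exact_mod_cast ht0) hx0
  have ham : a = m * (t * x) ^ 3 := by
    rw [h, hrt]; push_cast; ring
  have hmV : IsVirtualCube (m : L) := by
    have : (m : L) = a * ((t * x) ^ 3)⁻¹ := by rw [ham]; field_simp
    rw [this]
    exact ha.mul (isVirtualCube_cube hX0).inv
  obtain ⟨e, i, j, s, hdec⟩ := exists_nat_cube_decomposition ![3, p, ℓ] hm0 fun u hu hS ↦ by
    obtain ⟨w, hw⟩ := exists_place_over (E := L) hu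
    have h3 : u ≠ 3 := hS 0
    have hp : u ≠ p := hS 1
    have hℓ : u ≠ ℓ := hS 2
    have h1 : ord w (u : L) = -1 := by
      refine ord_prime_eq_neg_one (α := T.θInt) (adjoin_eq_top_of_coord T.coordL) (n := 3) (by norm_num)
        (c := (T.D : ℤ)) ?_ hu ?_ w hw
      · ext; simpa using T.θ_pow
      · intro hd
        have hd : u ∣ 3 * T.D := by exact_mod_cast hd
        rw [hr.hD, hu.dvd_mul, hu.dvd_mul] at hd
        rcases hd with hd | hd | hd
        · exact h3 ((Nat.prime_dvd_prime_iff_eq hu Nat.prime_three).1 hd)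
        · exact hp ((Nat.prime_dvd_prime_iff_eq hu hr.hp).1 hd)
        · exact hℓ ((Nat.prime_dvd_prime_iff_eq hu hr.hℓ).1 (hu.dvd_of_dvd_pow hd))
    have h2 := hmV.2 w
    rw [ord_natCast_of_mem hu hw hm0, h1] at h2
    omega
  simp only [Matrix.cons_val_zero, Matrix.cons_val_one, Matrix.cons_val] at hdec
  have hs0 : s ≠ 0 := by rintro rfl; exact hm0 (by simp [hdec])
  have hℓ0 : (ℓ : L) ≠ 0 := by exact_mod_cast hr.hℓ.ne_zero
  refine ⟨e, j + 2 * f * i, T.θ ^ i * (ℓ : L)⁻¹ ^ (f * i) * s * (t * x), ?_, ?_⟩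
  · have := T.θ_ne_zero
    have hs' : (s : L) ≠ 0 := by exact_mod_cast hs0
    positivity
  · have hθ : T.θ ^ 3 = p * ℓ ^ f := by rw [T.θ_pow, hr.hD]; push_cast; rfl
    rw [ham, hdec]
    push_cast
    rw [show ((T.θ ^ i * (ℓ : L)⁻¹ ^ (f * i) * s * (t * x)) ^ 3) =
      (T.θ ^ 3) ^ i * (ℓ : L)⁻¹ ^ (3 * f * i) * s ^ 3 * (t * x) ^ 3 by ring, hθ, inv_pow]
    field_simp
    ring

lemma not_isVirtualCube_three (T : CubicTower L K k) (h : T.D % 9 = 1 ∨ T.D % 9 = 8) : ¬ IsVirtualCube (3 : L) := by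
  intro hV
  obtain ⟨J, hJ⟩ := IsVirtualCube.exists_ideal (x := (3 : 𝓞 L))
    (by rw [RingOfIntegers.coe_eq_algebraMap, map_ofNat]; exact hV)
  have hJ0 : J ≠ ⊥ := by rintro rfl; simp at hJ
  have hnorm : Ideal.absNorm J = 3 := by
    have h1 := congrArg Ideal.absNorm hJ
    rw [Ideal.absNorm_span_singleton, map_pow] at h1
    have h2 : Algebra.norm ℤ (3 : 𝓞 L) = 27 := by
      have h3 := T.norm_coord 3 0 0
      have h4 := Algebra.coe_norm_int (K := L) 3
      rw [show ((3 : 𝓞 L) : L) = ((3 : ℚ) : L) + (0 : ℚ) * T.θ + (0 : ℚ) * T.θ ^ 2 by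
        rw [RingOfIntegers.coe_eq_algebraMap, map_ofNat]; simp, h3] at h4
      norm_num [cubicForm] at h4
      exact_mod_cast h4
    rw [h2] at h1
    exact (Nat.pow_left_injective (n := 3) (by norm_num) (by simpa using h1)).symm
  have hJp : J.IsPrime := Ideal.isPrime_of_irreducible_absNorm (by rw [hnorm]; exact Nat.prime_three)
  let v : HeightOneSpectrum (𝓞 L) := ⟨J, hJp, hJ0⟩
  have h3 : ord v (3 : L) = -3 := by
    have := ord_eq_neg_multiplicity v (x := (3 : 𝓞 L)) (by norm_num)
    rw [hJ, multiplicity_pow_ideal v hJ0, multiplicity_self, RingOfIntegers.coe_eq_algebraMap, map_ofNat] at this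
    simpa using this
  have h3v : ((3 : ℕ) : 𝓞 L) ∈ v.asIdeal := by
    have : (3 : 𝓞 L) ∈ J ^ 3 := hJ ▸ Ideal.mem_span_singleton_self _
    simpa using Ideal.pow_le_self (by norm_num) this
  obtain ⟨m, ε, hε, hD⟩ : ∃ m ε : ℤ, ε ^ 2 = 1 ∧ (T.D : ℤ) = 9 * m + ε := by
    rcases h with h | h
    · exact ⟨T.D / 9, 1, by norm_num, by omega⟩
    · exact ⟨T.D / 9 + 1, -1, by norm_num, by omega⟩
  have hεL : (ε : L) ^ 2 = 1 := by exact_mod_cast congrArg (Int.cast (R := L)) hε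
  have hDL : T.θ ^ 3 = 9 * m + ε := by
    rw [T.θ_pow]; exact_mod_cast congrArg (Int.cast (R := L)) hD
  set V := v.valuation L with hVdef
  have hV3 : V 3 = WithZero.exp (-3) := by
    rw [← h3, ord, WithZero.exp_log (by simp)]
  have hVint : ∀ x : 𝓞 L, V (x : L) ≤ 1 := fun x ↦ v.valuation_le_one x
  set π : L := T.θ - ε with hπ
  have hrel : π * (π ^ 2 + 3 * (ε * T.θ)) = 3 ^ 2 * m := by
    rw [hπ]
    linear_combination hDL - (ε : L) * hεL
  have hVε : V ε = 1 := by
    have := congrArg V hεL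
    rw [map_pow, map_one] at this
    exact (pow_eq_one_iff_of_nonneg zero_le (by norm_num)).1 this
  have hVθ : V T.θ = 1 := by
    have h1 : ord v ((T.D : ℤ) : L) = 0 := ord_intCast_eq_zero h3v (by
      rw [Nat.isCoprime_iff_coprime, Nat.Prime.coprime_iff_not_dvd Nat.prime_three]; omega)
    have h2 : V (T.D : L) = 1 := by
      rw [Int.cast_natCast] at h1
      rw [← WithZero.exp_log (x := V (T.D : L)) (by simpa using T.D_ne_zero)]
      change WithZero.exp (ord v (T.D : L)) = 1
      rw [h1, WithZero.exp_zero]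
    rw [← T.θ_pow, map_pow] at h2
    exact (pow_eq_one_iff_of_nonneg zero_le (by norm_num)).1 h2
  have hVπ : V π ≤ V 3 := by
    rcases eq_or_ne π 0 with h0 | hπ0
    · rw [h0, map_zero]; exact zero_le
    have h1 := congrArg V hrel
    have hVm : V (m : L) ≤ 1 := by simpa using hVint m
    have h3θ : V (3 * (ε * T.θ)) = V 3 := by rw [map_mul, map_mul, hVε, hVθ]; simp
    have hle : V π * V (π ^ 2 + 3 * (ε * T.θ)) ≤ V 3 ^ 2 := by
      rw [← map_mul, h1, map_mul, map_pow]; exact mul_le_of_le_one_right' hVm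
    obtain ⟨x, hx⟩ : ∃ x : ℤ, V π = WithZero.exp x := ⟨_, (WithZero.exp_log (by simpa using hπ0)).symm⟩
    have hx2 : V (π ^ 2) = WithZero.exp (2 * x) := by
      rw [map_pow, hx, ← WithZero.exp_nsmul]; simp
    have h9 : V 3 ^ 2 = WithZero.exp (-6) := by rw [hV3, ← WithZero.exp_nsmul]; rfl
    rw [h9] at hle
    rw [hx, hV3, WithZero.exp_le_exp]
    by_contra! hlt
    rcases le_or_gt x (-2) with hx' | hx'
    · rw [V.map_add_eq_of_lt_right (by
        rw [hx2, h3θ, hV3, WithZero.exp_lt_exp]; omega), h3θ, hV3, hx, ← WithZero.exp_add,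
        WithZero.exp_le_exp] at hle
      omega
    · rw [V.map_add_eq_of_lt_left (by
        rw [hx2, h3θ, hV3, WithZero.exp_lt_exp]; omega), hx2, hx, ← WithZero.exp_add,
        WithZero.exp_le_exp] at hle
      omega
  obtain ⟨δ, hδ⟩ := HeightOneSpectrum.mem_integers_of_valuation_le_one (R := 𝓞 L) L (π / 3) fun w ↦ by
    by_cases hw : w = v
    · rw [hw, map_div₀]
      exact div_le_one_of_le₀ hVπ zero_le
    · have h3w : (3 : 𝓞 L) ∉ w.asIdeal := fun h3w ↦ hw <| by
        ext1
        refine (v.isMaximal.eq_of_le w.isPrime.ne_top ?_).symm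
        have : J ^ 3 ≤ w.asIdeal := by rw [← hJ]; simpa using h3w
        exact (w.isPrime.pow_le_iff (by norm_num)).1 this
      have h3w' : w.valuation L 3 = 1 := by
        have := (w.valuation_eq_one_iff_notMem (K := L)).2 h3w
        rwa [map_ofNat] at this
      rw [map_div₀, h3w', div_one, hπ]
      have := w.valuation_le_one (K := L) (T.θInt - ε)
      simpa using this
  have hN : ∀ t : ℤ, ∃ s : ℤ, (s : ℚ) = cubicForm (T.D : ℚ) (t - ε / 3) (1 / 3) 0 := fun t ↦ by
    refine ⟨Algebra.norm ℤ (t + δ : 𝓞 L), ?_⟩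
    rw [Algebra.coe_norm_int, ← T.norm_coord]
    congr 1
    rw [RingOfIntegers.coe_eq_algebraMap, map_add, hδ, hπ]
    push_cast
    simp
    ring
  obtain ⟨s0, h0⟩ := hN 0
  obtain ⟨s1, h1⟩ := hN 1
  have hεQ : (ε : ℚ) ^ 2 = 1 := by exact_mod_cast hε
  have h2 : (3 * (s1 - s0) : ℚ) = 3 - 3 * ε + 1 := by
    rw [h0, h1, cubicForm, cubicForm]
    push_cast
    linear_combination hεQ
  have h3 : 3 * (s1 - s0) = 3 - 3 * ε + 1 := by exact_mod_cast h2
  omega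

end CubicTower

section units
variable {E : Type*} [Field E] [NumberField E]

lemma ideal_pow_three_injective {I J : Ideal (𝓞 E)} (h : I ^ 3 = J ^ 3) : I = J :=
  le_antisymm (Ideal.dvd_iff_le.1 ((UniqueFactorizationMonoid.pow_dvd_pow_iff_dvd three_ne_zero).1 h.symm.dvd))
    (Ideal.dvd_iff_le.1 ((UniqueFactorizationMonoid.pow_dvd_pow_iff_dvd three_ne_zero).1 h.dvd))

lemma exists_integral_cbrt {E : Type*} [Field E] {x : 𝓞 E} {y : E} (h : (x : E) = y ^ 3) : ∃ z : 𝓞 E, (z : E) = y ∧ x = z ^ 3 := by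
  have hy : IsIntegral ℤ y := IsIntegral.of_pow (n := 3) (by norm_num) (h ▸ x.isIntegral_coe)
  refine ⟨⟨y, hy⟩, rfl, ?_⟩
  exact RingOfIntegers.ext h

lemma exists_unit_ne_cube (h : Module.finrank ℚ E = 3) : ∃ ε : (𝓞 E)ˣ, ∀ x : E, ((ε : 𝓞 E) : E) ≠ x ^ 3 := by
  have hr : 0 < Units.rank E := by
    have h1 := InfinitePlace.card_add_two_mul_card_eq_rank E
    have h2 := InfinitePlace.card_eq_nrRealPlaces_add_nrComplexPlaces E
    rw [Units.rank]
    omega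
  let i : Fin (Units.rank E) := ⟨0, hr⟩
  refine ⟨Units.fundSystem E i, fun x hx ↦ ?_⟩
  obtain ⟨z, -, hz⟩ := exists_integral_cbrt hx
  have hzu : IsUnit z := isUnit_of_mul_isUnit_left (y := z ^ 2) (by
    rw [← pow_succ', ← hz]; exact Units.isUnit _)
  obtain ⟨η, rfl⟩ := hzu
  have h3 : Units.fundSystem E i = η ^ 3 := by ext1; simpa using hz
  obtain ⟨⟨ζ, e⟩, hη, -⟩ := Units.exist_unique_eq_mul_prod E η
  have h4 := (Units.exist_unique_eq_mul_prod E (Units.fundSystem E i)).unique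
    (y₁ := (ζ ^ 3, fun j ↦ 3 * e j)) (y₂ := (1, Pi.single i 1)) (by
      rw [h3, hη]
      simp only [mul_pow, ← Finset.prod_pow, SubmonoidClass.coe_pow]
      congr 1
      refine Finset.prod_congr rfl fun j _ ↦ ?_
      rw [mul_comm, zpow_mul]
      rfl) (by
      simp [Pi.single_apply])
  have h5 := congrFun (congrArg Prod.snd h4) i
  simp at h5
  omega

end units

lemma exists_two_in_kernel (f g h : ZMod 3) : ∃ a b c a' b' c' : ZMod 3, a * f + b * g + c * h = 0 ∧
    a' * f + b' * g + c' * h = 0 ∧ ∀ e e' : ZMod 3, ∃ s s' : ZMod 3, s * e + s' * e' = 0 ∧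
      ¬ (s * a + s' * a' = 0 ∧ s * b + s' * b' = 0 ∧ s * c + s' * c' = 0) := by
  by_cases hf : f = 0
  · by_cases hg : g = 0
    · refine ⟨1, 0, 0, 0, 1, 0, ?_⟩; subst hf hg; revert h; decide
    · refine ⟨1, 0, 0, 0, -(g * h), 1, ?_⟩; revert f g h; decide
  · refine ⟨-(f * g), 1, 0, -(f * h), 0, 1, ?_⟩; revert f g h; decide

namespace CubicTower
variable {L K k : Type*} [Field L] [NumberField L] [Field K] [NumberField K]
    [Field k] [NumberField k] [Algebra L k] [Algebra K k] {T : CubicTower L K k}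

lemma finrank_eq_three (T : CubicTower L K k) : Module.finrank ℚ L = 3 := by
  have h := T.norm_coord 2 0 0
  have h2 := Algebra.norm_algebraMap (R := ℚ) (S := L) 2
  simp [cubicForm] at h h2
  rw [h2] at h
  have : 2 ^ Module.finrank ℚ L = 2 ^ 3 := by exact_mod_cast h
  exact Nat.pow_right_injective (le_refl 2) this

lemma exists_kernel_base (T : CubicTower L K k) {p ℓ f : ℕ} (hr : IsRadicand T.D p ℓ f) :
    ∃ c : L, ∀ a : L, IsVirtualCube a → ∀ (r : ℚ) (x : L), a = r * x ^ 3 →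
      ∃ (e : ℕ) (x : L), x ≠ 0 ∧ a = c ^ e * x ^ 3 := by
  rcases hr.cases with h3 | ⟨h3, h9⟩
  · refine ⟨3, fun a ha r x hx ↦ ?_⟩
    obtain ⟨e, j, y, hy, h⟩ := exists_of_rat_mul_cube ha hx hr
    refine ⟨e + j, y, hy, ?_⟩
    rw [h, h3]; push_cast; ring
  · refine ⟨ℓ, fun a ha r x hx ↦ ?_⟩
    obtain ⟨e, j, y, hy, h⟩ := exists_of_rat_mul_cube ha hx hr
    by_cases he : 3 ∣ e
    · obtain ⟨e, rfl⟩ := he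
      refine ⟨j, 3 ^ e * y, mul_ne_zero (pow_ne_zero _ (by norm_num)) hy, ?_⟩
      rw [h]; ring
    · refine absurd ⟨by norm_num, fun v ↦ ?_⟩ (T.not_isVirtualCube_three h9)
      by_cases hv : ((3 : ℕ) : 𝓞 L) ∈ v.asIdeal
      · have hℓ : ord v ((ℓ : ℤ) : L) = 0 := ord_intCast_eq_zero hv (by
          rw [Nat.isCoprime_iff_coprime, Nat.coprime_primes Nat.prime_three hr.hℓ]; omega)
        have hℓ0 : (ℓ : L) ≠ 0 := by exact_mod_cast hr.hℓ.ne_zero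
        have h2 := ha.2 v
        rw [Int.cast_natCast] at hℓ
        have h30 : (3 : L) ≠ 0 := by norm_num
        rw [h, ord_mul v (mul_ne_zero (pow_ne_zero _ h30) (pow_ne_zero _ hℓ0)) (pow_ne_zero _ hy),
          ord_mul v (pow_ne_zero _ h30) (pow_ne_zero _ hℓ0), ord_pow, ord_pow,
          ord_pow, hℓ] at h2
        have : (3 : ℤ) ∣ e * ord v (3 : L) := by
          simpa using h2
        exact (Int.prime_three.dvd_or_dvd this).resolve_left (by exact_mod_cast he)
      · have h0 := ord_eq_zero_of_notMem (v := v) (x := (3 : 𝓞 L)) (by simpa using hv)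
        rw [RingOfIntegers.coe_eq_algebraMap, map_ofNat] at h0
        simp [h0]

variable [IsCyclotomicExtension {3} ℚ K]

lemma exists_cube_relation (T : CubicTower L K k) {p ℓ f : ℕ} (hr : IsRadicand T.D p ℓ f) {a₁ a₂ a₃ : L}
    (h₁ : IsVirtualCube a₁) (h₂ : IsVirtualCube a₂) (h₃ : IsVirtualCube a₃) :
    ∃ i j l : ℕ, ¬ (3 ∣ i ∧ 3 ∣ j ∧ 3 ∣ l) ∧ ∃ x : L, a₁ ^ i * a₂ ^ j * a₃ ^ l = x ^ 3 := by
  obtain ⟨γ, hγ⟩ := exists_place_over (E := K) hr.hp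
  obtain ⟨y₁, n₁, r₁⟩ := T.exists_rel h₁
  obtain ⟨y₂, n₂, r₂⟩ := T.exists_rel h₂
  obtain ⟨y₃, n₃, r₃⟩ := T.exists_rel h₃
  obtain ⟨c, hc⟩ := T.exists_kernel_base hr
  have key : ∀ i j l : ZMod 3, i * ((ord γ n₁ : ℤ) : ZMod 3) + j * ((ord γ n₂ : ℤ) : ZMod 3) +
      l * ((ord γ n₃ : ℤ) : ZMod 3) = 0 → ∃ (e : ℕ) (x : L), x ≠ 0 ∧
        a₁ ^ i.val * a₂ ^ j.val * a₃ ^ l.val = c ^ e * x ^ 3 := fun i j l h ↦ by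
    have hV : IsVirtualCube (a₁ ^ i.val * a₂ ^ j.val * a₃ ^ l.val) :=
      ((h₁.pow _).mul (h₂.pow _)).mul (h₃.pow _)
    have hR := ((r₁.pow i.val).mul (r₂.pow j.val)).mul (r₃.pow l.val)
    have hn : 3 ∣ ord γ (n₁ ^ i.val * n₂ ^ j.val * n₃ ^ l.val) := by
      have q₁ := r₁.ne_zero
      have q₂ := r₂.ne_zero
      have q₃ := r₃.ne_zero
      rw [ord_mul γ (by positivity) (by positivity), ord_mul γ (by positivity) (by positivity), ord_pow, ord_pow, ord_pow]
      refine (ZMod.intCast_zmod_eq_zero_iff_dvd _ 3).1 ?_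
      push_cast
      simpa using h
    obtain ⟨r, x, hx⟩ := hR.exists_rat_mul_cube hV.1 hr (hR.isVirtualCube hV hr hγ hn)
    exact hc _ hV r x hx
  obtain ⟨i, j, l, i', j', l', hk, hk', H⟩ := exists_two_in_kernel (ord γ n₁ : ℤ) (ord γ n₂ : ℤ) (ord γ n₃ : ℤ)
  obtain ⟨e, x, hx, hex⟩ := key _ _ _ hk
  obtain ⟨e', x', hx', hex'⟩ := key _ _ _ hk'
  obtain ⟨s, s', hs, hne⟩ := H e e'
  have hd : 3 ∣ s.val * e + s'.val * e' := by
    rw [← ZMod.natCast_eq_zero_iff]; push_cast; simpa using hs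
  obtain ⟨q, hq⟩ := hd
  refine ⟨s.val * i.val + s'.val * i'.val, s.val * j.val + s'.val * j'.val, s.val * l.val + s'.val * l'.val, ?_,
    c ^ q * x ^ s.val * x' ^ s'.val, ?_⟩
  · simp only [← ZMod.natCast_eq_zero_iff]
    push_cast
    simpa using hne
  · calc _ = (a₁ ^ i.val * a₂ ^ j.val * a₃ ^ l.val) ^ s.val * (a₁ ^ i'.val * a₂ ^ j'.val * a₃ ^ l'.val) ^ s'.val := by
          ring
      _ = c ^ (s.val * e + s'.val * e') * (x ^ s.val * x' ^ s'.val) ^ 3 := by rw [hex, hex']; ring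
      _ = _ := by rw [hq]; ring

lemma exists_pow_mul_pow_eq_one (T : CubicTower L K k) {p ℓ f : ℕ} (hr : IsRadicand T.D p ℓ f)
    {c₁ c₂ : ClassGroup (𝓞 L)} (h₁ : c₁ ^ 3 = 1) (h₂ : c₂ ^ 3 = 1) :
    ∃ i j : ℕ, ¬ (3 ∣ i ∧ 3 ∣ j) ∧ c₁ ^ i * c₂ ^ j = 1 := by
  obtain ⟨⟨I, hI⟩, rfl⟩ := ClassGroup.mk0_surjective c₁
  obtain ⟨⟨J, hJ⟩, rfl⟩ := ClassGroup.mk0_surjective c₂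
  obtain ⟨ε, hε⟩ := exists_unit_ne_cube T.finrank_eq_three
  rw [← map_pow, SubmonoidClass.mk_pow, ClassGroup.mk0_eq_one_iff] at h₁ h₂
  obtain ⟨a, ha⟩ := h₁
  obtain ⟨b, hb⟩ := h₂
  rw [Ideal.submodule_span_eq] at ha hb
  have hI0 : I ≠ ⊥ := nonZeroDivisors.ne_zero hI
  have hJ0 : J ≠ ⊥ := nonZeroDivisors.ne_zero hJ
  have ha0 : a ≠ 0 := by rintro rfl; exact pow_ne_zero 3 hI0 (by simpa using ha)
  have hb0 : b ≠ 0 := by rintro rfl; exact pow_ne_zero 3 hJ0 (by simpa using hb)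
  have hεV : IsVirtualCube ((ε : 𝓞 L) : L) := isVirtualCube_of_ideal (J := ⊤) (by simp) (by
    rw [Ideal.span_singleton_eq_top.2 ε.isUnit, ← Ideal.one_eq_top, one_pow])
  obtain ⟨i, j, l, hne, x, hx⟩ := T.exists_cube_relation hr (isVirtualCube_of_ideal ha0 ha.symm)
    (isVirtualCube_of_ideal hb0 hb.symm) hεV
  obtain ⟨z, hz, hz3⟩ := exists_integral_cbrt (x := a ^ i * b ^ j * (ε : 𝓞 L) ^ l) (y := x) (by simpa using hx)
  refine ⟨i, j, ?_, ?_⟩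
  · rintro ⟨⟨i, rfl⟩, ⟨j, rfl⟩⟩
    have hl : ¬ 3 ∣ l := fun hl ↦ hne ⟨⟨i, rfl⟩, ⟨j, rfl⟩, hl⟩
    have haL : (a : L) ≠ 0 := by simpa using ha0
    have hbL : (b : L) ≠ 0 := by simpa using hb0
    have hw : ((ε : 𝓞 L) : L) ^ l = (x / (a ^ i * b ^ j)) ^ 3 := by
      field_simp
      linear_combination hx
    have hεL : ((ε : 𝓞 L) : L) ≠ 0 := by simp
    obtain ⟨m, hm⟩ | ⟨m, hm⟩ : (∃ m, l = 3 * m + 1) ∨ ∃ m, l = 3 * m + 2 := by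
      have : l % 3 = 1 ∨ l % 3 = 2 := by omega
      rcases this with h | h
      · exact Or.inl ⟨l / 3, by omega⟩
      · exact Or.inr ⟨l / 3, by omega⟩
    · refine hε (x / (a ^ i * b ^ j) / ((ε : 𝓞 L) : L) ^ m) ?_
      rw [div_pow, ← hw, hm]
      field_simp
      ring
    · refine hε (((ε : 𝓞 L) : L) ^ (m + 1) / (x / (a ^ i * b ^ j))) ?_
      rw [div_pow (((ε : 𝓞 L) : L) ^ (m + 1)), ← hw, hm]
      field_simp
      ring
  · rw [← map_pow, ← map_pow, SubmonoidClass.mk_pow, SubmonoidClass.mk_pow, ← map_mul]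
    have : I ^ i * J ^ j = Ideal.span {z} := by
      apply ideal_pow_three_injective
      calc (I ^ i * J ^ j) ^ 3 = (I ^ 3) ^ i * (J ^ 3) ^ j := by ring
        _ = Ideal.span {a ^ i * b ^ j} := by
          rw [ha, hb, Ideal.span_singleton_pow, Ideal.span_singleton_pow, Ideal.span_singleton_mul_span_singleton]
        _ = Ideal.span {z ^ 3} := by
          rw [← hz3, Ideal.span_singleton_mul_right_unit (ε.isUnit.pow l)]
        _ = _ := by rw [Ideal.span_singleton_pow]
    exact (ClassGroup.mk0_eq_one_iff (I := I ^ i * J ^ j) (mul_mem (pow_mem hI _) (pow_mem hJ _))).2 ⟨z, this⟩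

end CubicTower

section group
variable {G : Type*} [CommGroup G]

lemma exists_pow_eq_of_not_dvd {g : G} (hg : g ^ 3 = 1) {i : ℕ} (hi : ¬ 3 ∣ i) : ∃ m, (g ^ i) ^ m = g := by
  have : i % 3 = 1 ∨ i % 3 = 2 := by omega
  rcases this with h | h
  · refine ⟨1, ?_⟩
    rw [← Nat.div_add_mod i 3, h, pow_one, pow_add, pow_mul, hg, one_pow, one_mul, pow_one]
  · refine ⟨2, ?_⟩
    rw [← Nat.div_add_mod i 3, h, pow_add, pow_mul, hg, one_pow, one_mul, ← pow_mul, pow_succ, hg, one_mul]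

lemma primaryComponent_three_of_generator [Fact (Nat.Prime 3)] {g : G} (hg3 : g ^ 3 = 1) (hg : ∀ c, g ≠ c ^ 3)
    (h : ∀ c : G, c ^ 3 = 1 → ∃ i j : ℕ, ¬ (3 ∣ i ∧ 3 ∣ j) ∧ g ^ i * c ^ j = 1) :
    Nat.card (CommGroup.primaryComponent G 3) = 3 ∧ IsCyclic (CommGroup.primaryComponent G 3) := by
  have hg1 : g ≠ 1 := by rintro rfl; exact hg 1 (by simp)
  have ht : ∀ c : G, c ^ 3 = 1 → ∃ i : ℕ, c = g ^ i := fun c hc ↦ by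
    obtain ⟨i, j, hij, h1⟩ := h c hc
    by_cases hj : 3 ∣ j
    · obtain ⟨j, rfl⟩ := hj
      rw [pow_mul, hc, one_pow, mul_one] at h1
      obtain ⟨m, hm⟩ := exists_pow_eq_of_not_dvd hg3 (i := i) fun hi ↦ hij ⟨hi, dvd_mul_right 3 j⟩
      rw [h1, one_pow] at hm
      exact absurd hm.symm hg1
    · obtain ⟨m, hm⟩ := exists_pow_eq_of_not_dvd hc hj
      have h2 : c ^ j = g ^ (2 * i) := by
        calc c ^ j = g ^ (2 * i) * (g ^ i * c ^ j) := by
              rw [← mul_assoc, ← pow_add, show 2 * i + i = 3 * i by ring, pow_mul, hg3, one_pow, one_mul]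
          _ = _ := by rw [h1, mul_one]
      exact ⟨2 * i * m, by rw [← hm, h2, ← pow_mul]⟩
  have hall : ∀ (n : ℕ) (c : G), c ^ 3 ^ n = 1 → c ∈ Subgroup.zpowers g := by
    intro n
    induction n with
    | zero => intro c hc; rw [pow_zero, pow_one] at hc; rw [hc]; exact one_mem _
    | succ n ih =>
      intro c hc
      rcases n.eq_zero_or_pos with rfl | hn
      · obtain ⟨i, rfl⟩ := ht c (by simpa using hc)
        exact pow_mem (Subgroup.mem_zpowers g) i
      · refine ih c ?_
        obtain ⟨i, hi⟩ := ht (c ^ 3 ^ n) (by rw [← pow_mul, ← pow_succ]; exact hc)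
        by_cases h3 : 3 ∣ i
        · obtain ⟨i, rfl⟩ := h3
          rw [hi, pow_mul, hg3, one_pow]
        · obtain ⟨m, hm⟩ := exists_pow_eq_of_not_dvd hg3 h3
          refine absurd ?_ (hg ((c ^ 3 ^ (n - 1)) ^ m))
          rw [← hm, ← hi, ← pow_mul, ← pow_mul, ← pow_mul]
          congr 1
          obtain ⟨n, rfl⟩ := Nat.exists_eq_succ_of_ne_zero hn.ne'
          simp only [Nat.succ_eq_add_one, Nat.add_sub_cancel]
          ring
  have heq : CommGroup.primaryComponent G 3 = Subgroup.zpowers g := by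
    ext c
    constructor
    · rintro ⟨n, hn⟩
      exact hall n c hn
    · intro hc
      obtain ⟨i, rfl⟩ := Subgroup.mem_zpowers_iff.1 hc
      exact ⟨1, by rw [pow_one, ← zpow_natCast, ← zpow_mul, mul_comm, zpow_mul, zpow_natCast, hg3, one_zpow]⟩
  rw [heq]
  exact ⟨by rw [Nat.card_zpowers, orderOf_eq_prime hg3 hg1], inferInstance⟩

end group

namespace CubicTower
variable {L K k : Type*} [Field L] [NumberField L] [Field K] [NumberField K]
    [Field k] [NumberField k] [Algebra L k] [Algebra K k] {T : CubicTower L K k}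

lemma mk0_ne_pow_three [IsCyclotomicExtension {3} ℚ K] (T : CubicTower L K k) {p M : ℕ} (hp : p.Prime) (hp3 : p % 3 = 1) (hM : ¬ p ∣ M)
    (hD : T.D = p * M) {I : Ideal (𝓞 L)} (hI : I ∈ (Ideal (𝓞 L))⁰) (hn : ¬ p ∣ Ideal.absNorm I)
    (hcube : ¬ (p : ℤ) ∣ (Ideal.absNorm I : ℤ) ^ ((p - 1) / 3) - 1) (c : ClassGroup (𝓞 L)) :
    ClassGroup.mk0 ⟨I, hI⟩ ≠ c ^ 3 := by
  obtain ⟨⟨J, hJ⟩, rfl⟩ := ClassGroup.mk0_surjective c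
  intro h
  rw [← map_pow, ClassGroup.mk0_eq_mk0_iff] at h
  obtain ⟨x, y, hx, hy, hxy⟩ := h
  simp only [SubmonoidClass.mk_pow] at hxy
  have hn2 := congrArg Ideal.absNorm hxy
  rw [map_mul, map_mul, map_pow, Ideal.absNorm_span_singleton, Ideal.absNorm_span_singleton] at hn2
  set n := Ideal.absNorm I
  set m := Ideal.absNorm J
  have hnorm : ∀ q : ℚ, Algebra.norm ℚ (q : L) = q ^ 3 := fun q ↦ by
    have := Algebra.norm_algebraMap (R := ℚ) (S := L) q
    rwa [T.finrank_eq_three, eq_ratCast] at this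
  have hxL : (x : L) ≠ 0 := by simpa using hx
  have hx0 : Algebra.norm ℤ x ≠ 0 := Algebra.norm_ne_zero_iff.2 hx
  have key : ∃ s : ℚ, s ^ 3 * (Algebra.norm ℤ y : ℚ) * m ^ 3 = (Algebra.norm ℤ x : ℚ) * n := by
    have hn3 := congrArg (Nat.cast (R := ℚ)) hn2
    rw [Nat.cast_mul, Nat.cast_mul, Nat.cast_natAbs, Nat.cast_natAbs, Int.cast_abs, Int.cast_abs, Nat.cast_pow] at hn3
    rcases abs_choice (Algebra.norm ℤ x : ℚ) with h1 | h1 <;> rcases abs_choice (Algebra.norm ℤ y : ℚ) with h2 | h2 <;>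
      rw [h1, h2] at hn3
    · exact ⟨1, by linarith⟩
    · exact ⟨-1, by linarith⟩
    · exact ⟨-1, by linarith⟩
    · exact ⟨1, by linarith⟩
  obtain ⟨s, hs⟩ := key
  refine hcube (T.dvd_pow_sub_one_of_norm hp hp3 hM hD (x := ((s * m : ℚ) : L) * (y : L) / (x : L)) (n := n) ?_ ?_)
  · exact_mod_cast hn
  · have h1 : Algebra.norm ℚ (((s * m : ℚ) : L) * (y : L) / (x : L)) * Algebra.norm ℚ (x : L) =
        Algebra.norm ℚ (((s * m : ℚ) : L) * (y : L)) := by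
      rw [← map_mul, div_mul_cancel₀ _ hxL]
    rw [map_mul, hnorm, ← Algebra.coe_norm_int, ← Algebra.coe_norm_int] at h1
    have h2 : (Algebra.norm ℤ x : ℚ) ≠ 0 := by exact_mod_cast hx0
    apply mul_right_cancel₀ h2
    rw [h1]
    push_cast
    linear_combination hs

theorem primaryComponent_three [IsCyclotomicExtension {3} ℚ K] [Fact (Nat.Prime 3)] (T : CubicTower L K k)
    {p ℓ f : ℕ} (hr : IsRadicand T.D p ℓ f) {I : Ideal (𝓞 L)} {a : 𝓞 L} (ha : a ≠ 0) (hI : I ^ 3 = Ideal.span {a})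
    (hn : ¬ p ∣ Ideal.absNorm I) (hcube : ¬ (p : ℤ) ∣ (Ideal.absNorm I : ℤ) ^ ((p - 1) / 3) - 1) :
    Nat.card (CommGroup.primaryComponent (ClassGroup (𝓞 L)) 3) = 3 ∧
      IsCyclic (CommGroup.primaryComponent (ClassGroup (𝓞 L)) 3) := by
  have hI0 : I ≠ ⊥ := by
    rintro rfl
    exact ha (Ideal.span_singleton_eq_bot.1 (by rw [← hI, Ideal.zero_eq_bot.symm, zero_pow three_ne_zero]))
  have hI' : I ∈ (Ideal (𝓞 L))⁰ := mem_nonZeroDivisors_of_ne_zero hI0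
  have hg3 : ClassGroup.mk0 ⟨I, hI'⟩ ^ 3 = 1 := by
    rw [← map_pow, SubmonoidClass.mk_pow, ClassGroup.mk0_eq_one_iff]
    exact ⟨a, hI⟩
  exact primaryComponent_three_of_generator hg3 (T.mk0_ne_pow_three hr.hp hr.p_mod_three hr.not_dvd hr.hD hI' hn hcube)
    fun c hc ↦ T.exists_pow_mul_pow_eq_one hr hg3 hc

end CubicTower

namespace CubicTower
variable {L K k : Type*} [Field L] [NumberField L] [Field K] [NumberField K]
    [Field k] [NumberField k] [Algebra L k] [Algebra K k] {T : CubicTower L K k}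

lemma natAbs_norm_natCast (T : CubicTower L K k) (n : ℕ) : Ideal.absNorm (Ideal.span {(n : 𝓞 L)}) = n ^ 3 := by
  rw [Ideal.absNorm_span_singleton]
  have h : (Algebra.norm ℤ (n : 𝓞 L) : ℚ) = n ^ 3 := by
    rw [Algebra.coe_norm_int]
    have := Algebra.norm_algebraMap (R := ℚ) (S := L) n
    rw [T.finrank_eq_three] at this
    simpa using this
  have h' : Algebra.norm ℤ (n : 𝓞 L) = n ^ 3 := by exact_mod_cast h
  rw [h', Int.natAbs_pow, Int.natAbs_natCast]

lemma exists_cbrt_ideal (T : CubicTower L K k) {p ℓ f : ℕ} (hp : p.Prime) (hℓ : ℓ.Prime) (hpℓ : p ≠ ℓ) {t : 𝓞 L}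
    (ht : t ^ 3 = p * ℓ ^ f) (hf : ¬ 3 ∣ f) : ∃ J : Ideal (𝓞 L), Ideal.span {(ℓ : 𝓞 L)} = J ^ 3 ∧ Ideal.absNorm J = ℓ := by
  have hp0 : (p : L) ≠ 0 := by exact_mod_cast hp.ne_zero
  have hℓ0 : (ℓ : L) ≠ 0 := by exact_mod_cast hℓ.ne_zero
  have hV : IsVirtualCube ((ℓ : 𝓞 L) : L) := by
    rw [RingOfIntegers.coe_eq_algebraMap, map_natCast]
    refine ⟨hℓ0, fun v ↦ ?_⟩
    by_cases hv : (ℓ : 𝓞 L) ∈ v.asIdeal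
    · have h1 : ord v ((p : ℤ) : L) = 0 := ord_intCast_eq_zero hv
        (by rw [Nat.isCoprime_iff_coprime, Nat.coprime_primes hℓ hp]; exact hpℓ.symm)
      have h2 := congrArg (ord v) (congrArg (algebraMap (𝓞 L) L) ht)
      rw [map_pow, map_mul, map_pow, map_natCast, map_natCast, ord_pow, ord_mul v hp0 (pow_ne_zero _ hℓ0), ord_pow] at h2
      rw [Int.cast_natCast] at h1
      rw [h1, zero_add] at h2
      have h3 : (3 : ℤ) ∣ f * ord v (ℓ : L) := ⟨_, by rw [← h2]; push_cast; rfl⟩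
      exact (Int.prime_three.dvd_or_dvd h3).resolve_left (by exact_mod_cast hf)
    · have := ord_eq_zero_of_notMem hv
      rw [RingOfIntegers.coe_eq_algebraMap, map_natCast] at this
      simp [this]
  obtain ⟨J, hJ⟩ := hV.exists_ideal
  refine ⟨J, hJ, ?_⟩
  have h1 := congrArg Ideal.absNorm hJ
  rw [T.natAbs_norm_natCast, map_pow] at h1
  exact (Nat.pow_left_injective (n := 3) (by norm_num) h1).symm

/-- The ideal class is noncubic when the second prime is not a cube modulo the first. -/
lemma exists_ideal_of_noncube (T : CubicTower L K k) {p ℓ f : ℕ} (hr : IsRadicand T.D p ℓ f) (hf : ¬ 3 ∣ f) :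
    ∃ I : Ideal (𝓞 L), I ^ 3 = Ideal.span {(ℓ : 𝓞 L)} ∧ Ideal.absNorm I = ℓ := by
  obtain ⟨J, hJ, hn⟩ := T.exists_cbrt_ideal hr.hp hr.hℓ hr.ne (t := T.θInt) (f := f) (by
    ext
    have := T.θ_pow
    rw [hr.hD] at this
    simpa using this) hf
  exact ⟨J, hJ.symm, hn⟩

variable {R : Type*} [Field R] [NumberField R] [Algebra L R]

lemma exists_ideal_of_periods (T : CubicTower L K k) {p ℓ f : ℕ} (hp : p.Prime) (hℓ : ℓ.Prime) (hpℓ : p ≠ ℓ)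
    {r : ℕ} {t : 𝓞 L} (htr : t = r * T.θInt) (ht : t ^ 3 = p * ℓ ^ f) (hf : f = 0 ∨ ¬ 3 ∣ f)
    {α : 𝓞 R} (hα : Algebra.adjoin L {(α : R)} = ⊤) (hαp : α ^ p = 1) {w₀ w₁ w₂ : 𝓞 R} {s₁ s₂ S : ℤ}
    (h₃ : w₀ * w₁ * w₂ = p * ℓ ^ f) (h₁ : w₀ + w₁ + w₂ = p * s₁) (h₂ : w₀ * w₁ + w₁ * w₂ + w₂ * w₀ = p * s₂)
    (hS : w₂ ^ 2 * w₁ + w₀ ^ 2 * w₂ + w₁ ^ 2 * w₀ = p * S) (hp6 : ¬ (p : ℤ) ∣ S + 6 * ℓ ^ f)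
    (hp3 : ¬ (p : ℤ) ∣ S - 3 * ℓ ^ f) :
    ∃ (I : Ideal (𝓞 L)) (a : 𝓞 L), a ≠ 0 ∧ I ^ 3 = Ideal.span {a} ∧ (Ideal.absNorm I : ℤ) = |S - 3 * ℓ ^ f| := by
  have hp0 : (p : 𝓞 R) ≠ 0 := by exact_mod_cast hp.ne_zero
  have hℓ0 : (ℓ : 𝓞 R) ≠ 0 := by exact_mod_cast hℓ.ne_zero
  set a : 𝓞 L := (S + 6 * ℓ ^ f : ℤ) + 3 * s₁ * t ^ 2 + 3 * s₂ * t with ha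
  have hnorm : Algebra.norm ℤ a = (S - 3 * ℓ ^ f) ^ 3 := by
    have h1 : (Algebra.norm ℤ a : ℚ) = cubicForm (T.D : ℚ) (S + 6 * ℓ ^ f) (3 * s₂ * r) (3 * s₁ * r ^ 2) := by
      rw [Algebra.coe_norm_int, ← T.norm_coord]
      congr 1
      have q6 : algebraMap (𝓞 L) L 6 = 6 := map_ofNat _ _
      have q3 : algebraMap (𝓞 L) L 3 = 3 := map_ofNat _ _
      rw [ha, htr, RingOfIntegers.coe_eq_algebraMap]
      simp [q6, q3]
      ring
    have hD : (r ^ 3 * T.D : ℤ) = p * ℓ ^ f := by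
      have h2 : (r : L) ^ 3 * T.D = p * ℓ ^ f := by
        have := congrArg (algebraMap (𝓞 L) L) ht
        rw [htr] at this
        simp only [map_pow, map_mul, map_natCast] at this
        rw [← this, ← T.θ_pow, mul_pow]; rfl
      exact_mod_cast h2
    have h2 : Algebra.norm ℤ a = cubicForm (p * ℓ ^ f : ℤ) (S + 6 * ℓ ^ f) (3 * s₂) (3 * s₁) := by
      have : (Algebra.norm ℤ a : ℚ) = ((cubicForm (p * ℓ ^ f : ℤ) (S + 6 * ℓ ^ f) (3 * s₂) (3 * s₁) : ℤ) : ℚ) := by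
        rw [h1, ← hD]
        simp only [cubicForm]
        push_cast
        ring
      exact_mod_cast this
    rw [h2]
    apply Int.cast_injective (α := 𝓞 R)
    apply mul_left_cancel₀ (pow_ne_zero 3 hp0)
    have e1 : (p : 𝓞 R) ^ 3 * (cubicForm (p * ℓ ^ f : ℤ) (S + 6 * ℓ ^ f) (3 * s₂) (3 * s₁) : ℤ) =
        cubicForm (p * ℓ ^ f : 𝓞 R) (p * S + 6 * (p * ℓ ^ f)) (3 * (p * s₂)) (3 * (p * s₁)) := by
      simp only [cubicForm]; push_cast; ring
    have e2 : (p : 𝓞 R) ^ 3 * ((S - 3 * ℓ ^ f) ^ 3 : ℤ) = (p * S - 3 * (p * ℓ ^ f)) ^ 3 := by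
      push_cast; ring
    rw [e1, e2, ← h₁, ← h₂, ← h₃, ← hS]
    simp only [cubicForm]
    ring
  have ha0 : a ≠ 0 := by
    rintro h0
    rw [h0, Algebra.norm_zero] at hnorm
    exact hp3 (by rw [pow_eq_zero_iff (n := 3) (by norm_num) |>.1 hnorm.symm]; exact dvd_zero _)
  set t' : 𝓞 R := algebraMap (𝓞 L) (𝓞 R) t with ht'
  have ht3 : t' ^ 3 = w₀ * w₁ * w₂ := by
    rw [h₃, ht', ← map_pow, ht]; simp
  have hcube : (p : 𝓞 R) * algebraMap (𝓞 L) (𝓞 R) a * (w₀ ^ 2 * w₁) = (t' ^ 2 + w₀ * t' + w₀ * w₁) ^ 3 := by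
    have e : (p : 𝓞 R) * algebraMap (𝓞 L) (𝓞 R) a = (p * S + 6 * (p * ℓ ^ f)) + 3 * (p * s₁) * t' ^ 2 + 3 * (p * s₂) * t' := by
      have q6 : algebraMap (𝓞 L) (𝓞 R) 6 = 6 := map_ofNat _ _
      have q3 : algebraMap (𝓞 L) (𝓞 R) 3 = 3 := map_ofNat _ _
      rw [ha]; simp [q6, q3]; ring
    rw [e, ← h₁, ← h₂, ← h₃, ← hS]
    linear_combination (-(t' ^ 3 + 3 * w₀ * t' ^ 2 + (3 * w₀ ^ 2 + 3 * w₀ * w₁) * t' + w₀ * w₁ * w₂ + w₀ ^ 3 + 6 * w₀ ^ 2 * w₁)) * ht3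
  have hunr : ∀ v : HeightOneSpectrum (𝓞 L), ((p * ℓ ^ f : ℕ) : 𝓞 L) ∉ v.asIdeal → 3 ∣ ord v (a : L) := by
    intro v hv
    obtain ⟨w, hw⟩ := exists_above (R := R) v
    have h1 := ord_algebraMap hα hp.ne_zero (c := 1) (by simpa using hαp) v w (fun h ↦ hv (by
      push_cast; exact v.asIdeal.mul_mem_right _ (by simpa using h))) (a : L)
    have hw' : (p * ℓ ^ f : 𝓞 R) ∉ w.asIdeal := fun h ↦ hv (by
      rw [Ideal.mem_of_liesOver w.asIdeal v.asIdeal]; simpa using h)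
    have hn0 : w₀ ∉ w.asIdeal := fun h ↦ hw' (by
      rw [← h₃, mul_assoc]; exact w.asIdeal.mul_mem_right _ h)
    have hn1 : w₁ ∉ w.asIdeal := fun h ↦ hw' (by
      rw [← h₃, mul_comm w₀, mul_assoc]; exact w.asIdeal.mul_mem_right _ h)
    have hnp : (p : 𝓞 R) ∉ w.asIdeal := fun h ↦ hw' (w.asIdeal.mul_mem_right _ h)
    have hz : ∀ x : 𝓞 R, x ∉ w.asIdeal → (x : R) ≠ 0 := fun x hx h0 ↦ hx (by
      rw [show x = 0 by simpa using h0]; exact zero_mem _)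
    have haR : algebraMap (𝓞 R) R (algebraMap (𝓞 L) (𝓞 R) a) = algebraMap L R (a : L) := rfl
    have haR0 : algebraMap L R (a : L) ≠ 0 := by simpa using ha0
    have h2 := congrArg (ord w) (congrArg (algebraMap (𝓞 R) R) hcube)
    rw [map_mul, map_mul, map_mul, map_pow, map_pow, ord_pow, haR,
      ord_mul w (mul_ne_zero (hz _ hnp) haR0) (mul_ne_zero (pow_ne_zero _ (hz _ hn0)) (hz _ hn1)),
      ord_mul w (hz _ hnp) haR0, ord_mul w (pow_ne_zero _ (hz _ hn0)) (hz _ hn1), ord_pow, h1] at h2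
    have q1 := ord_eq_zero_of_notMem hnp
    have q2 := ord_eq_zero_of_notMem hn0
    have q3 := ord_eq_zero_of_notMem hn1
    rw [RingOfIntegers.coe_eq_algebraMap] at q1 q2 q3
    rw [q1, q2, q3] at h2
    exact ⟨_, by simpa using h2⟩
  have hpord : ∀ v : HeightOneSpectrum (𝓞 L), (p : 𝓞 L) ∈ v.asIdeal → 3 ∣ ord v (a : L) := by
    intro v hv
    have htv : t ∈ v.asIdeal := v.isPrime.mem_of_pow_mem 3 (by rw [ht]; exact v.asIdeal.mul_mem_right _ hv)
    have : a ∉ v.asIdeal := fun h ↦ by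
      have h1 : ((S + 6 * ℓ ^ f : ℤ) : 𝓞 L) ∈ v.asIdeal := by
        have e : ((S + 6 * ℓ ^ f : ℤ) : 𝓞 L) = a - (3 * s₁ * t + 3 * s₂) * t := by rw [ha]; ring
        rw [e]
        exact sub_mem h (Ideal.mul_mem_left _ _ htv)
      have h2 := ord_intCast_eq_zero hv (n := S + 6 * ℓ ^ f)
        ((Nat.prime_iff_prime_int.1 hp).coprime_iff_not_dvd.2 hp6)
      have h3 : (S + 6 * ℓ ^ f : ℤ) ≠ 0 := fun h ↦ hp6 (h ▸ dvd_zero _)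
      have h4 := ord_neg_of_mem (v := v) (by exact_mod_cast h3) h1
      rw [RingOfIntegers.coe_eq_algebraMap, map_intCast] at h4
      omega
    rw [ord_eq_zero_of_notMem this]
    exact dvd_zero _
  have hV : IsVirtualCube (a : L) := by
    refine ⟨by simpa using ha0, ?_⟩
    rcases hf with rfl | hf
    · intro v
      by_cases hv : (p : 𝓞 L) ∈ v.asIdeal
      · exact hpord v hv
      · exact hunr v (by simpa using hv)
    obtain ⟨J, hJ, hJn⟩ := T.exists_cbrt_ideal hp hℓ hpℓ ht hf
    have hJp : J.IsPrime := Ideal.isPrime_of_irreducible_absNorm (by rw [hJn]; exact hℓ)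
    have hℓL : (ℓ : 𝓞 L) ≠ 0 := by exact_mod_cast hℓ.ne_zero
    have hJ0 : J ≠ ⊥ := by
      rintro rfl
      rw [Ideal.absNorm_bot] at hJn
      exact hℓ.ne_zero hJn.symm
    let u : HeightOneSpectrum (𝓞 L) := ⟨J, hJp, hJ0⟩
    have hother : ∀ v : HeightOneSpectrum (𝓞 L), v ≠ u → 3 ∣ ord v (a : L) := by
      intro v hv
      by_cases hpv : (p : 𝓞 L) ∈ v.asIdeal
      · exact hpord v hpv
      refine hunr v fun h ↦ hv ?_
      push_cast at h
      have h1 : (ℓ : 𝓞 L) ∈ v.asIdeal := v.isPrime.mem_of_pow_mem _ ((v.isPrime.mem_or_mem h).resolve_left hpv)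
      have h2 : J ≤ v.asIdeal := by
        have : J ^ 3 ≤ v.asIdeal := by rw [← hJ]; simpa using h1
        exact (v.isPrime.pow_le_iff (by norm_num)).1 this
      ext1
      exact (u.isMaximal.eq_of_le v.isPrime.ne_top h2).symm
    intro v
    by_cases hv : v = u
    swap
    · exact hother v hv
    rw [hv, ord_eq_neg_multiplicity u ha0, dvd_neg]
    set m := multiplicity u.asIdeal (Ideal.span {a}) with hm
    set i := 2 * m with hi
    have hspan : Ideal.span {a} ≠ ⊥ := by simpa using ha0
    obtain ⟨I, hI⟩ := ideal_isCube (I := Ideal.span {a} * J ^ i) (mul_ne_zero hspan (pow_ne_zero _ hJ0)) fun v ↦ by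
      rw [multiplicity_mul v.prime (FiniteMultiplicity.of_prime_left v.prime
        (mul_ne_zero hspan (pow_ne_zero _ hJ0))), multiplicity_pow_ideal v hJ0]
      by_cases hv : v = u
      · rw [hv, ← hm, show multiplicity u.asIdeal J = 1 from multiplicity_self ..]
        omega
      · have h1 := hother v hv
        rw [ord_eq_neg_multiplicity v ha0, dvd_neg] at h1
        have h2 : multiplicity v.asIdeal J = 0 := by
          rw [multiplicity_eq_zero]
          intro hd
          apply hv
          ext1
          exact (u.isMaximal.eq_of_le v.isPrime.ne_top (Ideal.dvd_iff_le.1 hd)).symm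
        rw [h2, mul_zero, add_zero]
        exact_mod_cast h1
    have h1 := congrArg Ideal.absNorm hI
    rw [map_mul, map_pow, map_pow, Ideal.absNorm_span_singleton, hnorm, Int.natAbs_pow, hJn] at h1
    have hne : (S - 3 * ℓ ^ f : ℤ) ≠ 0 := fun h ↦ hp3 (h ▸ dvd_zero _)
    have h2 := congrArg (fun n ↦ n.factorization ℓ) h1
    simp only [Nat.factorization_pow] at h2
    rw [Nat.factorization_mul (pow_ne_zero _ (Int.natAbs_ne_zero.2 hne)) (pow_ne_zero _ hℓ.ne_zero)] at h2
    simp [hℓ.factorization_self] at h2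
    omega
  obtain ⟨I, hI⟩ := hV.exists_ideal
  refine ⟨I, a, ha0, hI.symm, ?_⟩
  have h1 := congrArg Ideal.absNorm hI
  rw [Ideal.absNorm_span_singleton, hnorm, Int.natAbs_pow, map_pow] at h1
  rw [← Nat.pow_left_injective (n := 3) (by norm_num) h1, Int.natCast_natAbs]

end CubicTower

/-- The arithmetic of the cyclic cubic field of conductor `p` used below: a generator `g` of the Galois group acting on
the ring of integers, and a generator `π` of the ramified prime. -/
structure CyclicCubic (F : Type*) [Field F] [NumberField F] (p : ℕ) where
  g : 𝓞 F ≃+* 𝓞 F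
  g_g_g : ∀ x, g (g (g x)) = x
  fixed : ∀ x, g x = x → ∃ n : ℤ, x = n
  norm_eq : ∀ x, ((Algebra.norm ℤ x : ℤ) : 𝓞 F) = x * g x * g (g x)
  hilbert : ∀ x y : 𝓞 F, y ≠ 0 → Algebra.norm ℤ x = Algebra.norm ℤ y → ∃ b, b ≠ 0 ∧ x * g b = y * b
  π : 𝓞 F
  u : 𝓞 F
  π_norm : π * g π * g (g π) = p
  g_π : g π = u * π
  cube_of_ideal : ∀ (n : ℕ) (J : Ideal (𝓞 F)), n ≠ 0 → Ideal.span {(n : 𝓞 F)} = J ^ 3 → ∃ i m : ℕ, n = p ^ i * m ^ 3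

namespace CyclicCubic
variable {F : Type*} [Field F] [NumberField F] {p : ℕ} (C : CyclicCubic F p)

lemma norm_π : Algebra.norm ℤ C.π = p := by
  have := C.norm_eq C.π
  rw [C.π_norm] at this
  exact_mod_cast this

lemma exists_residue [Fact p.Prime] : ∃ φ : 𝓞 F →+* ZMod p, (∀ x, φ x = 0 ↔ C.π ∣ x) := by
  have hcard : Nat.card (𝓞 F ⧸ Ideal.span {C.π}) = p := by
    have := Ideal.absNorm_span_singleton C.π
    rw [C.norm_π, Ideal.absNorm_apply, Submodule.cardQuot_apply] at this
    simpa using this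
  have hf : Finite (𝓞 F ⧸ Ideal.span {C.π}) := 
    Nat.finite_of_card_ne_zero (by rw [hcard]; exact (Fact.out : p.Prime).ne_zero)
  let _ := Fintype.ofFinite (𝓞 F ⧸ Ideal.span {C.π})
  let e := ZMod.ringEquivOfPrime (𝓞 F ⧸ Ideal.span {C.π}) (p := p) Fact.out
    (Nat.card_eq_fintype_card.symm.trans hcard)
  refine ⟨(e.symm : 𝓞 F ⧸ Ideal.span {C.π} →+* ZMod p).comp (Ideal.Quotient.mk _), fun x ↦ ?_⟩
  rw [RingHom.comp_apply, RingHom.coe_coe, map_eq_zero_iff _ e.symm.injective, Ideal.Quotient.eq_zero_iff_mem,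
    Ideal.mem_span_singleton]

lemma g_u : C.u * C.g C.u * C.g (C.g C.u) = 1 ∨ p = 0 := by
  by_cases hp : p = 0
  · exact Or.inr hp
  left
  have h := C.norm_eq C.u
  have h1 : Algebra.norm ℤ (C.g C.π) = Algebra.norm ℤ C.π := by
    have h2 := C.norm_eq (C.g C.π)
    rw [C.g_g_g] at h2
    have h3 := C.norm_eq C.π
    apply Int.cast_injective (α := 𝓞 F)
    rw [h2, h3]; ring
  rw [C.g_π, map_mul, C.norm_π] at h1
  have h2 : Algebra.norm ℤ C.u = 1 := by
    have : (p : ℤ) ≠ 0 := by exact_mod_cast hp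
    exact mul_right_cancel₀ this (by rw [h1, one_mul])
  rw [← h, h2, Int.cast_one]

theorem exists_periods [Fact p.Prime] (hp9 : p % 9 = 4 ∨ p % 9 = 7) {κ : 𝓞 F} {D : ℤ} (hD : ¬ (p : ℤ) ∣ D)
    (hκ : κ * C.g κ * C.g (C.g κ) = D) : ∃ (w₀ w₁ w₂ : 𝓞 F) (s₁ s₂ S : ℤ),
      w₀ * w₁ * w₂ = p * D ∧ w₀ + w₁ + w₂ = p * s₁ ∧ w₀ * w₁ + w₁ * w₂ + w₂ * w₀ = p * s₂ ∧
      w₂ ^ 2 * w₁ + w₀ ^ 2 * w₂ + w₁ ^ 2 * w₀ = p * S ∧ ¬ (p : ℤ) ∣ S + 6 * D ∧ ¬ (p : ℤ) ∣ S - 3 * D ∧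
      ¬ (p : ℤ) ∣ |S - 3 * D| ^ ((p - 1) / 3) - 1 := by
  have hp : p.Prime := Fact.out
  obtain ⟨φ, hφ⟩ := C.exists_residue
  have hu := C.g_u.resolve_right hp.ne_zero
  have hπ0 : C.π ≠ 0 := by
    intro h
    have := C.π_norm
    rw [h, zero_mul, zero_mul] at this
    exact hp.ne_zero (by exact_mod_cast this.symm)
  have hφπ : φ C.π = 0 := (hφ _).2 dvd_rfl
  have hφg : ∀ x, φ (C.g x) = φ x := fun x ↦ by
    have h1 : φ (x - ((φ x).val : ℕ)) = 0 := by simp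
    obtain ⟨y, hy⟩ := (hφ _).1 h1
    have h2 := congrArg φ (congrArg C.g hy)
    rw [map_mul, C.g_π, map_mul, map_mul, hφπ, map_sub, map_natCast, map_sub, map_natCast, ZMod.natCast_zmod_val] at h2
    linear_combination h2
  have hint : ∀ n : ℤ, φ n = 0 ↔ (p : ℤ) ∣ n := fun n ↦ by
    rw [map_intCast, ZMod.intCast_zmod_eq_zero_iff_dvd]
  set ω := φ C.u with hω
  have hω3 : ω ^ 3 = 1 := by
    have := congrArg φ hu
    rw [map_mul, map_mul, hφg, hφg, hφg, map_one] at this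
    rw [← this]; ring
  have h3 : (3 : ZMod p) ≠ 0 := by
    have : ((3 : ℕ) : ZMod p) ≠ 0 := by
      rw [Ne, ZMod.natCast_eq_zero_iff, Nat.prime_dvd_prime_iff_eq hp Nat.prime_three]
      rintro rfl; omega
    exact_mod_cast this
  set η := C.u ^ 2 * C.g C.u with hη
  have hp3 : (p : 𝓞 F) = C.π ^ 3 * η := by
    rw [← C.π_norm, C.g_π, map_mul, C.g_π, hη]; ring
  have hω1 : ω ≠ 1 := by
    intro h1
    obtain ⟨t, ht⟩ := C.fixed (C.π + C.g C.π + C.g (C.g C.π)) (by simp only [map_add, C.g_g_g]; ring)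
    have hte : C.π * (1 + C.u + C.u * C.g C.u) = t := by
      rw [← ht, C.g_π, map_mul, C.g_π]; ring
    obtain ⟨m, hm⟩ := (hint t).1 (by rw [← hte, map_mul, hφπ, zero_mul])
    have h2 : 1 + C.u + C.u * C.g C.u = C.π * (C.π * η * m) := by
      apply mul_left_cancel₀ hπ0
      rw [hte, hm]; push_cast; rw [hp3]; ring
    have h4 := congrArg φ h2
    simp only [map_add, map_mul, map_one, hφπ, hφg, ← hω, h1, zero_mul] at h4
    exact h3 (by linear_combination h4)
  have hωr : ω ^ 2 + ω + 1 = 0 := by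
    have : (ω - 1) * (ω ^ 2 + ω + 1) = 0 := by linear_combination hω3
    exact (mul_eq_zero.1 this).resolve_left (sub_ne_zero.2 hω1)
  set k := φ κ with hk
  have hDk : (D : ZMod p) = k ^ 3 := by
    have := congrArg φ hκ
    rw [map_mul, map_mul, hφg, hφg, hφg, map_intCast] at this
    rw [← this]; ring
  have hD0 : (D : ZMod p) ≠ 0 := by rwa [Ne, ZMod.intCast_zmod_eq_zero_iff_dvd]
  have hk0 : k ≠ 0 := by rintro h; rw [hDk, h] at hD0; simp at hD0
  set w₀ := C.π * κ with hw₀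
  set w₁ := C.g w₀ with hw₁
  set w₂ := C.g w₁ with hw₂
  have hgw₂ : C.g w₂ = w₀ := C.g_g_g _
  have e₁ : w₁ = C.π * (C.u * C.g κ) := by rw [hw₁, hw₀, map_mul, C.g_π]; ring
  have e₂ : w₂ = C.π * (C.u * C.g C.u * C.g (C.g κ)) := by rw [hw₂, e₁, map_mul, map_mul, C.g_π]; ring
  have z₀ : φ w₀ = 0 := by rw [hw₀, map_mul, hφπ, zero_mul]
  have z₁ : φ w₁ = 0 := by rw [hw₁, hφg, z₀]
  have z₂ : φ w₂ = 0 := by rw [hw₂, hφg, z₁]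
  have rational : ∀ x, C.g x = x → φ x = 0 → ∃ s : ℤ, x = p * s := fun x hx h0 ↦ by
    obtain ⟨n, rfl⟩ := C.fixed x hx
    obtain ⟨m, rfl⟩ := (hint n).1 h0
    exact ⟨m, by push_cast; rfl⟩
  obtain ⟨s₁, hs₁⟩ := rational (w₀ + w₁ + w₂) (by rw [map_add, map_add, hgw₂, ← hw₁, ← hw₂]; ring)
    (by simp [z₀, z₁, z₂])
  obtain ⟨s₂, hs₂⟩ := rational (w₀ * w₁ + w₁ * w₂ + w₂ * w₀)
    (by simp only [map_add, map_mul, hgw₂, ← hw₁, ← hw₂]; ring) (by simp [z₀, z₁, z₂])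
  obtain ⟨S, hS⟩ := rational (w₂ ^ 2 * w₁ + w₀ ^ 2 * w₂ + w₁ ^ 2 * w₀)
    (by simp only [map_add, map_mul, map_pow, hgw₂, ← hw₁, ← hw₂]; ring) (by simp [z₀, z₁, z₂])
  have hSr : (S : ZMod p) = 3 * ω ^ 2 * D := by
    have h1 : η * S = (C.u * C.g C.u * C.g (C.g κ)) ^ 2 * (C.u * C.g κ) + κ ^ 2 * (C.u * C.g C.u * C.g (C.g κ)) +
        (C.u * C.g κ) ^ 2 * κ := by
      apply mul_left_cancel₀ (pow_ne_zero 3 hπ0)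
      rw [← mul_assoc, ← hp3, ← hS, e₁, e₂, hw₀]; ring
    have h2 := congrArg φ h1
    simp only [hη, map_mul, map_add, map_pow, hφg, map_intCast, ← hω, ← hk] at h2
    rw [hDk]
    linear_combination h2 + (ω ^ 2 * k ^ 3 - S) * hω3
  refine ⟨w₀, w₁, w₂, s₁, s₂, S, ?_, hs₁, hs₂, hS, ?_, ?_, ?_⟩
  · rw [← hκ, ← C.π_norm, hw₂, hw₁, hw₀]; simp only [map_mul]; ring
  · rw [← ZMod.intCast_zmod_eq_zero_iff_dvd]
    push_cast
    rw [hSr]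
    intro h
    have h1 : 3 * (ω ^ 2 + 2) * (D : ZMod p) = 0 := by linear_combination h
    have h2 : ω ^ 2 + 2 = 0 := by simpa [h3, hD0] using h1
    apply h3
    linear_combination h2 + (ω + 1) * (h2 - hωr)
  · rw [← ZMod.intCast_zmod_eq_zero_iff_dvd]
    push_cast
    rw [hSr]
    intro h
    have h1 : 3 * (ω ^ 2 - 1) * (D : ZMod p) = 0 := by linear_combination h
    have h2 : ω ^ 2 - 1 = 0 := by simpa [h3, hD0] using h1
    apply hω1
    linear_combination hω3 - ω * h2
  · obtain ⟨m, hm⟩ : ∃ m, p = 6 * m + 1 := by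
      have : p % 2 = 1 := by
        rcases hp.eq_two_or_odd with h | h
        · omega
        · exact h
      exact ⟨p / 6, by omega⟩
    have hpm : (p - 1) / 3 = 2 * m := by omega
    rw [hpm, pow_mul, sq_abs, ← pow_mul, ← ZMod.intCast_zmod_eq_zero_iff_dvd]
    push_cast
    rw [hSr]
    have h1 : 3 * ω ^ 2 * D - 3 * D = -(ω * ((ω ^ 2 - 1) * k) ^ 3) := by
      rw [hDk]
      linear_combination k ^ 3 * (ω * (ω ^ 3 + 1) - 3 * ω ^ 2 + 3) * hω3
    have hne : (ω ^ 2 - 1) * k ≠ 0 := by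
      refine mul_ne_zero (fun h2 ↦ hω1 ?_) hk0
      linear_combination hω3 - ω * h2
    have hf : ((ω ^ 2 - 1) * k) ^ (3 * (2 * m)) = 1 := by
      rw [show 3 * (2 * m) = p - 1 by omega]
      exact ZMod.pow_card_sub_one_eq_one hne
    rw [h1, pow_mul, neg_sq, ← pow_mul, mul_pow, ← pow_mul, hf, mul_one]
    intro h2
    have h2 : ω ^ (2 * m) = 1 := by linear_combination h2
    have : m % 3 = 1 ∨ m % 3 = 2 := by omega
    rcases this with h | h
    · have e : 2 * m = 3 * (2 * (m / 3)) + 2 := by omega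
      rw [e, pow_add, pow_mul, hω3, one_pow, one_mul] at h2
      apply hω1
      linear_combination hω3 - ω * h2
    · have e : 2 * m = 3 * (2 * (m / 3) + 1) + 1 := by omega
      rw [e, pow_add, pow_mul, hω3, one_pow, one_mul, pow_one] at h2
      exact hω1 h2

end CyclicCubic

namespace CyclicCubic
variable {F : Type*} [Field F] [NumberField F] {p : ℕ}

/-- The action of the chosen generator on ideals. -/
def act (C : CyclicCubic F p) (I : Ideal (𝓞 F)) : Ideal (𝓞 F) := I.map (C.g : 𝓞 F →+* 𝓞 F)

lemma act_mul (C : CyclicCubic F p) (I J : Ideal (𝓞 F)) : C.act (I * J) = C.act I * C.act J := Ideal.map_mul _ _ _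

lemma act_pow (C : CyclicCubic F p) (I : Ideal (𝓞 F)) (n : ℕ) : C.act (I ^ n) = C.act I ^ n := Ideal.map_pow _ _ _

lemma act_span (C : CyclicCubic F p) (a : 𝓞 F) : C.act (Ideal.span {a}) = Ideal.span {C.g a} := by
  rw [act, Ideal.map_span, Set.image_singleton]; rfl

lemma act_act_act (C : CyclicCubic F p) (I : Ideal (𝓞 F)) : C.act (C.act (C.act I)) = I := by
  rw [act, act, act, Ideal.map_map, Ideal.map_map]
  convert Ideal.map_id I
  ext x
  simp [C.g_g_g]

lemma norm_g (C : CyclicCubic F p) (a : 𝓞 F) : Algebra.norm ℤ (C.g a) = Algebra.norm ℤ a := by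
  apply Int.cast_injective (α := 𝓞 F)
  rw [C.norm_eq, C.norm_eq, C.g_g_g]
  ring

lemma norm_neg (C : CyclicCubic F p) (a : 𝓞 F) : Algebra.norm ℤ (-a) = -Algebra.norm ℤ a := by
  apply Int.cast_injective (α := 𝓞 F)
  rw [C.norm_eq, Int.cast_neg, C.norm_eq]
  simp only [map_neg]
  ring

lemma span_p (C : CyclicCubic F p) (hp : p ≠ 0) : Ideal.span {(p : 𝓞 F)} = Ideal.span {C.π} ^ 3 := by
  have hu := C.g_u.resolve_right hp
  rw [Ideal.span_singleton_pow, Ideal.span_singleton_eq_span_singleton]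
  have h1 : C.u * (C.g C.u * C.g (C.g C.u)) = 1 := by rw [← mul_assoc, hu]
  have h2 : IsUnit (C.u ^ 2 * C.g C.u) :=
    ((IsUnit.of_mul_eq_one _ h1).pow 2).mul ((IsUnit.of_mul_eq_one _ h1).map C.g)
  refine (Associated.symm ⟨h2.unit, ?_⟩)
  rw [IsUnit.unit_spec, ← C.π_norm, C.g_π, map_mul, C.g_π]
  ring

lemma isPrincipal_of_fixed (C : CyclicCubic F p) (hp : p ≠ 0) {J : Ideal (𝓞 F)} {e : 𝓞 F} (he : e ≠ 0) (hJ : J ^ 3 = Ideal.span {e})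
    (hg : C.act J = J) : ∃ c, J = Ideal.span {c} := by
  have h1 : Ideal.span {C.g e} = Ideal.span {e} := by rw [← C.act_span, ← hJ, C.act_pow, hg]
  have h2 : Ideal.span {C.g (C.g e)} = Ideal.span {e} := by rw [← C.act_span, h1, C.act_span, h1]
  have h3 : Ideal.span {e} ^ 3 = Ideal.span {((Ideal.absNorm J : ℕ) : 𝓞 F)} ^ 3 := by
    have h4 : Ideal.span {e} ^ 3 = Ideal.span {((Algebra.norm ℤ e : ℤ) : 𝓞 F)} := by
      rw [C.norm_eq, ← Ideal.span_singleton_mul_span_singleton, ← Ideal.span_singleton_mul_span_singleton, h1, h2]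
      ring
    have h5 : (Algebra.norm ℤ e).natAbs = Ideal.absNorm J ^ 3 := by
      rw [← Ideal.absNorm_span_singleton, ← hJ, map_pow]
    rw [h4, Ideal.span_singleton_pow, ← Nat.cast_pow, ← h5]
    rcases Int.natAbs_eq (Algebra.norm ℤ e) with h | h
    · conv_lhs => rw [h]
      simp
    · conv_lhs => rw [h]
      rw [Int.cast_neg, Ideal.span_singleton_neg]
      simp
  have h4 := (ideal_pow_three_injective h3).symm.trans hJ.symm
  have hJ0 : Ideal.absNorm J ≠ 0 := by
    rw [Ne, Ideal.absNorm_eq_zero_iff]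
    rintro rfl
    rw [← Ideal.zero_eq_bot, zero_pow three_ne_zero, eq_comm, Ideal.zero_eq_bot, Ideal.span_singleton_eq_bot] at hJ
    exact he hJ
  obtain ⟨i, m, him⟩ := C.cube_of_ideal _ J hJ0 h4
  refine ⟨C.π ^ i * m, ideal_pow_three_injective ?_⟩
  rw [← h4, him, Nat.cast_mul, Nat.cast_pow, Nat.cast_pow, ← Ideal.span_singleton_mul_span_singleton,
    ← Ideal.span_singleton_pow, C.span_p hp, ← Ideal.span_singleton_mul_span_singleton, mul_pow,
    Ideal.span_singleton_pow, Ideal.span_singleton_pow, Ideal.span_singleton_pow, Ideal.span_singleton_pow,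
    ← pow_mul, ← pow_mul, mul_comm 3]

lemma isPrincipal_of_mul_act_sq (C : CyclicCubic F p) (hp : p ≠ 0) {I : Ideal (𝓞 F)} {a d : 𝓞 F} (ha : a ≠ 0) (hI : I ^ 3 = Ideal.span {a})
    (hd : I * C.act I ^ 2 = Ideal.span {d}) : ∃ c, I = Ideal.span {c} := by
  have hga : C.g a ≠ 0 := by simpa using ha
  have h1 : I * Ideal.span {C.g a} = C.act I * Ideal.span {d} := by
    rw [← C.act_span, ← hI, C.act_pow, ← hd]; ring
  have h2 : Ideal.span {d} ^ 3 = Ideal.span {a} * Ideal.span {C.g a} ^ 2 := by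
    rw [← hd, ← C.act_span, ← hI, C.act_pow]; ring
  have h3 : (Algebra.norm ℤ d).natAbs = (Algebra.norm ℤ a).natAbs := by
    have := congrArg Ideal.absNorm h2
    simp only [map_pow, map_mul, Ideal.absNorm_span_singleton, C.norm_g] at this
    exact Nat.pow_left_injective three_ne_zero (this.trans (by ring))
  have hd0 : d ≠ 0 := by
    rintro rfl
    rw [Algebra.norm_zero] at h3
    exact ha (Algebra.norm_eq_zero_iff.1 (Int.natAbs_eq_zero.1 h3.symm))
  obtain ⟨d', hd'0, hd', hn⟩ : ∃ d', d' ≠ 0 ∧ Ideal.span {d'} = Ideal.span {d} ∧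
      Algebra.norm ℤ (C.g a) = Algebra.norm ℤ d' := by
    rcases Int.natAbs_eq_natAbs_iff.1 h3 with h | h
    · exact ⟨d, hd0, rfl, by rw [C.norm_g, h]⟩
    · exact ⟨-d, neg_ne_zero.2 hd0, Ideal.span_singleton_neg _, by rw [C.norm_g, C.norm_neg, h, neg_neg]⟩
  obtain ⟨b, hb, hab⟩ := C.hilbert _ _ hd'0 hn
  have hs : ∀ x : 𝓞 F, x ≠ 0 → Ideal.span {x} ≠ 0 := fun x hx ↦ by
    rwa [Ne, Ideal.zero_eq_bot, Ideal.span_singleton_eq_bot]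
  have hfix : C.act (I * Ideal.span {b}) = I * Ideal.span {b} := by
    apply mul_right_cancel₀ (hs _ hd0)
    calc C.act (I * Ideal.span {b}) * Ideal.span {d}
        = (C.act I * Ideal.span {d}) * Ideal.span {C.g b} := by rw [C.act_mul, C.act_span]; ring
      _ = I * Ideal.span {C.g a * C.g b} := by rw [← h1, mul_assoc, Ideal.span_singleton_mul_span_singleton]
      _ = I * Ideal.span {b} * Ideal.span {d} := by
          rw [hab, ← Ideal.span_singleton_mul_span_singleton, hd']; ring
  obtain ⟨c, hc⟩ := C.isPrincipal_of_fixed hp (mul_ne_zero ha (pow_ne_zero 3 hb))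
    (show (I * Ideal.span {b}) ^ 3 = Ideal.span {a * b ^ 3} by
      rw [mul_pow, hI, Ideal.span_singleton_pow, Ideal.span_singleton_mul_span_singleton]) hfix
  obtain ⟨c', rfl⟩ : b ∣ c := by
    rw [← Ideal.span_singleton_le_span_singleton, ← hc]
    exact Ideal.mul_le_right
  exact ⟨c', mul_right_cancel₀ (hs b hb) (by rw [hc, Ideal.span_singleton_mul_span_singleton, mul_comm])⟩

/-- The cyclic cubic field of prime conductor has class number prime to three. -/
lemma isPrincipal_of_pow_three (C : CyclicCubic F p) (hp : p ≠ 0) {I : Ideal (𝓞 F)} {a : 𝓞 F} (ha : a ≠ 0) (hI : I ^ 3 = Ideal.span {a}) :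
    ∃ c, I = Ideal.span {c} := by
  have step : ∀ (J : Ideal (𝓞 F)) (x : 𝓞 F), x ≠ 0 → J ^ 3 = Ideal.span {x} →
      (J * C.act J ^ 2) ^ 3 = Ideal.span {x * C.g x ^ 2} := fun J x _ hJ ↦ by
    rw [mul_pow, hJ, pow_right_comm, ← C.act_pow, hJ, C.act_span, Ideal.span_singleton_pow,
      Ideal.span_singleton_mul_span_singleton]
  have nz : ∀ x : 𝓞 F, x ≠ 0 → x * C.g x ^ 2 ≠ 0 := fun x hx ↦
    mul_ne_zero hx (pow_ne_zero 2 (by simpa using hx))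
  have h1 := step I a ha hI
  have h2 := step _ _ (nz a ha) h1
  obtain ⟨d, hd⟩ : ∃ d, (I * C.act I ^ 2 * C.act (I * C.act I ^ 2) ^ 2) *
      C.act (I * C.act I ^ 2 * C.act (I * C.act I ^ 2) ^ 2) ^ 2 = Ideal.span {d} := by
    refine ⟨a ^ 3 * C.g a ^ 2 * C.g (C.g a) ^ 4, ?_⟩
    simp only [← Ideal.span_singleton_mul_span_singleton, ← Ideal.span_singleton_pow, ← C.act_span, ← hI]
    simp only [C.act_mul, C.act_pow, C.act_act_act]
    ring
  obtain ⟨d₂, hd₂⟩ := C.isPrincipal_of_mul_act_sq hp (nz _ (nz a ha)) h2 hd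
  obtain ⟨d₁, hd₁⟩ := C.isPrincipal_of_mul_act_sq hp (nz a ha) h1 hd₂
  exact C.isPrincipal_of_mul_act_sq hp ha hI hd₁

lemma exists_pow_isPrincipal (C : CyclicCubic F p) (hp : p ≠ 0) {I : Ideal (𝓞 F)} (hI : I ≠ ⊥) :
    ∃ (m : ℕ) (c : 𝓞 F), ¬ 3 ∣ m ∧ I ^ m = Ideal.span {c} := by
  obtain ⟨n, m, hm, hc⟩ := Nat.exists_eq_pow_mul_and_not_dvd (classNumber_ne_zero F) 3 (by norm_num)
  have key : ∀ n : ℕ, (∃ c, I ^ (3 ^ n * m) = Ideal.span {c}) → ∃ c, I ^ m = Ideal.span {c} := by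
    intro n
    induction n with
    | zero => simp
    | succ n ih =>
      rintro ⟨c, hc⟩
      refine ih (C.isPrincipal_of_pow_three hp (a := c) ?_ ?_)
      · rintro rfl
        rw [Ideal.span_singleton_eq_bot.2 rfl] at hc
        exact hI (eq_bot_iff.2 (by simpa using (pow_eq_zero_iff' .. |>.1 hc).1.le))
      · rw [← pow_mul, ← hc]; ring_nf
  have h : ∃ c, I ^ (3 ^ n * m) = Ideal.span {c} := by
    have h0 : I ∈ (Ideal (𝓞 F))⁰ := mem_nonZeroDivisors_of_ne_zero hI
    have h1 : ClassGroup.mk0 (⟨I, h0⟩ ^ classNumber F) = 1 := by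
      rw [map_pow, classNumber]
      exact pow_card_eq_one
    rw [← hc]
    generalize classNumber F = N at h1
    have h2 : (⟨I, h0⟩ ^ N : (Ideal (𝓞 F))⁰) = ⟨I ^ N, pow_mem h0 N⟩ := Subtype.ext (SubmonoidClass.coe_pow _ _)
    rw [h2, ClassGroup.mk0_eq_one_iff] at h1
    exact ⟨_, (Ideal.span_singleton_generator (I ^ N)).symm⟩
  obtain ⟨c, h⟩ := key n h
  exact ⟨m, c, hm, h⟩

lemma exists_norm_eq (C : CyclicCubic F p) (hp : p ≠ 0) {I : Ideal (𝓞 F)} {ℓ f₀ : ℕ} (hℓ : ℓ ≠ 0) (hI : Ideal.absNorm I = ℓ ^ f₀)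
    (hf₀ : ¬ 3 ∣ f₀) (f : ℕ) : ∃ (κ : 𝓞 F) (j : ℕ), κ * C.g κ * C.g (C.g κ) = ((ℓ ^ (f + 3 * j) : ℤ) : 𝓞 F) := by
  have hI0 : I ≠ ⊥ := by
    rintro rfl
    rw [Ideal.absNorm_bot] at hI
    exact (pow_ne_zero _ hℓ) hI.symm
  obtain ⟨m, c, hm, hc⟩ := C.exists_pow_isPrincipal hp hI0
  have h1 : (Algebra.norm ℤ c).natAbs = ℓ ^ (f₀ * m) := by
    rw [← Ideal.absNorm_span_singleton, ← hc, map_pow, hI, pow_mul]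
  obtain ⟨κ, hκ⟩ : ∃ κ, Algebra.norm ℤ κ = (ℓ : ℤ) ^ (f₀ * m) := by
    rcases Int.natAbs_eq (Algebra.norm ℤ c) with h | h
    · exact ⟨c, by rw [h, h1]; push_cast; rfl⟩
    · exact ⟨-c, by rw [C.norm_neg, h, neg_neg, h1]; push_cast; rfl⟩
  have h3 : ¬ 3 ∣ f₀ * m := by
    rw [Nat.prime_three.dvd_mul]; tauto
  obtain ⟨j, hj⟩ : ∃ j, (f₀ * m) * (f₀ * m) = 1 + 3 * j := by
    have : (f₀ * m) * (f₀ * m) % 3 = 1 := by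
      have : (f₀ * m) % 3 = 1 ∨ (f₀ * m) % 3 = 2 := by omega
      rcases this with h | h <;> simp [Nat.mul_mod, h]
    exact ⟨(f₀ * m) * (f₀ * m) / 3, by omega⟩
  refine ⟨κ ^ (f * (f₀ * m)), f * j, ?_⟩
  rw [← C.norm_eq, map_pow, hκ, ← pow_mul]
  congr 2
  linear_combination f * hj

end CyclicCubic

section GaloisCubic
variable {F : Type*} [Field F] [NumberField F] [IsGalois ℚ F]

lemma exists_generator_of_finrank_three (h : Module.finrank ℚ F = 3) :
    ∃ σ : F ≃ₐ[ℚ] F, (∀ x, x ∈ Subgroup.zpowers σ) ∧ orderOf σ = 3 := by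
  have hc : Nat.card (F ≃ₐ[ℚ] F) = 3 := by rw [IsGalois.card_aut_eq_finrank, h]
  have : Fact (Nat.Prime 3) := ⟨Nat.prime_three⟩
  have := isCyclic_of_prime_card hc
  obtain ⟨σ, hσ⟩ := IsCyclic.exists_generator (α := F ≃ₐ[ℚ] F)
  exact ⟨σ, hσ, by rw [orderOf_eq_card_of_forall_mem_zpowers hσ, hc]⟩

lemma algebraMap_norm_eq_of_generator {A B : Type*} [Field A] [Field B] [Algebra A B] [FiniteDimensional A B]
    [IsGalois A B] {σ : B ≃ₐ[A] B} (hσ : ∀ x, x ∈ Subgroup.zpowers σ) (h3 : orderOf σ = 3) (x : B) :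
    algebraMap A B (Algebra.norm A x) = x * σ x * σ (σ x) := by
  classical
  have h1 := Algebra.norm_eq_prod_automorphisms A x
  have h2 : (Finset.univ : Finset (B ≃ₐ[A] B)) = (Finset.range (orderOf σ)).image (σ ^ ·) :=
    (image_range_orderOf.trans (by ext y; simp [hσ y])).symm
  rw [h2, Finset.prod_image (fun i hi j hj hij ↦ pow_injOn_Iio_orderOf (by simpa using hi) (by simpa using hj) hij),
    h3, Finset.prod_range_succ, Finset.prod_range_succ, Finset.prod_range_one] at h1
  simpa [pow_two] using h1

lemma mem_rat_of_generator {σ : F ≃ₐ[ℚ] F} (hσ : ∀ x, x ∈ Subgroup.zpowers σ) {x : F} (hx : σ x = x) : ∃ q : ℚ, x = q := by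
  have : x ∈ (⊥ : IntermediateField ℚ F) := by
    rw [IsGalois.mem_bot_iff_fixed]
    intro f
    have h1 : σ ∈ MulAction.stabilizer (F ≃ₐ[ℚ] F) x := hx
    have h2 := (Subgroup.zpowers_le.2 h1) (hσ f)
    exact h2
  obtain ⟨q, hq⟩ := IntermediateField.mem_bot.1 this
  exact ⟨q, by simpa using hq.symm⟩

end GaloisCubic

section Cyclotomic
variable {C : Type*} [Field C] [NumberField C] {p : ℕ}

lemma IsPrimitiveRoot.sub_one_dvd_map {ζ : 𝓞 C} (hp : p.Prime) (hζ : IsPrimitiveRoot ζ p) (σ : C ≃ₐ[ℚ] C) :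
    ζ - 1 ∣ RingOfIntegers.mapRingEquiv σ.toRingEquiv ζ - 1 := by
  have h1 : (RingOfIntegers.mapRingEquiv σ.toRingEquiv ζ) ^ p = 1 := by rw [← map_pow, hζ.pow_eq_one, map_one]
  have : NeZero p := ⟨hp.ne_zero⟩
  obtain ⟨i, -, hi⟩ := hζ.eq_pow_of_pow_eq_one h1
  rw [← hi]
  simpa using sub_dvd_pow_sub_pow ζ 1 i

lemma IsPrimitiveRoot.associated_map_sub_one {ζ : 𝓞 C} (hp : p.Prime) (hζ : IsPrimitiveRoot ζ p) (σ : C ≃ₐ[ℚ] C) :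
    Associated (RingOfIntegers.mapRingEquiv σ.toRingEquiv (ζ - 1)) (ζ - 1) := by
  refine associated_of_dvd_dvd ?_ (by simpa using hζ.sub_one_dvd_map hp σ)
  have h1 := map_dvd (RingOfIntegers.mapRingEquiv σ.toRingEquiv) (hζ.sub_one_dvd_map hp σ.symm)
  convert h1 using 1
  rw [map_sub, map_one]
  congr 1
  ext
  simp

end Cyclotomic

section Subfield
variable {C F : Type*} [Field C] [NumberField C] [Field F] [NumberField F] [Algebra F C]
    {p : ℕ} [Fact p.Prime]

lemma associated_norm_sub_one [IsGalois F C] {ζ : 𝓞 C} (hζ : IsPrimitiveRoot ζ p) :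
    Associated (algebraMap (𝓞 F) (𝓞 C) (RingOfIntegers.norm F (ζ - 1))) ((ζ - 1) ^ Fintype.card (C ≃ₐ[F] C)) := by
  have h1 : algebraMap (𝓞 F) (𝓞 C) (RingOfIntegers.norm F (ζ - 1)) =
      ∏ τ : C ≃ₐ[F] C, RingOfIntegers.mapRingEquiv τ.toRingEquiv (ζ - 1) := by
    apply RingOfIntegers.coe_injective
    refine (RingOfIntegers.coe_algebraMap_norm F (ζ - 1)).trans ?_
    rw [Algebra.norm_eq_prod_automorphisms, map_prod]
    rfl
  rw [h1, ← Finset.card_univ, ← Finset.prod_const]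
  exact Associated.prod _ _ _ fun τ _ ↦ hζ.associated_map_sub_one Fact.out (τ.restrictScalars ℚ)

lemma norm_sub_one_dvd_map [IsCyclotomicExtension {p} ℚ C] [IsGalois ℚ F] [IsGalois F C] [IsGalois ℚ C] {ζ : 𝓞 C} (hζ : IsPrimitiveRoot ζ p) (σ : F ≃ₐ[ℚ] F) :
    RingOfIntegers.norm F (ζ - 1) ∣ RingOfIntegers.mapRingEquiv σ.toRingEquiv (RingOfIntegers.norm F (ζ - 1)) := by
  set π := RingOfIntegers.norm F (ζ - 1) with hπ
  obtain ⟨s, hs⟩ := AlgEquiv.restrictNormalHom_surjective (F := ℚ) (K₁ := F) (E := C) σ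
  have h1 : algebraMap (𝓞 F) (𝓞 C) (RingOfIntegers.mapRingEquiv σ.toRingEquiv π) =
      RingOfIntegers.mapRingEquiv s.toRingEquiv (algebraMap (𝓞 F) (𝓞 C) π) := by
    apply RingOfIntegers.coe_injective
    rw [← hs]
    exact AlgEquiv.restrictNormal_commutes s F (π : F)
  have h2 := associated_norm_sub_one (F := F) (C := C) hζ
  have h3 : algebraMap (𝓞 F) (𝓞 C) π ∣ algebraMap (𝓞 F) (𝓞 C) (RingOfIntegers.mapRingEquiv σ.toRingEquiv π) := by
    rw [h1]
    have h4 := h2.map (RingOfIntegers.mapRingEquiv s.toRingEquiv)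
    rw [map_pow] at h4
    exact (h2.trans (((hζ.associated_map_sub_one Fact.out s).pow_pow).symm.trans h4.symm)).dvd
  by_cases h0 : π = 0
  · simp [h0]
  obtain ⟨y, hy⟩ := h3
  have h5 : (algebraMap F C) ((σ (π : F)) / (π : F)) = y := by
    have h6 := congrArg (fun x : 𝓞 C ↦ (x : C)) hy
    have h7 : algebraMap F C (σ π) = algebraMap F C π * y := h6
    have h8 : algebraMap F C (π : F) ≠ 0 := by simpa using h0
    rw [map_div₀, h7, mul_div_cancel_left₀ _ h8]
  have h9 : IsIntegral ℤ ((σ (π : F)) / (π : F)) := by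
    rw [← isIntegral_algebraMap_iff (algebraMap F C).injective, h5]
    exact y.isIntegral_coe
  refine ⟨⟨_, h9⟩, RingOfIntegers.coe_injective ?_⟩
  have h8 : (π : F) ≠ 0 := by simpa using h0
  change σ (π : F) = (π : F) * (σ (π : F) / (π : F))
  rw [mul_div_cancel₀ _ h8]

end Subfield

section Construction
variable (C : Type*) {F : Type*} [Field C] [NumberField C] [Field F] [NumberField F] [Algebra F C]
  {p : ℕ} [Fact p.Prime] [IsCyclotomicExtension {p} ℚ C]

lemma exists_eq_prime_pow_mul_cube (C : Type*) [Field C] [NumberField C] [Algebra F C]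
    [IsCyclotomicExtension {p} ℚ C] {n : ℕ} {J : Ideal (𝓞 F)} (hn : n ≠ 0) (h : Ideal.span {(n : 𝓞 F)} = J ^ 3) :
    ∃ i m : ℕ, n = p ^ i * m ^ 3 := by
  have hp : p.Prime := Fact.out
  have h1 := isVirtualCube_of_ideal (by exact_mod_cast hn) h
  have h2 : IsVirtualCube (n : C) := by simpa using h1.map_algebraMap (R := C)
  have hζ := IsCyclotomicExtension.zeta_spec p ℚ C
  obtain ⟨a, b, c, s, hs⟩ := exists_nat_cube_decomposition ![p, p, p] hn fun u hu hne ↦ by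
    have hup : u ≠ p := hne 0
    obtain ⟨w, hw⟩ := exists_place_over (E := C) hu
    have h3 := ord_prime_eq_neg_one (α := hζ.toInteger) (n := p) (c := 1)
      (IsCyclotomicExtension.adjoin_primitive_root_eq_top hζ) hp.ne_zero
      (by rw [hζ.toInteger_isPrimitiveRoot.pow_eq_one, Int.cast_one]) hu
      (by rw [mul_one]; exact_mod_cast fun h ↦ hup ((Nat.prime_dvd_prime_iff_eq hu hp).1 h)) w hw
    have h4 := h2.2 w
    rw [ord_natCast_of_mem hu hw hn, h3] at h4
    have : (3 : ℤ) ∣ n.factorization u := by simpa using h4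
    exact_mod_cast this
  exact ⟨a + b + c, s, by
    rw [hs]
    change p ^ a * p ^ b * p ^ c * s ^ 3 = _
    ring⟩

theorem CyclicCubic.nonempty {F : Type} [Field F] [NumberField F] (C : Type*) [Field C] [NumberField C] [Algebra F C]
    [IsCyclotomicExtension {p} ℚ C] [IsGalois ℚ F] (h3 : Module.finrank ℚ F = 3) (hp2 : p ≠ 2) : Nonempty (CyclicCubic F p) := by
  have hp : p.Prime := Fact.out
  obtain ⟨σ, hσ, hσ3⟩ := exists_generator_of_finrank_three h3
  have : IsCyclic (F ≃ₐ[ℚ] F) := ⟨σ, hσ⟩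
  have : IsGalois ℚ C := IsCyclotomicExtension.isGalois {p} ℚ C
  have : IsGalois F C := IsGalois.tower_top_of_isGalois ℚ F C
  have hζ := IsCyclotomicExtension.zeta_spec p ℚ C
  have hζ' := hζ.toInteger_isPrimitiveRoot
  set π : 𝓞 F := RingOfIntegers.norm F (hζ.toInteger - 1) with hπ
  have hnorm : ∀ x : 𝓞 F, ((Algebra.norm ℤ x : ℤ) : 𝓞 F) = x * RingOfIntegers.mapRingEquiv σ.toRingEquiv x *
      RingOfIntegers.mapRingEquiv σ.toRingEquiv (RingOfIntegers.mapRingEquiv σ.toRingEquiv x) := fun x ↦ by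
    apply RingOfIntegers.coe_injective
    have h1 := algebraMap_norm_eq_of_generator hσ hσ3 (x : F)
    rw [eq_ratCast, ← Algebra.coe_norm_int] at h1
    simpa using h1
  have hσσ : ∀ x, σ (σ (σ x)) = x := fun x ↦ by
    have := congrArg (fun f : F ≃ₐ[ℚ] F ↦ f x) (pow_orderOf_eq_one σ)
    rw [hσ3] at this
    exact this
  obtain ⟨u, hu⟩ := norm_sub_one_dvd_map (F := F) hζ' σ
  refine ⟨⟨RingOfIntegers.mapRingEquiv σ.toRingEquiv, fun x ↦ ?_, fun x hx ↦ ?_, hnorm, fun x y hy h ↦ ?_, π, u, ?_,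
    ?_, fun n J ↦ exists_eq_prime_pow_mul_cube C⟩⟩
  · exact RingOfIntegers.coe_injective (hσσ x)
  · obtain ⟨q, hq⟩ := mem_rat_of_generator hσ (congrArg (fun z : 𝓞 F ↦ (z : F)) hx)
    have h1 : IsIntegral ℤ q := by
      rw [← isIntegral_algebraMap_iff (algebraMap ℚ F).injective]
      simpa [← hq] using x.isIntegral_coe
    obtain ⟨n, hn⟩ := IsIntegrallyClosed.isIntegral_iff.1 h1
    refine ⟨n, RingOfIntegers.coe_injective ?_⟩
    refine hq.trans ?_
    rw [← hn]
    simp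
  · have hy' : (y : F) ≠ 0 := by simpa using hy
    have hxy : Algebra.norm ℚ ((x : F) / y) = 1 := by
      have h1 : Algebra.norm ℚ ((x : F) / y) * Algebra.norm ℚ (y : F) = Algebra.norm ℚ (y : F) := by
        rw [← map_mul, div_mul_cancel₀ _ hy', ← Algebra.coe_norm_int, ← Algebra.coe_norm_int, h]
      exact mul_right_cancel₀ (by simpa using hy') (h1.trans (one_mul _).symm)
    obtain ⟨z, hz⟩ := groupCohomology.exists_div_of_norm_eq_one hσ hxy
    have hz0 : (z : F) ≠ 0 := z.ne_zero
    have hσz : σ (z : F) ≠ 0 := by simp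
    obtain ⟨m, b, hm, hb⟩ := exists_int_mul_eq (z : F)
    refine ⟨b, ?_, RingOfIntegers.coe_injective ?_⟩
    · rintro rfl
      have : (m : F) * z ≠ 0 := mul_ne_zero (by exact_mod_cast hm) hz0
      exact this (by rw [← hb]; simp)
    · change (x : F) * σ (b : F) = (y : F) * (b : F)
      rw [hb, map_mul, map_intCast]
      rw [div_eq_div_iff hσz hy'] at hz
      linear_combination -m * hz
  · rw [← hnorm]
    have h1 : Algebra.norm ℚ (π : F) = p := by
      rw [hπ, RingOfIntegers.coe_norm, Algebra.norm_norm]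
      exact hζ.norm_sub_one_of_prime_ne_two' (Polynomial.cyclotomic.irreducible_rat hp.pos) hp2
    rw [← Algebra.coe_norm_int] at h1
    have h2 : Algebra.norm ℤ π = p := by exact_mod_cast h1
    rw [h2, Int.cast_natCast]
  · rw [hu, mul_comm]

end Construction

lemma IsCyclotomicExtension.nonempty_algHom {K C R : Type*} [Field K] [Field C] [Field R] [Algebra K C] [Algebra K R]
    {n : ℕ} [NeZero n] [IsCyclotomicExtension {n} K C] {ζ : R} (hζ : IsPrimitiveRoot ζ n) : Nonempty (C →ₐ[K] R) := by
  have := IsCyclotomicExtension.isSplittingField_X_pow_sub_one n K C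
  refine ⟨Polynomial.IsSplittingField.lift C (Polynomial.X ^ n - 1) ?_⟩
  simpa using Polynomial.X_pow_sub_one_splits hζ

section
variable {C : Type} [Field C] [NumberField C] {p : ℕ} [Fact p.Prime] [IsCyclotomicExtension {p} ℚ C]

lemma exists_cubic_subfield (hp3 : p % 3 = 1) : ∃ F : IntermediateField ℚ C, Module.finrank ℚ F = 3 ∧ IsGalois ℚ F := by
  have hp : p.Prime := Fact.out
  have : IsGalois ℚ C := IsCyclotomicExtension.isGalois {p} ℚ C
  have hab : IsAbelianGalois ℚ C := IsCyclotomicExtension.isAbelianGalois {p} ℚ C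
  let e := IsCyclotomicExtension.autEquivPow C (Polynomial.cyclotomic.irreducible_rat hp.pos)
  have : IsCyclic (C ≃ₐ[ℚ] C) := isCyclic_of_surjective e.symm e.symm.surjective
  obtain ⟨x, hx⟩ := IsCyclic.exists_ofOrder_eq_natCard (α := C ≃ₐ[ℚ] C)
  have hc : Nat.card (C ≃ₐ[ℚ] C) = p - 1 := by
    rw [Nat.card_congr e.toEquiv, Nat.card_eq_fintype_card, ZMod.card_units_eq_totient, Nat.totient_prime hp]
  rw [hc] at hx
  have h3 : orderOf (x ^ 3) = (p - 1) / 3 := by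
    rw [orderOf_pow_of_dvd three_ne_zero (by rw [hx]; omega), hx]
  refine ⟨IntermediateField.fixedField (Subgroup.zpowers (x ^ 3)), ?_,
    (IsAbelianGalois.of_algHom (M := C) (algebraMap _ C).toRatAlgHom).toIsGalois⟩
  have h1 := IntermediateField.finrank_fixedField_eq_card (Subgroup.zpowers (x ^ 3))
  rw [Nat.card_zpowers, h3] at h1
  have h2 := Module.finrank_mul_finrank ℚ (IntermediateField.fixedField (Subgroup.zpowers (x ^ 3))) C
  rw [h1, ← IsGalois.card_aut_eq_finrank ℚ C, hc] at h2
  have := hp.two_le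
  obtain ⟨m, hm⟩ : ∃ m, p - 1 = 3 * m := ⟨(p - 1) / 3, by omega⟩
  rw [hm, Nat.mul_div_cancel_left _ three_pos] at h2
  exact Nat.eq_of_mul_eq_mul_right (by omega) h2

lemma exists_absNorm_eq (hp9 : p % 9 = 4 ∨ p % 9 = 7) (F : IntermediateField ℚ C) {ℓ : ℕ} (hℓ : ℓ.Prime) (hpℓ : p ≠ ℓ)
    (hcube : (p : ℤ) ∣ (ℓ : ℤ) ^ ((p - 1) / 3) - 1) :
    ∃ (I : Ideal (𝓞 F)) (f : ℕ), ¬ 3 ∣ f ∧ Ideal.absNorm I = ℓ ^ f := by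
  have hp : p.Prime := Fact.out
  have : Fact ℓ.Prime := ⟨hℓ⟩
  obtain ⟨w, hw⟩ := exists_place_over (E := C) hℓ
  have hlies : w.asIdeal.LiesOver (Ideal.span {(ℓ : ℤ)}) := by
    refine ⟨?_⟩
    have hmax : (Ideal.span {(ℓ : ℤ)}).IsMaximal :=
      PrincipalIdealRing.isMaximal_of_irreducible (Nat.prime_iff_prime_int.1 hℓ).irreducible
    refine hmax.eq_of_le (Ideal.IsPrime.ne_top inferInstance) ?_
    rw [Ideal.span_singleton_le_iff_mem, Ideal.mem_comap]
    simpa using hw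
  refine ⟨Ideal.relNorm (𝓞 F) w.asIdeal, orderOf (ℓ : ZMod p), fun h ↦ ?_, ?_⟩
  · have h1 : orderOf (ℓ : ZMod p) ∣ (p - 1) / 3 := by
      apply orderOf_dvd_of_pow_eq_one
      have := (ZMod.intCast_zmod_eq_zero_iff_dvd _ p).2 hcube
      push_cast at this
      exact sub_eq_zero.1 this
    have := h.trans h1
    omega
  · have h1 := IsCyclotomicExtension.Rat.inertiaDeg_eq_of_not_dvd (p := ℓ) (K := C) w.asIdeal (m := p)
      (fun h ↦ hpℓ ((Nat.prime_dvd_prime_iff_eq hℓ hp).1 h).symm)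
    rw [Ideal.absNorm_relNorm, ← Ideal.pow_inertiaDeg ℓ w.asIdeal, h1]

end

theorem exists_periods {p : ℕ} [Fact p.Prime] (hp9 : p % 9 = 4 ∨ p % 9 = 7) {ℓ f : ℕ} (hℓ : ℓ.Prime) (hpℓ : p ≠ ℓ)
    (hcube : f = 0 ∨ (p : ℤ) ∣ (ℓ : ℤ) ^ ((p - 1) / 3) - 1) {R : Type*} [Field R] [NumberField R] {ζ : R}
    (hζ : IsPrimitiveRoot ζ p) : ∃ (f' j : ℕ) (w₀ w₁ w₂ : 𝓞 R) (s₁ s₂ S : ℤ), f' = f + 3 * j ∧ (f = 0 → f' = 0) ∧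
      w₀ * w₁ * w₂ = p * ℓ ^ f' ∧ w₀ + w₁ + w₂ = p * s₁ ∧ w₀ * w₁ + w₁ * w₂ + w₂ * w₀ = p * s₂ ∧
      w₂ ^ 2 * w₁ + w₀ ^ 2 * w₂ + w₁ ^ 2 * w₀ = p * S ∧ ¬ (p : ℤ) ∣ S + 6 * ℓ ^ f' ∧ ¬ (p : ℤ) ∣ S - 3 * ℓ ^ f' ∧
      ¬ (p : ℤ) ∣ |S - 3 * ℓ ^ f'| ^ ((p - 1) / 3) - 1 := by
  have hp : p.Prime := Fact.out
  have : NeZero p := ⟨hp.ne_zero⟩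
  have : IsCyclotomicExtension {p} ℚ (CyclotomicField p ℚ) := by
    convert CyclotomicField.isCyclotomicExtension p ℚ
    · rfl
    · exact Subsingleton.elim _ _
  obtain ⟨F, hF3, hF⟩ := exists_cubic_subfield (C := CyclotomicField p ℚ) (p := p) (by omega)
  obtain ⟨C⟩ := CyclicCubic.nonempty (F := F) (CyclotomicField p ℚ) hF3 (p := p) (by rintro rfl; omega)
  obtain ⟨ι⟩ := IsCyclotomicExtension.nonempty_algHom (K := ℚ) (C := CyclotomicField p ℚ) hζ
  let φ : 𝓞 F →+* 𝓞 R := RingOfIntegers.mapRingHom (ι.toRingHom.comp (algebraMap F (CyclotomicField p ℚ)))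
  obtain ⟨f', j, κ, hf', hf0, hκ⟩ : ∃ (f' j : ℕ) (κ : 𝓞 F), f' = f + 3 * j ∧ (f = 0 → f' = 0) ∧
      κ * C.g κ * C.g (C.g κ) = ((ℓ ^ f' : ℤ) : 𝓞 F) := by
    by_cases hf : f = 0
    · exact ⟨0, 0, 1, by simp [hf], fun _ ↦ rfl, by simp⟩
    · obtain ⟨I, f₀, hf₀, hI⟩ := exists_absNorm_eq hp9 F hℓ hpℓ (hcube.resolve_left hf)
      obtain ⟨κ, j, hκ⟩ := C.exists_norm_eq hp.ne_zero hℓ.ne_zero hI hf₀ f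
      exact ⟨_, j, κ, rfl, fun h ↦ absurd h hf, hκ⟩
  have hD : ¬ (p : ℤ) ∣ (ℓ : ℤ) ^ f' := by
    intro h
    have h1 : p ∣ ℓ ^ f' := by exact_mod_cast h
    exact hpℓ ((Nat.prime_dvd_prime_iff_eq hp hℓ).1 (hp.dvd_of_dvd_pow h1))
  obtain ⟨w₀, w₁, w₂, s₁, s₂, S, h3, h1, h2, hS, hs⟩ := C.exists_periods hp9 hD hκ
  refine ⟨f', j, φ w₀, φ w₁, φ w₂, s₁, s₂, S, hf', hf0, ?_, ?_, ?_, ?_, hs⟩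
  · simpa using congrArg φ h3
  · simpa using congrArg φ h1
  · simpa using congrArg φ h2
  · simpa using congrArg φ hS

namespace CubicTower
variable {L K k : Type*} [Field L] [NumberField L] [Field K] [NumberField K]
    [Field k] [NumberField k] [Algebra L k] [Algebra K k]

theorem primaryComponent_three_of_isRadicand [IsCyclotomicExtension {3} ℚ K] [Fact (Nat.Prime 3)] (T : CubicTower L K k)
    {p ℓ f : ℕ} (hr : IsRadicand T.D p ℓ f) (hf : f = 0 ∨ ¬ 3 ∣ f) :
    Nat.card (CommGroup.primaryComponent (ClassGroup (𝓞 L)) 3) = 3 ∧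
      IsCyclic (CommGroup.primaryComponent (ClassGroup (𝓞 L)) 3) := by
  by_cases hcube : f = 0 ∨ (p : ℤ) ∣ (ℓ : ℤ) ^ ((p - 1) / 3) - 1
  · have : Fact p.Prime := ⟨hr.hp⟩
    have : NeZero p := ⟨hr.hp.ne_zero⟩
    have hζ := IsCyclotomicExtension.zeta_spec p L (CyclotomicField p L)
    obtain ⟨f', j, w₀, w₁, w₂, s₁, s₂, S, hf', hf0, h3, h1, h2, hS, hp6, hp3, hpc⟩ :=
      exists_periods hr.hp9 hr.hℓ hr.ne hcube hζ
    have hθ : T.θInt ^ 3 = p * ℓ ^ f := by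
      ext
      have := T.θ_pow
      rw [hr.hD] at this
      simpa using this
    obtain ⟨I, a, ha, hI, hn⟩ := T.exists_ideal_of_periods hr.hp hr.hℓ hr.ne (r := ℓ ^ j) (t := (ℓ ^ j : ℕ) * T.θInt) rfl
      (f := f') (by rw [mul_pow, hθ, hf']; push_cast; ring) (by omega) (α := hζ.toInteger)
      (IsCyclotomicExtension.adjoin_primitive_root_eq_top hζ) hζ.toInteger_isPrimitiveRoot.pow_eq_one h3 h1 h2 hS hp6 hp3
    refine T.primaryComponent_three hr ha hI ?_ (by rw [hn]; exact hpc)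
    rw [← Int.natCast_dvd_natCast, hn, dvd_abs]
    exact hp3
  · push Not at hcube
    obtain ⟨I, hI, hn⟩ := T.exists_ideal_of_noncube hr (hf.resolve_left hcube.1)
    refine T.primaryComponent_three hr (by exact_mod_cast hr.hℓ.ne_zero) hI ?_ (by rw [hn]; exact hcube.2)
    rw [hn]
    exact fun h ↦ hr.ne ((Nat.prime_dvd_prime_iff_eq hr.hp hr.hℓ).1 h)

end CubicTower

section PureCubic

lemma exists_coord_of_mem_adjoin {A B : Type*} [CommRing A] [CommRing B] [Algebra A B] {θ : B} {d : A}
    (hθ : θ ^ 3 = algebraMap A B d) {x : B} (hx : x ∈ Algebra.adjoin A {θ}) :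
    ∃ a b c : A, x = algebraMap A B a + algebraMap A B b * θ + algebraMap A B c * θ ^ 2 := by
  induction hx using Algebra.adjoin_induction with
  | mem x hx => exact ⟨0, 1, 0, by simpa using hx⟩
  | algebraMap r => exact ⟨r, 0, 0, by simp⟩
  | add x y _ _ hx hy =>
    obtain ⟨a, b, c, rfl⟩ := hx
    obtain ⟨a', b', c', rfl⟩ := hy
    exact ⟨a + a', b + b', c + c', by simp only [map_add]; ring⟩
  | mul x y _ _ hx hy =>
    obtain ⟨a, b, c, rfl⟩ := hx
    obtain ⟨a', b', c', rfl⟩ := hy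
    refine ⟨a * a' + d * (b * c' + c * b'), a * b' + b * a' + d * (c * c'), a * c' + b * b' + c * a', ?_⟩
    simp only [map_add, map_mul]
    linear_combination (algebraMap A B b * algebraMap A B c' + algebraMap A B c * algebraMap A B b' +
      algebraMap A B c * algebraMap A B c' * θ) * hθ

lemma norm_add_mul_add_mul_sq {A B : Type*} [Field A] [CommRing B] [Algebra A B] (h3 : Module.finrank A B = 3)
    {θ : B} {d : A} (hθ : θ ^ 3 = algebraMap A B d) (hgen : Algebra.adjoin A {θ} = ⊤) (a b c : A) :
    Algebra.norm A (algebraMap A B a + algebraMap A B b * θ + algebraMap A B c * θ ^ 2) = cubicForm d a b c := by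
  let e := basisOfTopLeSpanOfCardEqFinrank ![1, θ, θ ^ 2] (fun x _ ↦ by
    obtain ⟨a, b, c, rfl⟩ := exists_coord_of_mem_adjoin hθ (x := x) (hgen ▸ Algebra.mem_top)
    rw [Submodule.mem_span_range_iff_exists_fun]
    exact ⟨![a, b, c], by simp [Fin.sum_univ_three, Algebra.smul_def]⟩) (by simp [h3])
  have he : ⇑e = ![1, θ, θ ^ 2] := coe_basisOfTopLeSpanOfCardEqFinrank _ _ _
  let M : Matrix (Fin 3) (Fin 3) A := !![a, d * c, d * b; b, a, d * c; c, b, a]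
  have hM : Algebra.leftMulMatrix e (algebraMap A B a + algebraMap A B b * θ + algebraMap A B c * θ ^ 2) = M := by
    ext i j
    rw [Algebra.leftMulMatrix_eq_repr_mul]
    have key : (algebraMap A B a + algebraMap A B b * θ + algebraMap A B c * θ ^ 2) * e j = ∑ i, M i j • e i := by
      rw [he]
      fin_cases j
      · simp [M, Fin.sum_univ_three, Algebra.smul_def]
      · simp [M, Fin.sum_univ_three, Algebra.smul_def]
        linear_combination algebraMap A B c * hθ
      · simp [M, Fin.sum_univ_three, Algebra.smul_def]
        linear_combination (algebraMap A B b + algebraMap A B c * θ) * hθ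
    rw [key, e.repr_sum_self]
  rw [Algebra.norm_eq_matrix_det e, hM, Matrix.det_fin_three]
  simp [M, cubicForm]
  ring

lemma minpoly_eq_X_pow_three_sub_C {A B : Type*} [Field A] [Field B] [Algebra A B] {θ : B} {d : A}
    (hθ : θ ^ 3 = algebraMap A B d) (hd : ∀ x : A, x ^ 3 ≠ d) :
    minpoly A θ = Polynomial.X ^ 3 - Polynomial.C d :=
  (minpoly.eq_of_irreducible_of_monic (X_pow_sub_C_irreducible_of_prime Nat.prime_three hd)
    (by simp [hθ]) (Polynomial.monic_X_pow_sub_C d three_ne_zero)).symm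

lemma finrank_eq_three_of_pow_three {A B : Type*} [Field A] [Field B] [Algebra A B] [FiniteDimensional A B] {θ : B} {d : A}
    (hθ : θ ^ 3 = algebraMap A B d) (hd : ∀ x : A, x ^ 3 ≠ d) (hgen : Algebra.adjoin A {θ} = ⊤) :
    Module.finrank A B = 3 := by
  have hi : IsIntegral A θ := Algebra.IsIntegral.isIntegral θ
  have h1 : IntermediateField.adjoin A {θ} = ⊤ := by
    rw [← IntermediateField.toSubalgebra_injective.eq_iff,
      IntermediateField.adjoin_simple_toSubalgebra_of_isAlgebraic hi.isAlgebraic, hgen, IntermediateField.top_toSubalgebra]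
  rw [← IntermediateField.finrank_top', ← h1, IntermediateField.adjoin.finrank hi, minpoly_eq_X_pow_three_sub_C hθ hd,
    Polynomial.natDegree_X_pow_sub_C]

variable {L K k : Type} [Field L] [NumberField L] [Field K] [NumberField K]
    [Field k] [NumberField k] [Algebra L k] [Algebra K k]

lemma irreducible_cyclotomic_three_of_finrank (h3 : Module.finrank ℚ L = 3) :
    Irreducible (Polynomial.cyclotomic 3 L) := by
  have hdeg : (Polynomial.cyclotomic 3 L).natDegree = 2 := by
    rw [Polynomial.natDegree_cyclotomic]; rfl
  refine Polynomial.irreducible_of_degree_le_three_of_not_isRoot (Finset.mem_Icc.2 (by rw [hdeg]; norm_num)) fun x hx ↦ ?_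
  have hx' : IsPrimitiveRoot x 3 := (Polynomial.isRoot_cyclotomic_iff).1 hx
  have h1 := minpoly.degree_dvd (K := ℚ) (Algebra.IsIntegral.isIntegral x)
  rw [← Polynomial.cyclotomic_eq_minpoly_rat hx' three_pos, Polynomial.natDegree_cyclotomic, h3] at h1
  revert h1
  decide

lemma pow_three_ne_of_isCyclotomicExtension [IsCyclotomicExtension {3} ℚ K] {D : ℕ} (hD : ∀ q : ℚ, q ^ 3 ≠ D) (x : K) : x ^ 3 ≠ D := by
  intro hx
  have h1 := minpoly.degree_dvd (K := ℚ) (Algebra.IsIntegral.isIntegral x)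
  rw [minpoly_eq_X_pow_three_sub_C (by simpa using hx) hD, Polynomial.natDegree_X_pow_sub_C,
    IsCyclotomicExtension.finrank (n := 3) K (Polynomial.cyclotomic.irreducible_rat three_pos)] at h1
  revert h1
  decide

lemma IsPrimitiveRoot.exists_eq_add_mul [IsCyclotomicExtension {3} ℚ K] {ζ : K} (hζ : IsPrimitiveRoot ζ 3) (x : K) : ∃ a b : ℚ, x = a + b * ζ := by
  obtain ⟨a, b, c, h⟩ := exists_coord_of_mem_adjoin (A := ℚ) (θ := ζ) (d := 1) (by simp [hζ.pow_eq_one]) (x := x)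
    (by rw [IsCyclotomicExtension.adjoin_primitive_root_eq_top hζ]; trivial)
  have h1 := hζ.geom_sum_eq_zero (by norm_num)
  simp only [Finset.sum_range_succ, Finset.range_zero, Finset.sum_empty] at h1
  refine ⟨a - c, b - c, ?_⟩
  rw [h]
  simp only [eq_ratCast]
  push_cast
  linear_combination (c : K) * h1

lemma exists_algEquiv_pow_two {A B : Type*} [Field A] [Field B] [Algebra A B] [IsCyclotomicExtension {3} A B]
    (h : Irreducible (Polynomial.cyclotomic 3 A)) {ζ : B} (hζ : IsPrimitiveRoot ζ 3) :
    ∃ τ : B ≃ₐ[A] B, τ ζ = ζ ^ 2 := by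
  have hz := IsCyclotomicExtension.zeta_spec 3 A B
  obtain ⟨τ, hτ⟩ : ∃ τ : B ≃ₐ[A] B, τ (IsCyclotomicExtension.zeta 3 A B) = IsCyclotomicExtension.zeta 3 A B ^ 2 :=
    ⟨_, IsCyclotomicExtension.fromZetaAut_spec (hz.pow_of_coprime 2 (by norm_num)) h⟩
  obtain ⟨i, -, rfl⟩ := hz.eq_pow_of_pow_eq_one hζ.pow_eq_one
  exact ⟨τ, by rw [map_pow, hτ, pow_right_comm]⟩

lemma adjoin_eq_top_of_isCyclotomicExtension {L K k : Type*} [Field L] [CharZero L] [Field K] [CharZero K] [Field k]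
    [Algebra L k] [Algebra K k] [IsCyclotomicExtension {3} L k] {ζ : K} (hζ : IsPrimitiveRoot ζ 3) {θ : L}
    (hL : Algebra.adjoin ℚ {θ} = ⊤) : Algebra.adjoin K {algebraMap L k θ} = ⊤ := by
  have hz : IsPrimitiveRoot (algebraMap K k ζ) 3 := hζ.map_of_injective (algebraMap K k).injective
  have h1 : ∀ y : L, algebraMap L k y ∈ Algebra.adjoin K {algebraMap L k θ} := fun y ↦ by
    have hy : y ∈ Algebra.adjoin ℚ {θ} := hL ▸ Algebra.mem_top
    induction hy using Algebra.adjoin_induction with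
    | mem y hy =>
      rw [Set.mem_singleton_iff.1 hy]
      exact Algebra.self_mem_adjoin_singleton _ _
    | algebraMap r =>
      have : algebraMap L k (algebraMap ℚ L r) = algebraMap K k (r : K) := by simp
      rw [this]
      exact Subalgebra.algebraMap_mem _ _
    | add x y _ _ hx hy => rw [map_add]; exact add_mem hx hy
    | mul x y _ _ hx hy => rw [map_mul]; exact mul_mem hx hy
  refine Algebra.eq_top_iff.2 fun x ↦ ?_
  have hx : x ∈ Algebra.adjoin L {algebraMap K k ζ} := by
    rw [IsCyclotomicExtension.adjoin_primitive_root_eq_top hz]; trivial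
  induction hx using Algebra.adjoin_induction with
  | mem y hy =>
    rw [Set.mem_singleton_iff.1 hy]
    exact Subalgebra.algebraMap_mem _ _
  | algebraMap r => exact h1 r
  | add x y _ _ hx hy => exact add_mem hx hy
  | mul x y _ _ hx hy => exact mul_mem hx hy

lemma exists_kummer_generator {ζ : K} (hζ : IsPrimitiveRoot ζ 3) {t : k} {d : K} (ht : t ^ 3 = algebraMap K k d)
    (hd : ∀ x : K, x ^ 3 ≠ d) (hgen : Algebra.adjoin K {t} = ⊤) :
    ∃ σ : k ≃ₐ[K] k, σ t = algebraMap K k ζ * t ∧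
      ∀ x : k, x * σ x * σ (σ x) = 1 → ∃ y : k, y ≠ 0 ∧ x = y / σ y := by
  have hz : IsPrimitiveRoot (algebraMap K k ζ) 3 := hζ.map_of_injective (algebraMap K k).injective
  have hirr := X_pow_sub_C_irreducible_of_prime Nat.prime_three hd
  have hfin : FiniteDimensional K k := Module.Finite.of_restrictScalars_finite ℚ K k
  have hsplit : Polynomial.IsSplittingField K k (Polynomial.X ^ 3 - Polynomial.C d) := by
    refine ⟨?_, ?_⟩
    · simpa using X_pow_sub_C_splits_of_isPrimitiveRoot hz ht
    · rw [eq_top_iff, ← hgen]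
      refine Algebra.adjoin_mono (Set.singleton_subset_iff.2 ?_)
      rw [Polynomial.mem_rootSet]
      exact ⟨hirr.ne_zero, by simp [ht]⟩
  have hgal : IsGalois K k :=
    isGalois_of_isSplittingField_X_pow_sub_C ⟨ζ, (mem_primitiveRoots three_pos).2 hζ⟩ hirr k
  have hmin := minpoly_eq_X_pow_three_sub_C (θ := algebraMap K k ζ * t)
    (by rw [mul_pow, hz.pow_eq_one, one_mul, ht]) hd
  obtain ⟨σ, hσ⟩ := minpoly.exists_algEquiv_of_root (K := K) (x := t) (y := algebraMap K k ζ * t)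
    (Algebra.IsAlgebraic.isAlgebraic _) (by simp [hmin, ht])
  have h3 : Module.finrank K k = 3 := finrank_eq_three_of_pow_three ht hd hgen
  have hcard : Nat.card (k ≃ₐ[K] k) = 3 := by rw [IsGalois.card_aut_eq_finrank, h3]
  have ht0 : t ≠ 0 := by
    rintro rfl
    exact hd 0 ((algebraMap K k).injective (by simpa using ht))
  have hσ1 : σ ≠ 1 := by
    rintro rfl
    have h1 : t = algebraMap K k ζ * t := hσ
    exact hz.ne_one (by norm_num) (mul_right_cancel₀ ht0 (by rw [one_mul, ← h1]))
  have : Fact (Nat.Prime 3) := ⟨Nat.prime_three⟩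
  have hgenσ : ∀ x, x ∈ Subgroup.zpowers σ := fun x ↦ mem_zpowers_of_prime_card hcard hσ1
  have hcyc : IsCyclic (k ≃ₐ[K] k) := ⟨σ, hgenσ⟩
  have hord : orderOf σ = 3 := by rw [orderOf_eq_card_of_forall_mem_zpowers hgenσ, hcard]
  refine ⟨σ, hσ, fun x hx ↦ ?_⟩
  obtain ⟨y, hy⟩ := groupCohomology.exists_div_of_norm_eq_one hgenσ (x := x) (by
    apply (algebraMap K k).injective
    rw [algebraMap_norm_eq_of_generator hgenσ hord, hx, map_one])
  exact ⟨y, y.ne_zero, hy.symm⟩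

theorem exists_cubicTower [IsCyclotomicExtension {3} ℚ K] [IsCyclotomicExtension {3} L k] {D : ℕ} {θ : L} (hθ : θ ^ 3 = D) (hD : ∀ q : ℚ, q ^ 3 ≠ D) (hgen : Algebra.adjoin ℚ {θ} = ⊤) :
    ∃ T : CubicTower L K k, T.D = D := by
  have hθ' : θ ^ 3 = algebraMap ℚ L D := by simpa using hθ
  have h3 := finrank_eq_three_of_pow_three hθ' hD hgen
  have hζ := IsCyclotomicExtension.zeta_spec 3 ℚ K
  have hz : IsPrimitiveRoot (algebraMap K k (IsCyclotomicExtension.zeta 3 ℚ K)) 3 :=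
    hζ.map_of_injective (algebraMap K k).injective
  have ht : algebraMap L k θ ^ 3 = algebraMap K k D := by rw [← map_pow, hθ]; simp
  have hgen' := adjoin_eq_top_of_isCyclotomicExtension (k := k) hζ hgen
  obtain ⟨σ, hσ, hilb⟩ := exists_kummer_generator hζ ht (pow_three_ne_of_isCyclotomicExtension hD) hgen'
  obtain ⟨τ, hτ⟩ := exists_algEquiv_pow_two (irreducible_cyclotomic_three_of_finrank h3) hz
  obtain ⟨c, hc⟩ := exists_algEquiv_pow_two (Polynomial.cyclotomic.irreducible_rat three_pos) hζ
  refine ⟨⟨D, ?_, θ, hθ, _, hζ, fun x ↦ ?_, fun x ↦ hζ.exists_eq_add_mul x, fun x ↦ ?_, fun a b c ↦ ?_, σ, hσ, τ, hτ,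
    c.toRingEquiv, hc, hilb⟩, rfl⟩
  · rintro rfl
    exact hD 0 (by simp)
  · simpa using exists_coord_of_mem_adjoin hθ' (x := x) (hgen ▸ Algebra.mem_top)
  · exact exists_coord_of_mem_adjoin ht (hgen' ▸ Algebra.mem_top)
  · simpa using norm_add_mul_add_mul_sq h3 hθ' hgen a b c

end PureCubic

section PureCubic
variable {L : Type} [Field L] [NumberField L]

lemma CubicTower.IsRadicand.rat_pow_three_ne {D p ℓ f : ℕ} (hr : CubicTower.IsRadicand D p ℓ f) (q : ℚ) : q ^ 3 ≠ D := by
  intro h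
  have : Fact p.Prime := ⟨hr.hp⟩
  have h1 := congrArg (padicValRat p) h
  have hℓ : ℓ ^ f ≠ 0 := pow_ne_zero _ hr.hℓ.ne_zero
  rw [padicValRat.pow, padicValRat.of_nat, hr.hD, padicValNat.mul hr.hp.ne_zero hℓ, padicValNat_self,
    padicValNat.eq_zero_of_not_dvd hr.not_dvd] at h1
  omega

theorem primaryComponent_three_of_root [Fact (Nat.Prime 3)] {θ : L} {D p ℓ f : ℕ} (hr : CubicTower.IsRadicand D p ℓ f)
    (hf : f = 0 ∨ ¬ 3 ∣ f) (hθ : θ ^ 3 = D) (hgen : Algebra.adjoin ℚ {θ} = ⊤) :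
    Nat.card (CommGroup.primaryComponent (ClassGroup (𝓞 L)) 3) = 3 ∧
      IsCyclic (CommGroup.primaryComponent (ClassGroup (𝓞 L)) 3) := by
  have : IsCyclotomicExtension {3} ℚ (CyclotomicField 3 ℚ) := by
    convert CyclotomicField.isCyclotomicExtension 3 ℚ
    · rfl
    · exact Subsingleton.elim _ _
  obtain ⟨ι⟩ := IsCyclotomicExtension.nonempty_algHom (K := ℚ) (C := CyclotomicField 3 ℚ)
    (IsCyclotomicExtension.zeta_spec 3 L (CyclotomicField 3 L))
  let := ι.toRingHom.toAlgebra
  obtain ⟨T, hT⟩ := exists_cubicTower (K := CyclotomicField 3 ℚ) (k := CyclotomicField 3 L) hθ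
    hr.rat_pow_three_ne hgen
  exact T.primaryComponent_three_of_isRadicand (by rw [hT]; exact hr) hf

theorem primaryComponent_three_of_root_sq [Fact (Nat.Prime 3)] {θ : L} {D p ℓ f : ℕ}
    (hr : CubicTower.IsRadicand D p ℓ (2 * f)) (hf : f = 0 ∨ ¬ 3 ∣ f) (hθ : θ ^ 3 = p ^ 2 * ℓ ^ f)
    (hgen : Algebra.adjoin ℚ {θ} = ⊤) :
    Nat.card (CommGroup.primaryComponent (ClassGroup (𝓞 L)) 3) = 3 ∧
      IsCyclic (CommGroup.primaryComponent (ClassGroup (𝓞 L)) 3) := by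
  have hp : (p : L) ≠ 0 := by exact_mod_cast hr.hp.ne_zero
  have hℓ : (ℓ : L) ≠ 0 := by exact_mod_cast hr.hℓ.ne_zero
  refine primaryComponent_three_of_root (θ := θ ^ 2 / p) hr (by omega) ?_ ?_
  · rw [hr.hD, div_pow, pow_right_comm, hθ]
    push_cast
    field_simp
    ring
  · have h1 : θ = ((ℓ ^ f : ℚ)⁻¹) • (θ ^ 2 / p) ^ 2 := by
      rw [Algebra.smul_def]
      simp only [eq_ratCast]
      push_cast
      field_simp
      linear_combination -θ * hθ
    rw [eq_top_iff, ← hgen]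
    refine Algebra.adjoin_le (Set.singleton_subset_iff.2 ?_)
    have h2 : ((ℓ ^ f : ℚ)⁻¹) • (θ ^ 2 / p) ^ 2 ∈ Algebra.adjoin ℚ {θ ^ 2 / (p : L)} :=
      Subalgebra.smul_mem _ (pow_mem (Algebra.self_mem_adjoin_singleton _ _) 2) _
    rwa [← h1] at h2

theorem primaryComponent_three_of_pow_three_eq [Fact (Nat.Prime 3)] {θ : L} (hgen : Algebra.adjoin ℚ {θ} = ⊤)
    {p ℓ e f : ℕ} (hp : p.Prime) (hp9 : p % 9 = 4 ∨ p % 9 = 7) (hℓ : ℓ.Prime) (he : e = 1 ∨ e = 2) (hf : f = 0 ∨ ¬ 3 ∣ f)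
    (hθ : θ ^ 3 = (p ^ e * ℓ ^ f : ℕ))
    (hcases : ℓ = 3 ∨ ℓ % 3 = 2 ∧ ((p ^ e * ℓ ^ f) % 9 = 1 ∨ (p ^ e * ℓ ^ f) % 9 = 8)) :
    Nat.card (CommGroup.primaryComponent (ClassGroup (𝓞 L)) 3) = 3 ∧
      IsCyclic (CommGroup.primaryComponent (ClassGroup (𝓞 L)) 3) := by
  rcases he with rfl | rfl
  · rw [pow_one] at hθ hcases
    exact primaryComponent_three_of_root ⟨hp, hp9, hℓ, rfl, hcases⟩ hf hθ hgen
  · refine primaryComponent_three_of_root_sq ⟨hp, hp9, hℓ, rfl, hcases.imp_right fun h ↦ ⟨h.1, Or.inl ?_⟩⟩ hf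
      (by exact_mod_cast hθ) hgen
    have h1 : (p ^ 3 * (p * ℓ ^ (2 * f))) % 9 = 1 := by
      rw [show p ^ 3 * (p * ℓ ^ (2 * f)) = (p ^ 2 * ℓ ^ f) ^ 2 by ring, Nat.pow_mod]
      rcases h.2 with h | h <;> rw [h]
    have h2 : p ^ 3 % 9 = 1 := by
      rw [Nat.pow_mod]
      rcases hp9 with h | h <;> rw [h]
    rw [Nat.mul_mod, h2] at h1
    simpa using h1

end PureCubic

end

/-- For the listed forms of the radicand `d`, the `3`-class group of the pure cubic field
`L = ℚ(∛d)` is cyclic of order `3`. -/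
theorem three_class_group_cyclic_of_order_three
    (d : ℕ) (hd : 1 < d) (hdcf : IsCubeFree d)
    (hform :
      ((∃ p e₁ : ℕ, p.Prime ∧ (p % 9 = 4 ∨ p % 9 = 7) ∧ (e₁ = 1 ∨ e₁ = 2) ∧ d = p ^ e₁) ∨
      (∃ p e e₁ : ℕ, p.Prime ∧ (p % 9 = 4 ∨ p % 9 = 7) ∧ (e = 1 ∨ e = 2) ∧
        (e₁ = 1 ∨ e₁ = 2) ∧ d = 3 ^ e * p ^ e₁) ∨
      (∃ p q e₁ f₁ : ℕ, p.Prime ∧ q.Prime ∧ (p % 9 = 4 ∨ p % 9 = 7) ∧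
        (q % 9 = 2 ∨ q % 9 = 5) ∧ (e₁ = 1 ∨ e₁ = 2) ∧ (f₁ = 1 ∨ f₁ = 2) ∧
        d = p ^ e₁ * q ^ f₁ ∧ (d % 9 = 1 ∨ d % 9 = 8)))) :
    Nat.card ↥(CommGroup.primaryComponent (ClassGroup (𝓞 ↥(Lc d))) 3) = 3 ∧
    IsCyclic ↥(CommGroup.primaryComponent (ClassGroup (𝓞 ↥(Lc d))) 3) := by
  have hp3 : Nat.Prime 3 := Nat.prime_three
  have hθ : AdjoinSimple.gen ℚ (cbrt d) ^ 3 = d := by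
    ext
    simpa using cbrt_pow_three d
  have hgen : Algebra.adjoin ℚ {AdjoinSimple.gen ℚ (cbrt d)} = ⊤ :=
    (adjoin.powerBasis (isIntegral_cbrt d)).adjoin_gen_eq_top
  rcases hform with ⟨p, e, hp, hp9, he, rfl⟩ | ⟨p, f, e, hp, hp9, hf, he, rfl⟩ |
    ⟨p, q, e, f, hp, hq, hp9, hq9, he, hf, rfl, hd9⟩
  · exact primaryComponent_three_of_pow_three_eq (L := Lc (p ^ e)) hgen hp hp9 hp3 (f := 0) he (Or.inl rfl)
      (hθ.trans (congrArg Nat.cast (by simp))) (Or.inl rfl)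
  · exact primaryComponent_three_of_pow_three_eq (L := Lc (3 ^ f * p ^ e)) hgen hp hp9 hp3 (f := f) he (by omega)
      (hθ.trans (congrArg Nat.cast (mul_comm _ _))) (Or.inl rfl)
  · exact primaryComponent_three_of_pow_three_eq (L := Lc (p ^ e * q ^ f)) hgen hp hp9 hq he (by omega) hθ
      (Or.inr ⟨by omega, hd9⟩)

end
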